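/- arXiv:2501.11476 — 4 statements merged into one kernel-verified Lean document; each statement's English description precedes it below -/
import Mathlib

section
/- For any ball B̃ = B(x̃, r̃) ⊂ 𝕋², there exist constants C > 1 (depending only on A) and N(B̃) ≥ 1 such that for all n ≥ N(B̃), the number of n-periodic points of T in B̃ satisfies C^{−1} r̃² H_n ≤ #(B̃ ∩ P_n) ≤ C r̃² H_n, where H_n = ∏_j |λ_jⁿ − 1|. -/
noncomputable def intVec (z : Fin 2 → ℤ) : EuclideanSpace ℝ (Fin 2) :=
  (WithLp.equiv 2 (Fin 2 → ℝ)).symm fun i => (z i : ℝ)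

/-- The lift to `ℝ²` of the set `P_n = (Aⁿ - I)⁻¹ ℤ² (mod 1)` of `n`-periodic
points of `T x = A x (mod 1)`. -/
noncomputable def periodicLift (A : Matrix (Fin 2) (Fin 2) ℤ) (n : ℕ) :
    Set (EuclideanSpace ℝ (Fin 2)) :=
  {x | ∃ z : Fin 2 → ℤ,
    Matrix.toEuclideanLin ((A ^ n).map (Int.cast : ℤ → ℝ) - 1) x = intVec z}

open MeasureTheory Module

theorem encard_ball_inter_le_of_dense {E : Type*} [NormedAddCommGroup E] (L : AddSubgroup E)
    {ε : ℝ} (hL : ∀ x, ∃ z ∈ L, dist z x < ε) (x y : E) (r : ℝ) :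
    (Metric.ball x r ∩ (L : Set E)).encard ≤ (Metric.ball y (r + ε) ∩ (L : Set E)).encard := by
  obtain ⟨z, hz, hzd⟩ := hL (y - x)
  rw [← (add_left_injective z).encard_image]
  refine Set.encard_le_encard ?_
  rintro _ ⟨g, ⟨hg, hgL⟩, rfl⟩
  refine ⟨?_, L.add_mem hgL hz⟩
  rw [Metric.mem_ball, dist_eq_norm] at *
  rw [show g + z - y = (g - x) + (z - (y - x)) by abel]
  exact (norm_add_le _ _).trans_lt (add_lt_add hg hzd)

section LatticeCounting

variable {E ι : Type*} [NormedAddCommGroup E] [NormedSpace ℝ E] [MeasurableSpace E] [BorelSpace E]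

/-- The measure of a set is the average number of lattice points in its translates. -/
theorem measure_eq_lintegral_encard [Finite ι] (b : Basis ι ℝ E) (μ : Measure E)
    [μ.IsAddHaarMeasure] {S : Set E} (hS : MeasurableSet S) :
    μ S = ∫⁻ x in ZSpan.fundamentalDomain b,
      (({g : E | g ∈ Submodule.span ℤ (Set.range b) ∧ g + x ∈ S}.encard : ℕ∞) : ENNReal) ∂μ := by
  have hF := ZSpan.isAddFundamentalDomain' b μ
  have : Countable (Submodule.span ℤ (Set.range b)).toAddSubgroup :=
    inferInstanceAs (Countable (Submodule.span ℤ (Set.range b)))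
  have hmeas : Measurable (S.indicator (1 : E → ENNReal)) := measurable_one.indicator hS
  rw [← lintegral_indicator_one hS, hF.lintegral_eq_tsum'', ← lintegral_tsum fun g =>
    show AEMeasurable (fun x => S.indicator (1 : E → ENNReal) (g +ᵥ x)) _ from
      (hmeas.comp (measurable_const_vadd g)).aemeasurable]
  refine lintegral_congr fun x => ?_
  have himage : {g : E | g ∈ Submodule.span ℤ (Set.range b) ∧ g + x ∈ S} =
      Subtype.val '' {g : (Submodule.span ℤ (Set.range b)).toAddSubgroup | (g : E) + x ∈ S} := by
    ext g
    simp [and_comm]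
  rw [himage, Subtype.val_injective.encard_image, ← ENNReal.tsum_set_one,
    tsum_subtype _ (fun _ => (1 : ENNReal))]
  exact tsum_congr fun g => by
    simp only [Set.indicator, Set.mem_ofPred_eq, AddSubgroup.vadd_def, vadd_eq_add, Pi.one_apply]

/-- The ball-counting function of the pullback of a lattice averages to the volume of the image
of the ball. -/
theorem measure_image_ball_eq_lintegral [Finite ι] (b : Basis ι ℝ E) (μ : Measure E)
    [μ.IsAddHaarMeasure] (f : E ≃L[ℝ] E) (ρ : ℝ) :
    μ (f '' Metric.ball 0 ρ) = ∫⁻ x in ZSpan.fundamentalDomain b,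
      (((Metric.ball (-f.symm x) ρ ∩
        f ⁻¹' (Submodule.span ℤ (Set.range b) : Set E)).encard : ℕ∞) : ENNReal) ∂μ := by
  rw [measure_eq_lintegral_encard b μ (f.isOpenMap _ Metric.isOpen_ball).measurableSet]
  refine lintegral_congr fun x => ?_
  rw [← f.injective.encard_image (Metric.ball _ _ ∩ _)]
  congr 2
  ext g
  constructor
  · rintro ⟨hg, y, hy, hyx⟩
    refine ⟨f.symm g, ⟨?_, by simpa using hg⟩, by simp⟩
    have : y = f.symm g + f.symm x := by
      rw [← map_add, ← f.symm_apply_apply y]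
      exact congrArg _ hyx
    rw [mem_ball_zero_iff, this] at hy
    rwa [Metric.mem_ball, dist_eq_norm, sub_neg_eq_add]
  · rintro ⟨h, ⟨hh, hL⟩, rfl⟩
    refine ⟨hL, h + f.symm x, ?_, by simp⟩
    rwa [Metric.mem_ball, dist_eq_norm, sub_neg_eq_add, ← mem_ball_zero_iff] at hh

theorem measure_image_ball_eq [FiniteDimensional ℝ E] (μ : Measure E) [μ.IsAddHaarMeasure]
    (f : E ≃L[ℝ] E) {ρ : ℝ} (hρ : 0 < ρ) :
    μ (f '' Metric.ball 0 ρ) = ENNReal.ofReal (|LinearMap.det (f : E →ₗ[ℝ] E)| *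
      (ρ ^ finrank ℝ E * μ.real (Metric.ball 0 1))) := by
  have h := μ.addHaar_image_linearMap (f : E →ₗ[ℝ] E) (Metric.ball 0 ρ)
  rw [ENNReal.ofReal_mul (abs_nonneg _), ENNReal.ofReal_mul (by positivity),
    ofReal_measureReal measure_ball_lt_top.ne, ← μ.addHaar_ball_of_pos 0 hρ, ← h]
  rfl

theorem ncard_ball_inter_bounds [Finite ι] (b : Basis ι ℝ E)
    (μ : Measure E) [μ.IsAddHaarMeasure] (f : E ≃L[ℝ] E) {r : ℝ} (hr : 0 < r)
    (hL : ∀ x, ∃ z ∈ f ⁻¹' (Submodule.span ℤ (Set.range b) : Set E), dist z x < r / 2) (x : E) :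
    |LinearMap.det (f : E →ₗ[ℝ] E)| * ((r / 2) ^ finrank ℝ E * μ.real (Metric.ball 0 1)) ≤
        (Metric.ball x r ∩ f ⁻¹' (Submodule.span ℤ (Set.range b) : Set E)).ncard *
          μ.real (ZSpan.fundamentalDomain b) ∧
      (Metric.ball x r ∩ f ⁻¹' (Submodule.span ℤ (Set.range b) : Set E)).ncard *
          μ.real (ZSpan.fundamentalDomain b) ≤
        |LinearMap.det (f : E →ₗ[ℝ] E)| *
          ((r + r / 2) ^ finrank ℝ E * μ.real (Metric.ball 0 1)) := by
  have : FiniteDimensional ℝ E := b.finiteDimensional_of_finite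
  let L : AddSubgroup E :=
    (Submodule.span ℤ (Set.range b)).toAddSubgroup.comap (f : E →+ E)
  have hcoe : f ⁻¹' (Submodule.span ℤ (Set.range b) : Set E) = (L : Set E) := rfl
  have htop : μ (ZSpan.fundamentalDomain b) ≠ ⊤ :=
    (ZSpan.fundamentalDomain_isBounded b).measure_lt_top.ne
  have hne : μ (ZSpan.fundamentalDomain b) ≠ 0 := ZSpan.measure_fundamentalDomain_ne_zero b
  have hlow : μ (f '' Metric.ball 0 (r / 2)) ≤
      ((Metric.ball x r ∩ (L : Set E)).encard : ENNReal) * μ (ZSpan.fundamentalDomain b) := by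
    rw [measure_image_ball_eq_lintegral b, hcoe, ← setLIntegral_const]
    refine lintegral_mono fun y => ?_
    have := encard_ball_inter_le_of_dense L hL (-f.symm y) x (r / 2)
    rw [add_halves] at this
    exact ENat.toENNReal_le.2 this
  have hup : ((Metric.ball x r ∩ (L : Set E)).encard : ENNReal) * μ (ZSpan.fundamentalDomain b) ≤
      μ (f '' Metric.ball 0 (r + r / 2)) := by
    rw [measure_image_ball_eq_lintegral b, hcoe, ← setLIntegral_const]
    refine lintegral_mono fun y => ?_
    exact ENat.toENNReal_le.2 (encard_ball_inter_le_of_dense L hL x (-f.symm y) r)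
  rw [measure_image_ball_eq μ f (by positivity)] at hlow hup
  have hfin : (Metric.ball x r ∩ (L : Set E)).Finite := by
    rw [← Set.encard_ne_top_iff]
    intro h
    rw [h, ENat.toENNReal_top, ENNReal.top_mul hne] at hup
    exact ENNReal.ofReal_ne_top (top_le_iff.1 hup)
  have heq : ((Metric.ball x r ∩ (L : Set E)).encard : ENNReal) * μ (ZSpan.fundamentalDomain b) =
      ENNReal.ofReal ((Metric.ball x r ∩ (L : Set E)).ncard *
        μ.real (ZSpan.fundamentalDomain b)) := by
    rw [← hfin.cast_ncard_eq, ENNReal.ofReal_mul (by positivity), ofReal_measureReal htop]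
    simp
  rw [heq] at hlow hup
  rw [hcoe]
  exact ⟨(ENNReal.ofReal_le_ofReal_iff (by positivity)).1 hlow,
    (ENNReal.ofReal_le_ofReal_iff (by positivity)).1 hup⟩

end LatticeCounting

/-- Integer points come within `δ` of every line of irrational slope `γ`, at a bounded distance
from any prescribed point of the line. -/
theorem exists_int_pair_near {γ : ℝ} (hγ : Irrational γ) (γ' : ℝ) {δ : ℝ} (hδ : 0 < δ) :
    ∃ B : ℝ, 0 < B ∧ ∀ a b : ℝ, ∃ p q : ℤ,
      |(q - γ * p) - (b - γ * a)| < δ ∧ |(q - γ' * p) - (b - γ' * a)| < B := by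
  let U : ℕ → Set (ℝ × ℝ) := fun k => ⋃ z : ℤ × ℤ,
    {v | |(z.2 - γ * z.1) - (v.2 - γ * v.1)| < δ ∧ |(z.2 - γ' * z.1) - (v.2 - γ' * v.1)| < k}
  have hopen : ∀ k, IsOpen (U k) := fun k => isOpen_iUnion fun z => by
    simp only [Set.ofPred_and]
    exact (isOpen_lt (by fun_prop) continuous_const).inter
      (isOpen_lt (by fun_prop) continuous_const)
  have hmono : Monotone U := fun k l hkl => Set.iUnion_mono fun z v hv =>
    ⟨hv.1, hv.2.trans_le (by exact_mod_cast hkl)⟩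
  have hdense : Dense (AddSubgroup.closure {γ, 1} : Set ℝ) :=
    dense_addSubgroupClosure_pair_iff.2 (by simpa using hγ)
  have hcover : Set.Icc (0 : ℝ) 1 ×ˢ Set.Icc (0 : ℝ) 1 ⊆ ⋃ k, U k := by
    intro v _
    obtain ⟨t, ht, htd⟩ := hdense.exists_dist_lt (v.2 - γ * v.1) hδ
    obtain ⟨m, n, rfl⟩ := AddSubgroup.mem_closure_pair.1 ht
    obtain ⟨k, hk⟩ := exists_nat_gt |((n : ℝ) - γ' * (-m : ℤ)) - (v.2 - γ' * v.1)|
    refine Set.mem_iUnion.2 ⟨k, Set.mem_iUnion.2 ⟨(-m, n), ?_, hk⟩⟩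
    rw [dist_comm, Real.dist_eq] at htd
    convert htd using 2
    simp
    ring
  obtain ⟨k, hk⟩ := (isCompact_Icc.prod isCompact_Icc).elim_directed_cover U hopen hcover
    hmono.directed_le
  refine ⟨k + 1, by positivity, fun a b => ?_⟩
  have hmem : (Int.fract a, Int.fract b) ∈ Set.Icc (0 : ℝ) 1 ×ˢ Set.Icc (0 : ℝ) 1 :=
    ⟨⟨Int.fract_nonneg a, (Int.fract_lt_one a).le⟩, ⟨Int.fract_nonneg b, (Int.fract_lt_one b).le⟩⟩
  obtain ⟨z, h1, h2⟩ := Set.mem_iUnion.1 (hk hmem)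
  refine ⟨z.1 + ⌊a⌋, z.2 + ⌊b⌋, ?_, ?_⟩
  · convert h1 using 2
    simp only [Int.fract]
    push_cast
    ring
  · refine lt_of_eq_of_lt (congrArg _ ?_) (h2.trans (lt_add_one _))
    simp only [Int.fract]
    push_cast
    ring

/-- Left eigenvectors of `A` diagonalize `Aⁿ - 1` for every `n`. -/
theorem exists_diagonalizing_slope (A : Matrix (Fin 2) (Fin 2) ℤ) (l₁ l₂ γ : ℝ)
    (hsum : l₁ + l₂ = (A.trace : ℝ)) (hprod : l₁ * l₂ = (A.det : ℝ))
    (h0 : 0 < |l₁|) (h1 : |l₁| < 1) (h2 : 1 < |l₂|)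
    (hγ : (A.map (Int.cast : ℤ → ℝ)).mulVec ![1, γ] = l₂ • ![1, γ]) :
    ∃ γ' : ℝ, γ ≠ γ' ∧ ∀ n : ℕ,
      !![-γ, 1; -γ', 1] * ((A ^ n).map (Int.cast : ℤ → ℝ) - 1) =
        Matrix.diagonal ![l₁ ^ n - 1, l₂ ^ n - 1] * !![-γ, 1; -γ', 1] := by
  have e0 : (A 0 0 : ℝ) + A 0 1 * γ = l₂ := by
    simpa [Matrix.mulVec, dotProduct] using congrFun hγ 0
  have e1 : (A 1 0 : ℝ) + A 1 1 * γ = l₂ * γ := by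
    simpa [Matrix.mulVec, dotProduct] using congrFun hγ 1
  rw [Matrix.trace_fin_two] at hsum
  rw [Matrix.det_fin_two] at hprod
  push_cast at hsum hprod
  have hb : (A 0 1 : ℝ) ≠ 0 := by
    intro hb
    have hl : l₁ = (A 1 1 : ℝ) := by linear_combination hsum + e0 - γ * hb
    rw [hl] at h0 h1
    norm_cast at h0 h1
    omega
  have hne : l₁ ≠ l₂ := by
    rintro rfl
    exact h1.not_gt h2
  have hγ' : ((l₁ - A 0 0) / A 0 1 : ℝ) * A 0 1 = l₁ - A 0 0 := div_mul_cancel₀ _ hb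
  generalize ((l₁ - A 0 0) / A 0 1 : ℝ) = γ' at hγ'
  have e2 : (A 1 0 : ℝ) + A 1 1 * γ' = l₁ * γ' := by
    apply mul_right_cancel₀ hb
    linear_combination (A 1 1 - l₁ : ℝ) * hγ' - l₁ * hsum + hprod
  refine ⟨γ', ?_, fun n => ?_⟩
  · rintro rfl
    exact hne (by linear_combination e0 - hγ')
  · have hbase : !![-γ, 1; -γ', 1] * A.map (Int.cast : ℤ → ℝ) =
        Matrix.diagonal ![l₁, l₂] * !![-γ, 1; -γ', 1] := by
      ext i j
      fin_cases i <;> fin_cases j <;> simp [Matrix.mul_apply, Matrix.diagonal_apply]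
      · linear_combination e1 + γ * hsum
      · linear_combination -e0 - hsum
      · linear_combination e2 + γ' * hsum
      · linear_combination -hγ' - hsum
    have hmap : (A ^ n).map (Int.cast : ℤ → ℝ) = A.map (Int.cast : ℤ → ℝ) ^ n :=
      map_pow (Int.castRingHom ℝ).mapMatrix A n
    have hpow : !![-γ, 1; -γ', 1] * A.map (Int.cast : ℤ → ℝ) ^ n =
        Matrix.diagonal ![l₁, l₂] ^ n * !![-γ, 1; -γ', 1] :=
      (show SemiconjBy _ _ _ from hbase).pow_right n
    rw [mul_sub, hmap, hpow, Matrix.diagonal_pow, mul_one]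
    ext i j
    fin_cases i <;> fin_cases j <;> simp [Matrix.mul_apply, Matrix.diagonal_apply] <;> ring

theorem euclidean_norm_le_slope_coordinates {γ γ' : ℝ} (h : γ ≠ γ')
    (u : EuclideanSpace ℝ (Fin 2)) :
    ‖u‖ ≤ ((1 + |γ|) / |γ - γ'| + 1) * (|u 1 - γ * u 0| + |u 1 - γ' * u 0|) := by
  have hd : 0 < |γ - γ'| := abs_pos.2 (sub_ne_zero.2 h)
  have hnorm : ‖u‖ ≤ |u 0| + |u 1| := by
    rw [EuclideanSpace.norm_eq, Fin.sum_univ_two, Real.norm_eq_abs, Real.norm_eq_abs]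
    exact Real.sqrt_le_iff.2 ⟨by positivity, by nlinarith [abs_nonneg (u 0), abs_nonneg (u 1)]⟩
  have hu0 : |u 0| ≤ (|u 1 - γ * u 0| + |u 1 - γ' * u 0|) / |γ - γ'| := by
    rw [le_div_iff₀ hd, ← abs_mul]
    refine le_of_eq_of_le ?_ (abs_sub (u 1 - γ * u 0) (u 1 - γ' * u 0))
    rw [← abs_neg]
    congr 1
    ring
  have hu1 : |u 1| ≤ |u 1 - γ * u 0| + |γ| * |u 0| := by
    rw [← abs_mul]
    refine le_of_eq_of_le ?_ (abs_add_le _ _)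
    congr 1
    ring
  calc ‖u‖ ≤ (1 + |γ|) * |u 0| + |u 1 - γ * u 0| := by linarith
    _ ≤ (1 + |γ|) * ((|u 1 - γ * u 0| + |u 1 - γ' * u 0|) / |γ - γ'|) +
        (|u 1 - γ * u 0| + |u 1 - γ' * u 0|) := by
      gcongr
      exact le_add_of_nonneg_right (abs_nonneg _)
    _ = _ := by ring

theorem periodicLift_eq_preimage (A : Matrix (Fin 2) (Fin 2) ℤ) (n : ℕ) :
    periodicLift A n = Matrix.toEuclideanLin ((A ^ n).map (Int.cast : ℤ → ℝ) - 1) ⁻¹'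
      (Submodule.span ℤ (Set.range (EuclideanSpace.basisFun (Fin 2) ℝ).toBasis) :
        Set (EuclideanSpace ℝ (Fin 2))) := by
  ext x
  simp only [periodicLift, Set.mem_ofPred_eq, Set.mem_preimage, SetLike.mem_coe,
    Basis.mem_span_iff_repr_mem, OrthonormalBasis.coe_toBasis_repr_apply,
    EuclideanSpace.basisFun_repr, Set.mem_range, algebraMap_int_eq, eq_intCast]
  constructor
  · rintro ⟨z, hz⟩ i
    exact ⟨z i, by rw [hz]; rfl⟩
  · intro h
    choose z hz using h
    exact ⟨z, by ext i; exact (hz i).symm⟩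

/-- For large `n` the `n`-periodic points are `ε`-dense. -/
theorem periodicLift_eventually_dense (A : Matrix (Fin 2) (Fin 2) ℤ) {l₁ l₂ γ γ' : ℝ}
    (h1 : |l₁| < 1) (h2 : 1 < |l₂|) (hγirr : Irrational γ) (hne : γ ≠ γ')
    (hdiag : ∀ n : ℕ, !![-γ, 1; -γ', 1] * ((A ^ n).map (Int.cast : ℤ → ℝ) - 1) =
        Matrix.diagonal ![l₁ ^ n - 1, l₂ ^ n - 1] * !![-γ, 1; -γ', 1])
    (hbij : ∀ n ≠ 0, Function.Surjective
      (Matrix.toEuclideanLin ((A ^ n).map (Int.cast : ℤ → ℝ) - 1)))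
    {ε : ℝ} (hε : 0 < ε) :
    ∃ N : ℕ, ∀ n ≥ N, ∀ x, ∃ z ∈ periodicLift A n, dist z x < ε := by
  have hd : 0 < |γ - γ'| := abs_pos.2 (sub_ne_zero.2 hne)
  set K := (1 + |γ|) / |γ - γ'| + 1
  have hKpos : 0 < K := by positivity
  have hl : 0 < 1 - |l₁| := sub_pos.2 h1
  obtain ⟨B, hB, hnear⟩ := exists_int_pair_near hγirr γ'
    (δ := ε / (2 * K) * (1 - |l₁|)) (by positivity)
  have hlarge : ∀ᶠ n : ℕ in Filter.atTop, B / (ε / (2 * K)) + 1 ≤ |l₂| ^ n :=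
    (tendsto_pow_atTop_atTop_of_one_lt h2).eventually_ge_atTop _
  obtain ⟨N, hN⟩ := Filter.eventually_atTop.1 (hlarge.and (Filter.eventually_ne_atTop 0))
  refine ⟨N, fun n hn x => ?_⟩
  obtain ⟨hn2, hn0⟩ := hN n hn
  set f := Matrix.toEuclideanLin ((A ^ n).map (Int.cast : ℤ → ℝ) - 1)
  obtain ⟨p, q, hp, hq⟩ := hnear (f x 0) (f x 1)
  obtain ⟨z, hz⟩ := hbij n hn0 (intVec ![p, q])
  refine ⟨z, ⟨_, hz⟩, ?_⟩
  have hfu : !![-γ, 1; -γ', 1].mulVec (f (z - x)).ofLp =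
      (Matrix.diagonal ![l₁ ^ n - 1, l₂ ^ n - 1]).mulVec
        (!![-γ, 1; -γ', 1].mulVec (z - x).ofLp) := by
    rw [Matrix.mulVec_mulVec, ← hdiag, ← Matrix.mulVec_mulVec]
    rfl
  have hz0 : f z 0 = p := by rw [hz]; rfl
  have hz1 : f z 1 = q := by rw [hz]; rfl
  have hc0 : (q - γ * p) - (f x 1 - γ * f x 0) =
      (l₁ ^ n - 1) * ((z - x) 1 - γ * (z - x) 0) := by
    have := congrFun hfu 0
    simp [Matrix.mulVec, dotProduct, Matrix.diagonal_apply, hz0, hz1]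
      at this ⊢
    linear_combination this
  have hc1 : (q - γ' * p) - (f x 1 - γ' * f x 0) =
      (l₂ ^ n - 1) * ((z - x) 1 - γ' * (z - x) 0) := by
    have := congrFun hfu 1
    simp [Matrix.mulVec, dotProduct, Matrix.diagonal_apply, hz0, hz1]
      at this ⊢
    linear_combination this
  rw [hc0, abs_mul] at hp
  rw [hc1, abs_mul] at hq
  have hm1 : 1 - |l₁| ≤ |l₁ ^ n - 1| := by
    have := abs_sub_abs_le_abs_sub 1 (l₁ ^ n)
    rw [abs_one, abs_pow, abs_sub_comm] at this
    linarith [pow_le_of_le_one (abs_nonneg l₁) h1.le hn0]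
  have hm2 : B / (ε / (2 * K)) ≤ |l₂ ^ n - 1| := by
    have := abs_sub_abs_le_abs_sub (l₂ ^ n) 1
    rw [abs_one, abs_pow] at this
    linarith
  have hu1 : |(z - x) 1 - γ * (z - x) 0| < ε / (2 * K) := by
    refine lt_of_mul_lt_mul_right (a := 1 - |l₁|) (lt_of_le_of_lt ?_ hp) hl.le
    rw [mul_comm]
    gcongr
  have hu2 : |(z - x) 1 - γ' * (z - x) 0| < ε / (2 * K) := by
    have hm2pos : 0 < |l₂ ^ n - 1| := lt_of_lt_of_le (by positivity) hm2
    refine lt_of_mul_lt_mul_left (a := |l₂ ^ n - 1|) (hq.trans_le ?_) hm2pos.le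
    rwa [div_le_iff₀ (by positivity)] at hm2
  rw [dist_eq_norm]
  calc ‖z - x‖ ≤ K * (|(z - x) 1 - γ * (z - x) 0| + |(z - x) 1 - γ' * (z - x) 0|) :=
        euclidean_norm_le_slope_coordinates hne _
    _ < K * (ε / (2 * K) + ε / (2 * K)) := by gcongr
    _ = ε := by field_simp; ring

theorem det_eq_of_diagonalizing_slope {γ γ' m₁ m₂ : ℝ} (hne : γ ≠ γ')
    (M : Matrix (Fin 2) (Fin 2) ℝ)
    (hdiag : !![-γ, 1; -γ', 1] * M = Matrix.diagonal ![m₁, m₂] * !![-γ, 1; -γ', 1]) :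
    M.det = m₁ * m₂ := by
  have hdet : !![-γ, 1; -γ', 1].det ≠ 0 := by
    rw [Matrix.det_fin_two_of]
    intro h
    exact hne (by linarith)
  have := congrArg Matrix.det hdiag
  rw [Matrix.det_mul, Matrix.det_mul, Matrix.det_diagonal, Fin.prod_univ_two, mul_comm] at this
  exact mul_right_cancel₀ hdet this

theorem det_toEuclideanLin (M : Matrix (Fin 2) (Fin 2) ℝ) :
    LinearMap.det (Matrix.toEuclideanLin M) = M.det := by
  rw [Matrix.toEuclideanLin_eq_toLin_orthonormal, LinearMap.det_toLin]

/-- For any ball `B(x̃, r̃)`, there are `C > 1` (depending only on `A`) and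
`N(B̃)` such that for `n ≥ N(B̃)` the number of `n`-periodic points in the ball
is between `C⁻¹ r̃² H_n` and `C r̃² H_n`, where `H_n = |λ₁ⁿ-1|·|λ₂ⁿ-1|`. -/
theorem card_periodicPts_in_ball (A : Matrix (Fin 2) (Fin 2) ℤ)
    (l₁ l₂ γ : ℝ)
    (hsum : l₁ + l₂ = (A.trace : ℝ)) (hprod : l₁ * l₂ = (A.det : ℝ))
    (h0 : 0 < |l₁|) (h1 : |l₁| < 1) (h2 : 1 < |l₂|)
    (hγ : (A.map (Int.cast : ℤ → ℝ)).mulVec ![1, γ] = l₂ • ![1, γ])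
    (hγirr : Irrational γ) :
    ∃ C : ℝ, 1 < C ∧ ∀ x : EuclideanSpace ℝ (Fin 2), ∀ r : ℝ, 0 < r →
      ∃ N : ℕ, ∀ n : ℕ, N ≤ n →
        C⁻¹ * r ^ 2 * (|l₁ ^ n - 1| * |l₂ ^ n - 1|)
            ≤ ((Metric.ball x r ∩ periodicLift A n).ncard : ℝ) ∧
        ((Metric.ball x r ∩ periodicLift A n).ncard : ℝ)
            ≤ C * r ^ 2 * (|l₁ ^ n - 1| * |l₂ ^ n - 1|) := by
  obtain ⟨γ', hne, hdiag⟩ := exists_diagonalizing_slope A l₁ l₂ γ hsum hprod h0 h1 h2 hγ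
  have hdet : ∀ n : ℕ, LinearMap.det
      (Matrix.toEuclideanLin ((A ^ n).map (Int.cast : ℤ → ℝ) - 1)) =
        (l₁ ^ n - 1) * (l₂ ^ n - 1) := fun n => by
    rw [det_toEuclideanLin, det_eq_of_diagonalizing_slope hne _ (hdiag n)]
  have hdet0 : ∀ n ≠ 0, LinearMap.det
      (Matrix.toEuclideanLin ((A ^ n).map (Int.cast : ℤ → ℝ) - 1)) ≠ 0 := fun n hn => by
    rw [hdet]
    refine mul_ne_zero (fun h => ?_) (fun h => ?_)
    · have := pow_lt_one₀ (abs_nonneg l₁) h1 hn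
      rw [← abs_pow, sub_eq_zero.1 h, abs_one] at this
      exact this.false
    · have := one_lt_pow₀ h2 hn
      rw [← abs_pow, sub_eq_zero.1 h, abs_one] at this
      exact this.false
  let b := (EuclideanSpace.basisFun (Fin 2) ℝ).toBasis
  set v := volume.real (Metric.ball (0 : EuclideanSpace ℝ (Fin 2)) 1) with hv
  set c := volume.real (ZSpan.fundamentalDomain b) with hc
  have hvpos : 0 < v :=
    ENNReal.toReal_pos (Metric.measure_ball_pos _ _ one_pos).ne' measure_ball_lt_top.ne
  have hcpos : 0 < c := ENNReal.toReal_pos (ZSpan.measure_fundamentalDomain_ne_zero b)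
    (ZSpan.fundamentalDomain_isBounded b).measure_lt_top.ne
  refine ⟨1 + 4 * c / v + 9 * v / (4 * c), ?_, fun x r hr => ?_⟩
  · have : 0 < 4 * c / v := by positivity
    have : 0 < 9 * v / (4 * c) := by positivity
    linarith
  obtain ⟨N, hN⟩ := periodicLift_eventually_dense A h1 h2 hγirr hne hdiag
    (fun n hn => (LinearMap.equivOfDetNeZero _ (hdet0 n hn)).surjective) (half_pos hr)
  refine ⟨N + 1, fun n hn => ?_⟩
  let f := (LinearMap.equivOfDetNeZero _ (hdet0 n (by omega))).toContinuousLinearEquiv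
  have hpre : periodicLift A n = f ⁻¹' (Submodule.span ℤ (Set.range b) : Set _) :=
    periodicLift_eq_preimage A n
  have hbounds := ncard_ball_inter_bounds b volume f hr
    (by rw [← hpre]; exact hN n (by omega)) x
  have hfdet : LinearMap.det (f : EuclideanSpace ℝ (Fin 2) →ₗ[ℝ] EuclideanSpace ℝ (Fin 2)) =
      (l₁ ^ n - 1) * (l₂ ^ n - 1) := hdet n
  rw [← hpre, hfdet, abs_mul, finrank_euclideanSpace_fin, ← hv, ← hc] at hbounds
  obtain ⟨hlow, hup⟩ := hbounds
  generalize ((Metric.ball x r ∩ periodicLift A n).ncard : ℝ) = k at hlow hup ⊢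
  have hH : 0 ≤ |l₁ ^ n - 1| * |l₂ ^ n - 1| := by positivity
  generalize |l₁ ^ n - 1| * |l₂ ^ n - 1| = H at hlow hup hH ⊢
  constructor
  · calc (1 + 4 * c / v + 9 * v / (4 * c))⁻¹ * r ^ 2 * H ≤ (4 * c / v)⁻¹ * r ^ 2 * H := by
          gcongr
          have : 0 < 9 * v / (4 * c) := by positivity
          linarith
      _ = H * ((r / 2) ^ 2 * v) / c := by field_simp; ring
      _ ≤ k := (div_le_iff₀ hcpos).2 hlow
  · calc k ≤ H * ((r + r / 2) ^ 2 * v) / c := (le_div_iff₀ hcpos).2 hup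
      _ = (9 * v / (4 * c)) * r ^ 2 * H := by field_simp; ring
      _ ≤ (1 + 4 * c / v + 9 * v / (4 * c)) * r ^ 2 * H := by
          gcongr
          have : 0 < 4 * c / v := by positivity
          linarith
end

section
/- If s > 2log|λ₂|/(τ + log|λ₂|), then the Hausdorff s-measure of R_τ is zero; consequently dim_H R_τ ≤ 2log|λ₂|/(τ + log|λ₂|). -/
open Filter MeasureTheory

/-- The lift to `ℝ²` of the recurrence set
`R_τ = {x ∈ 𝕋² : Tⁿx ∈ B(x, e^{-nτ}) for infinitely many n}`, where
`T x = A x (mod 1)`:  `Tⁿx ∈ B(x, e^{-nτ})` iff `‖Aⁿx - x - z‖ < e^{-nτ}`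
for some `z ∈ ℤ²`. -/
noncomputable def recSet (A : Matrix (Fin 2) (Fin 2) ℤ) (τ : ℝ) :
    Set (EuclideanSpace ℝ (Fin 2)) :=
  {x | ∃ᶠ n : ℕ in atTop, ∃ z : Fin 2 → ℤ,
    ‖Matrix.toEuclideanLin ((A ^ n).map (Int.cast : ℤ → ℝ)) x - x - intVec z‖
      < Real.exp (-(n : ℝ) * τ)}

/-- A limsup set has vanishing `s`-dimensional Hausdorff measure as soon as its members admit
finite coverings whose `s`-volumes are summable. -/
theorem hausdorffMeasure_frequently_eq_zero {X ι : Type*} [EMetricSpace X] [MeasurableSpace X]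
    [BorelSpace X] [Countable ι] {s : ℝ} (hs : 0 < s) (E : ℕ → Set X) (c d : ℕ → ENNReal)
    (hd : Antitone d) (hd0 : Tendsto d atTop (nhds 0))
    (hsum : ∑' n, c n * d n ^ s ≠ ⊤)
    (hcov : ∀ n, ∃ (F : Finset ι) (S : ι → Set X), E n ⊆ ⋃ i ∈ F, S i ∧
      (∀ i, Metric.ediam (S i) ≤ d n) ∧ (F.card : ENNReal) ≤ c n) :
    μH[s] {x | ∃ᶠ n in atTop, x ∈ E n} = 0 := by
  classical
  choose F S hES hdiam hcard using hcov
  let t : ℕ → ℕ × ι → Set X := fun N p => if p.2 ∈ F (p.1 + N) then S (p.1 + N) p.2 else ∅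
  have htle : ∀ N, ∑' p, Metric.ediam (t N p) ^ s ≤ ∑' k, c (k + N) * d (k + N) ^ s := by
    intro N
    rw [ENNReal.tsum_prod']
    refine ENNReal.tsum_le_tsum fun k => ?_
    rw [tsum_eq_sum (s := F (k + N))]
    · calc ∑ i ∈ F (k + N), Metric.ediam (t N (k, i)) ^ s
          ≤ ∑ _i ∈ F (k + N), d (k + N) ^ s := by
            refine Finset.sum_le_sum fun i hi => ENNReal.rpow_le_rpow ?_ hs.le
            simpa [t, hi] using hdiam (k + N) i
        _ = (F (k + N)).card * d (k + N) ^ s := by simp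
        _ ≤ c (k + N) * d (k + N) ^ s := by gcongr; exact hcard _
    · intro i hi
      simp [t, hi, hs]
  have hlim : Tendsto (fun N => ∑' p, Metric.ediam (t N p) ^ s) atTop (nhds 0) :=
    tendsto_of_tendsto_of_tendsto_of_le_of_le tendsto_const_nhds
      (ENNReal.tendsto_sum_nat_add _ hsum) (fun _ => zero_le) htle
  have key := Measure.hausdorffMeasure_le_liminf_tsum s {x | ∃ᶠ n in atTop, x ∈ E n}
    d hd0 t ?_ ?_
  · rw [hlim.liminf_eq] at key
    exact le_antisymm key zero_le
  · refine Eventually.of_forall fun N p => ?_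
    by_cases hp : p.2 ∈ F (p.1 + N)
    · simp only [t, hp, if_true]
      exact (hdiam _ _).trans (hd (Nat.le_add_left _ _))
    · simp [t, hp]
  · refine Eventually.of_forall fun N x hx => ?_
    obtain ⟨n, hn, hxn⟩ := frequently_atTop.1 hx N
    obtain ⟨i, hi, hxi⟩ := Set.mem_iUnion₂.1 (hES n hxn)
    refine Set.mem_iUnion.2 ⟨(n - N, i), ?_⟩
    simpa [t, Nat.sub_add_cancel hn, hi] using hxi

theorem norm_le_abs_add_abs (w : EuclideanSpace ℝ (Fin 2)) : ‖w‖ ≤ |w 0| + |w 1| := by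
  rw [EuclideanSpace.norm_eq, Fin.sum_univ_two, Real.norm_eq_abs, Real.norm_eq_abs]
  refine Real.sqrt_le_iff.2 ⟨by positivity, ?_⟩
  nlinarith [mul_nonneg (abs_nonneg (w 0)) (abs_nonneg (w 1))]

/-- The linear form `x ↦ p x₀ + q x₁` on the plane. -/
noncomputable def planeForm (p q : ℝ) : EuclideanSpace ℝ (Fin 2) →L[ℝ] ℝ :=
  p • EuclideanSpace.proj 0 + q • EuclideanSpace.proj 1

theorem planeForm_apply (p q : ℝ) (x : EuclideanSpace ℝ (Fin 2)) :
    planeForm p q x = p * x 0 + q * x 1 := by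
  simp [planeForm]

/-- The plane norm is dominated by two linear forms with distinct slopes. -/
theorem exists_norm_le_planeForm {p q q' : ℝ} (hp : p ≠ 0) (hq : q ≠ q') :
    ∃ C, 0 ≤ C ∧ ∀ w : EuclideanSpace ℝ (Fin 2),
      ‖w‖ ≤ C * (|planeForm p q w| + |planeForm p q' w|) := by
  have hqq : q - q' ≠ 0 := sub_ne_zero.2 hq
  refine ⟨(1 + (|q| + |q'|)/ |p|) / |q - q'|, by positivity, fun w => ?_⟩
  set a := planeForm p q w with ha
  set b := planeForm p q' w with hb
  rw [planeForm_apply] at ha hb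
  have h1 : w 1 = (a - b) / (q - q') := by rw [ha, hb]; field_simp; ring
  have h0 : w 0 = (q * b - q' * a) / p / (q - q') := by rw [ha, hb]; field_simp; ring
  have e0 : |w 0| ≤ ((|q| + |q'|) * (|a| + |b|)) / |p| / |q - q'| := by
    rw [h0, abs_div, abs_div]
    gcongr
    calc |q * b - q' * a| ≤ |q * b| + |q' * a| := abs_sub _ _
      _ ≤ _ := by
        rw [abs_mul, abs_mul]
        nlinarith [mul_nonneg (abs_nonneg q) (abs_nonneg a),
          mul_nonneg (abs_nonneg q') (abs_nonneg b)]
  have e1 : |w 1| ≤ (|a| + |b|) / |q - q'| := by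
    rw [h1, abs_div]
    gcongr
    exact abs_sub _ _
  calc ‖w‖ ≤ |w 0| + |w 1| := norm_le_abs_add_abs w
    _ ≤ _ := add_le_add e0 e1
    _ = _ := by ring

theorem card_Icc_neg_floor_le {t : ℝ} (ht : 0 ≤ t) :
    ((Finset.Icc (-⌊t⌋) ⌊t⌋).card : ℝ) ≤ 2 * t + 1 := by
  have h0 : 0 ≤ ⌊t⌋ := Int.floor_nonneg.2 ht
  have h1 : (((Finset.Icc (-⌊t⌋) ⌊t⌋).card : ℤ) : ℝ) = 2 * ⌊t⌋ + 1 := by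
    rw [Int.card_Icc, Int.toNat_of_nonneg (by omega)]
    push_cast
    ring
  have := Int.floor_le t
  rw [Int.cast_natCast] at h1
  linarith

theorem mem_Icc_neg_floor {t : ℝ} {i : ℤ} (h : |(i : ℝ)| ≤ t) :
    i ∈ Finset.Icc (-⌊t⌋) ⌊t⌋ := by
  have := abs_le.1 h
  rw [Finset.mem_Icc, neg_le]
  exact ⟨Int.le_floor.2 (by push_cast; linarith), Int.le_floor.2 this.2⟩

theorem abs_floor_le (x : ℝ) : |(⌊x⌋ : ℝ)| ≤ |x| + 1 := by
  have h1 := Int.floor_le x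
  have h2 := Int.lt_floor_add_one x
  have := neg_abs_le x
  have := le_abs_self x
  exact abs_le.2 ⟨by linarith, by linarith⟩

/-- Suppose `M` acts on the linear forms `φ`, `ψ` by factors comparable to `1` and to `L`. Then the
points of a bounded region that `M` brings `ε`-close to the integer lattice are covered by `O(L²)`
sets of diameter `O(ε / L)`. -/
theorem exists_cover_near_lattice {p q q' : ℝ} (hp : p ≠ 0) (hq : q ≠ 0) (hqq : q ≠ q')
    {c : ℝ} (hc : 0 < c) {R : ℝ} (hR : 0 ≤ R) :
    ∃ N D : ℝ, 0 ≤ N ∧ 0 ≤ D ∧ ∀ (α β ε L : ℝ)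
      (M : EuclideanSpace ℝ (Fin 2) → EuclideanSpace ℝ (Fin 2)),
      1 ≤ L → 0 < ε → ε ≤ 1 → c ≤ |α| → |α| ≤ 2 → c * L ≤ |β| → |β| ≤ 2 * L →
      (∀ x, planeForm p q (M x) = α * planeForm p q x) →
      (∀ x, planeForm p q' (M x) = β * planeForm p q' x) →
      ∃ (F : Finset (ℤ × ℤ × ℤ)) (S : ℤ × ℤ × ℤ → Set (EuclideanSpace ℝ (Fin 2))),
        {x | ∃ z, ‖M x - intVec z‖ < ε} ∩ Metric.closedBall 0 R ⊆ ⋃ i ∈ F, S i ∧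
        (∀ i, Metric.ediam (S i) ≤ ENNReal.ofReal (D * (ε / L))) ∧ (F.card : ℝ) ≤ N * L ^ 2 := by
  obtain ⟨C, hC0, hC⟩ := exists_norm_le_planeForm hp hqq
  set φ := planeForm p q with hφ
  set ψ := planeForm p q' with hψ
  set P := ‖φ‖
  set Q := ‖ψ‖
  have hP0 : 0 ≤ P := norm_nonneg _
  have hQ0 : 0 ≤ Q := norm_nonneg _
  have hφle : ∀ w, |φ w| ≤ P * ‖w‖ := fun w => φ.le_opNorm w
  have hψle : ∀ w, |ψ w| ≤ Q * ‖w‖ := fun w => ψ.le_opNorm w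
  set a₁ := C * ((2 * P * R + P) + (2 * Q * R + Q)) with ha₁
  set a₂ := (2 * P * R + P) / |q| + 1 with ha₂
  set a₃ := P / c + 1 with ha₃
  have h1 : 0 ≤ a₁ := by positivity
  have h2 : 0 ≤ a₂ := by positivity
  have h3 : 0 ≤ a₃ := by positivity
  refine ⟨(2 * a₁ + 1) * (2 * a₂ + 1) * (2 * a₃ + 1), C * (1 + 2 * Q / c), by positivity,
    by positivity, ?_⟩
  intro α β ε L M hL hε hε1 hα hα2 hβ hβ2 hMφ hMψ
  have hL0 : 0 < L := by linarith
  have hα0 : 0 < |α| := by linarith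
  have hαne : α ≠ 0 := abs_pos.1 hα0
  let row : ℤ → ℤ := fun i => ⌊-(p / q) * i⌋
  let cell : EuclideanSpace ℝ (Fin 2) → (Fin 2 → ℤ) → ℤ := fun x z =>
    ⌊(φ x - φ (intVec z) / α) * (L / ε)⌋
  have hz0 : ∀ z i, intVec z i = z i := fun z i => rfl
  refine ⟨Finset.Icc (-⌊a₁ * L⌋) ⌊a₁ * L⌋ ×ˢ Finset.Icc (-⌊a₂⌋) ⌊a₂⌋ ×ˢ
      Finset.Icc (-⌊a₃ * L⌋) ⌊a₃ * L⌋,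
    fun i => {x | ∃ z, ‖M x - intVec z‖ < ε ∧ z 0 = i.1 ∧ z 1 - row i.1 = i.2.1 ∧
      cell x z = i.2.2}, ?_, ?_, ?_⟩
  · rintro x ⟨⟨z, hz⟩, hx⟩
    rw [mem_closedBall_zero_iff] at hx
    refine Set.mem_iUnion₂.2 ⟨(z 0, z 1 - row (z 0), cell x z), ?_, z, hz, rfl, rfl, rfl⟩
    have hφx : |φ x| ≤ P * R := (hφle x).trans (by gcongr)
    have hψx : |ψ x| ≤ Q * R := (hψle x).trans (by gcongr)
    have dφ : |α * φ x - φ (intVec z)| ≤ P * ε := by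
      rw [← hMφ, ← map_sub]
      exact (hφle _).trans (by gcongr)
    have dψ : |β * ψ x - ψ (intVec z)| ≤ Q * ε := by
      rw [← hMψ, ← map_sub]
      exact (hψle _).trans (by gcongr)
    have bφ : |φ (intVec z)| ≤ 2 * P * R + P := by
      have : |φ (intVec z)| ≤ |α * φ x| + |α * φ x - φ (intVec z)| := by
        simpa using abs_sub (α * φ x) (α * φ x - φ (intVec z))
      have h4 : |α * φ x| ≤ 2 * (P * R) := by rw [abs_mul]; gcongr
      have h5 : P * ε ≤ P * 1 := by gcongr
      linarith
    have bψ : |ψ (intVec z)| ≤ (2 * Q * R + Q) * L := by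
      have : |ψ (intVec z)| ≤ |β * ψ x| + |β * ψ x - ψ (intVec z)| := by
        simpa using abs_sub (β * ψ x) (β * ψ x - ψ (intVec z))
      have h4 : |β * ψ x| ≤ 2 * L * (Q * R) := by rw [abs_mul]; gcongr
      have h5 : Q * ε ≤ Q * L := by gcongr; linarith
      linarith
    simp only [Finset.mem_product]
    refine ⟨mem_Icc_neg_floor ?_, mem_Icc_neg_floor ?_, mem_Icc_neg_floor ?_⟩
    · have h4 : |((z 0 : ℤ) : ℝ)| ≤ ‖intVec z‖ := by
        simpa [hz0] using PiLp.norm_apply_le (intVec z) 0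
      have h5 : 2 * P * R + P ≤ (2 * P * R + P) * L :=
        le_mul_of_one_le_right (by positivity) hL
      calc _ ≤ _ := h4
        _ ≤ _ := hC _
        _ ≤ C * ((2 * P * R + P) * L + (2 * Q * R + Q) * L) := by
          gcongr
          exact bφ.trans h5
        _ = a₁ * L := by rw [ha₁]; ring
    · have h4 : φ (intVec z) / q = z 1 - (-(p / q) * z 0) := by
        rw [hφ, planeForm_apply, hz0, hz0]; field_simp; ring
      have h5 : |φ (intVec z) / q| ≤ (2 * P * R + P) / |q| := by
        rw [abs_div]; gcongr
      have h6 := Int.floor_le (-(p / q) * (z 0 : ℝ))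
      have h7 := Int.lt_floor_add_one (-(p / q) * (z 0 : ℝ))
      rw [h4] at h5
      have h8 := abs_le.1 h5
      push_cast
      simp only [row]
      rw [ha₂]
      exact abs_le.2 ⟨by linarith, by linarith⟩
    · refine (abs_floor_le _).trans ?_
      have h4 : (φ x - φ (intVec z) / α) = (α * φ x - φ (intVec z)) / α := by
        field_simp
      rw [h4, abs_mul, abs_div, abs_of_pos (div_pos hL0 hε)]
      calc |α * φ x - φ (intVec z)| / |α| * (L / ε) + 1
          ≤ P * ε / c * (L / ε) + L := by gcongr
        _ = a₃ * L := by rw [ha₃]; field_simp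
  · intro i
    refine Metric.ediam_le fun x hx y hy => ?_
    obtain ⟨z, hzx, h0, h1', hcx⟩ := hx
    obtain ⟨z', hzy, h0', h1'', hcy⟩ := hy
    obtain rfl : z = z' := by
      ext j
      fin_cases j
      · exact h0.trans h0'.symm
      · have := h1'.trans h1''.symm
        simpa using this
    rw [edist_le_ofReal (by positivity), dist_eq_norm]
    have e1 : |φ (x - y)| ≤ ε / L := by
      have h4 := Int.abs_sub_lt_one_of_floor_eq_floor (hcx.trans hcy.symm)
      rw [← sub_mul, abs_mul, abs_of_pos (div_pos hL0 hε)] at h4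
      have h5 : φ (x - y) = φ x - φ (intVec z) / α - (φ y - φ (intVec z) / α) := by
        rw [map_sub]; ring
      rw [h5, le_div_iff₀ hL0]
      rw [mul_div_assoc', div_lt_one hε] at h4
      exact h4.le
    have e2 : |ψ (x - y)| ≤ 2 * Q / c * (ε / L) := by
      have h4 : β * ψ (x - y) = ψ ((M x - intVec z) - (M y - intVec z)) := by
        simp only [map_sub, hMψ]; ring
      have h5 : |β * ψ (x - y)| ≤ Q * (ε + ε) := by
        rw [h4]
        refine (hψle _).trans ?_
        gcongr
        exact (norm_sub_le _ _).trans (by gcongr)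
      rw [abs_mul] at h5
      have h6 : c * L * |ψ (x - y)| ≤ Q * (ε + ε) := le_trans (by gcongr) h5
      have h7 : 2 * Q / c * (ε / L) = Q * (ε + ε) / (c * L) := by field_simp; ring
      rw [h7, le_div_iff₀ (by positivity)]
      linarith
    calc ‖x - y‖ ≤ _ := hC _
      _ ≤ C * (ε / L + 2 * Q / c * (ε / L)) := by gcongr
      _ = _ := by ring
  · rw [Finset.card_product, Finset.card_product]
    push_cast
    calc _ ≤ (2 * (a₁ * L) + 1) * ((2 * a₂ + 1) * (2 * (a₃ * L) + 1)) := by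
          gcongr <;> exact card_Icc_neg_floor_le (by positivity)
      _ ≤ (2 * (a₁ * L) + L) * ((2 * a₂ + 1) * (2 * (a₃ * L) + L)) := by gcongr
      _ = _ := by ring

/-- A linear form given by a left eigenvector of `A` is scaled by `l ^ n` under `A ^ n`. -/
theorem planeForm_toEuclideanLin_pow (A : Matrix (Fin 2) (Fin 2) ℤ) {p q l : ℝ}
    (h0 : p * A 0 0 + q * A 1 0 = l * p) (h1 : p * A 0 1 + q * A 1 1 = l * q) (n : ℕ)
    (x : EuclideanSpace ℝ (Fin 2)) :
    planeForm p q (Matrix.toEuclideanLin ((A ^ n).map (Int.cast : ℤ → ℝ)) x)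
      = l ^ n * planeForm p q x := by
  have key : ∀ n : ℕ, p * (A ^ n) 0 0 + q * (A ^ n) 1 0 = l ^ n * p ∧
      p * (A ^ n) 0 1 + q * (A ^ n) 1 1 = l ^ n * q := by
    intro n
    induction n with
    | zero => simp
    | succ n ih =>
      simp only [pow_succ', Matrix.mul_apply, Fin.sum_univ_two, Int.cast_add, Int.cast_mul]
      constructor
      · linear_combination ((A ^ n) 0 0 : ℝ) * h0 + ((A ^ n) 1 0 : ℝ) * h1 + l * ih.1
      · linear_combination ((A ^ n) 0 1 : ℝ) * h0 + ((A ^ n) 1 1 : ℝ) * h1 + l * ih.2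
  obtain ⟨k0, k1⟩ := key n
  simp only [planeForm_apply, Matrix.toLpLin_apply, Matrix.mulVec, dotProduct,
    Fin.sum_univ_two, Matrix.map_apply]
  linear_combination x 0 * k0 + x 1 * k1

theorem ne_intCast_of_abs_lt_one {l : ℝ} (h0 : 0 < |l|) (h1 : |l| < 1) (k : ℤ) : l ≠ k := by
  rintro rfl
  rw [← Int.cast_abs] at h0 h1
  have : 0 < |k| := by exact_mod_cast h0
  have : |k| < 1 := by exact_mod_cast h1
  omega

/-- The part of the recurrence set in a bounded region has measure zero above the critical
exponent. -/
theorem hausdorffMeasure_recSet_inter_closedBall (A : Matrix (Fin 2) (Fin 2) ℤ)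
    (l₁ l₂ : ℝ) (hsum : l₁ + l₂ = (A.trace : ℝ)) (hprod : l₁ * l₂ = (A.det : ℝ))
    (h0 : 0 < |l₁|) (h1 : |l₁| < 1) (h2 : 1 < |l₂|) (τ : ℝ) (hτ : 0 < τ)
    {s : ℝ} (hs : 2 * Real.log |l₂| / (τ + Real.log |l₂|) < s) {R : ℝ} (hR : 0 ≤ R) :
    μH[s] (recSet A τ ∩ Metric.closedBall 0 R) = 0 := by
  rw [Matrix.trace_fin_two] at hsum
  rw [Matrix.det_fin_two] at hprod
  push_cast at hsum hprod
  have hlog : 0 < Real.log |l₂| := Real.log_pos h2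
  have hl₂ : 0 < |l₂| := by linarith
  have hs0 : 0 < s := lt_of_le_of_lt (by positivity) hs
  have hne := ne_intCast_of_abs_lt_one h0 h1
  have hp : (A 1 0 : ℝ) ≠ 0 := by
    intro hc
    have : (l₁ - A 0 0) * (l₁ - A 1 1) = 0 := by
      linear_combination l₁ * hsum - hprod + (A 0 1 : ℝ) * hc
    rcases mul_eq_zero.1 this with h | h
    · exact hne _ (sub_eq_zero.1 h)
    · exact hne _ (sub_eq_zero.1 h)
  have hq : l₁ - A 0 0 ≠ 0 := sub_ne_zero.2 (hne _)
  have hqq : l₁ - A 0 0 ≠ l₂ - A 0 0 := by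
    intro h
    have : l₁ = l₂ := by linarith
    rw [this] at h1
    linarith
  have hc : 0 < min (1 - |l₁|) (1 - |l₂|⁻¹) :=
    lt_min (by linarith) (by linarith [inv_lt_one_of_one_lt₀ h2])
  obtain ⟨N, D, hN, hD, hcover⟩ := exists_cover_near_lattice hp hq hqq hc hR
  set ρ := Real.exp (-τ) / |l₂| with hρ
  have hρ0 : 0 < ρ := by positivity
  have hρ1 : ρ < 1 := by
    rw [hρ, div_lt_one hl₂]
    exact (Real.exp_lt_one_iff.2 (by linarith)).trans h2
  set E : ℕ → Set (EuclideanSpace ℝ (Fin 2)) := fun n =>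
    {x | ∃ z, ‖Matrix.toEuclideanLin ((A ^ (n + 1)).map (Int.cast : ℤ → ℝ)) x - x - intVec z‖
      < Real.exp (-((n + 1 : ℕ) : ℝ) * τ)} ∩ Metric.closedBall 0 R
  have hsub : recSet A τ ∩ Metric.closedBall 0 R ⊆ {x | ∃ᶠ n in atTop, x ∈ E n} := by
    rintro x ⟨hx, hxR⟩
    refine frequently_atTop.2 fun n => ?_
    obtain ⟨m, hm, hxm⟩ := frequently_atTop.1 hx (n + 1)
    obtain ⟨k, rfl⟩ : ∃ k, m = k + 1 := ⟨m - 1, by omega⟩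
    exact ⟨k, by omega, hxm, hxR⟩
  refine measure_mono_null hsub ?_
  refine hausdorffMeasure_frequently_eq_zero (ι := ℤ × ℤ × ℤ) hs0 E
    (fun n => ENNReal.ofReal (N * (|l₂| ^ (n + 1)) ^ 2))
    (fun n => ENNReal.ofReal (D * ρ ^ (n + 1))) ?_ ?_ ?_ ?_
  · intro m n hmn
    refine ENNReal.ofReal_le_ofReal ?_
    gcongr ?_ * ?_
    exact pow_le_pow_of_le_one hρ0.le hρ1.le (by omega)
  · have := ((tendsto_pow_atTop_nhds_zero_of_lt_one hρ0.le hρ1).comp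
      (tendsto_add_atTop_nat 1)).const_mul D
    simpa using ENNReal.tendsto_ofReal this
  · have hr : |l₂| ^ 2 * ρ ^ s < 1 := by
      rw [← Real.log_neg_iff (by positivity), Real.log_mul (by positivity) (by positivity),
        Real.log_pow, Real.log_rpow hρ0, hρ, Real.log_div (by positivity) (by positivity),
        Real.log_exp]
      rw [div_lt_iff₀ (by positivity)] at hs
      push_cast
      linarith
    have hterm : ∀ n : ℕ, ENNReal.ofReal (N * (|l₂| ^ (n + 1)) ^ 2) *
        ENNReal.ofReal (D * ρ ^ (n + 1)) ^ s =
        ENNReal.ofReal (N * D ^ s * (|l₂| ^ 2 * ρ ^ s) ^ (n + 1)) := by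
      intro n
      rw [ENNReal.ofReal_rpow_of_nonneg (by positivity) hs0.le,
        ← ENNReal.ofReal_mul (by positivity), Real.mul_rpow hD (by positivity),
        ← Real.rpow_pow_comm hρ0.le, mul_pow (|l₂| ^ 2), ← pow_mul, ← pow_mul,
        mul_comm 2 (n + 1)]
      congr 1
      ring
    simp_rw [hterm]
    refine Summable.tsum_ofReal_ne_top ?_
    exact (((summable_geometric_of_lt_one (by positivity) hr).comp_injective
      (add_left_injective 1)).mul_left _)
  · intro n
    set m := n + 1
    have hLL : |l₂| ≤ |l₂| ^ m := le_self_pow₀ h2.le (by omega)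
    have hL : 1 ≤ |l₂| ^ m := h2.le.trans hLL
    have hl₁m : |l₁ ^ m| ≤ |l₁| := by
      rw [abs_pow]
      exact pow_le_of_le_one h0.le h1.le (by omega)
    have hε : Real.exp (-(m : ℝ) * τ) ≤ 1 := by
      have : 0 ≤ (m : ℝ) * τ := by positivity
      exact Real.exp_le_one_iff.2 (by linarith)
    have hα : min (1 - |l₁|) (1 - |l₂|⁻¹) ≤ |l₁ ^ m - 1| := by
      refine (min_le_left _ _).trans ?_
      have := abs_sub_abs_le_abs_sub 1 (l₁ ^ m)
      rw [abs_one, abs_sub_comm] at this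
      linarith
    have hα2 : |l₁ ^ m - 1| ≤ 2 := by
      have := abs_sub (l₁ ^ m) 1
      rw [abs_one] at this
      linarith
    have hβ : min (1 - |l₁|) (1 - |l₂|⁻¹) * |l₂| ^ m ≤ |l₂ ^ m - 1| := by
      have h3 := abs_sub_abs_le_abs_sub (l₂ ^ m) 1
      rw [abs_one, abs_pow] at h3
      have h4 : 1 ≤ |l₂|⁻¹ * |l₂| ^ m := by
        rw [inv_mul_eq_div, le_div_iff₀ hl₂]
        linarith
      calc _ ≤ (1 - |l₂|⁻¹) * |l₂| ^ m := by gcongr; exact min_le_right _ _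
        _ ≤ _ := by linarith
    have hβ2 : |l₂ ^ m - 1| ≤ 2 * |l₂| ^ m := by
      have := abs_sub (l₂ ^ m) 1
      rw [abs_one, abs_pow] at this
      linarith
    obtain ⟨F, S, hFS, hS, hF⟩ := hcover (l₁ ^ m - 1) (l₂ ^ m - 1)
      (Real.exp (-(m : ℝ) * τ)) (|l₂| ^ m)
      (fun x => Matrix.toEuclideanLin ((A ^ m).map (Int.cast : ℤ → ℝ)) x - x)
      hL (Real.exp_pos _) hε hα hα2 hβ hβ2
      (fun x => by
        rw [map_sub, planeForm_toEuclideanLin_pow A (l := l₁) (by ring)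
          (by linear_combination hprod - l₁ * hsum)]
        ring)
      (fun x => by
        rw [map_sub, planeForm_toEuclideanLin_pow A (l := l₂) (by ring)
          (by linear_combination hprod - l₂ * hsum)]
        ring)
    refine ⟨F, S, hFS, fun i => (hS i).trans_eq ?_, ?_⟩
    · rw [hρ, div_pow, ← Real.exp_nat_mul, neg_mul, mul_neg]
    · rw [← ENNReal.ofReal_natCast]
      exact ENNReal.ofReal_le_ofReal hF

/-- If `s > 2log|λ₂|/(τ + log|λ₂|)` then the `s`-dimensional Hausdorff measure of `R_τ` is
zero; consequently `dim_H R_τ ≤ 2log|λ₂|/(τ + log|λ₂|)`. -/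
theorem hausdorffMeasure_recSet_eq_zero (A : Matrix (Fin 2) (Fin 2) ℤ)
    (l₁ l₂ : ℝ)
    (hsum : l₁ + l₂ = (A.trace : ℝ)) (hprod : l₁ * l₂ = (A.det : ℝ))
    (h0 : 0 < |l₁|) (h1 : |l₁| < 1) (h2 : 1 < |l₂|)
    (τ : ℝ) (hτ : 0 < τ) :
    (∀ s : ℝ, 2 * Real.log |l₂| / (τ + Real.log |l₂|) < s → μH[s] (recSet A τ) = 0) ∧
    dimH (recSet A τ) ≤ ENNReal.ofReal (2 * Real.log |l₂| / (τ + Real.log |l₂|)) := by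
  have hmeas : ∀ s : ℝ, 2 * Real.log |l₂| / (τ + Real.log |l₂|) < s →
      μH[s] (recSet A τ) = 0 := by
    intro s hs
    rw [← Set.inter_univ (recSet A τ), ← Metric.iUnion_closedBall_nat 0, Set.inter_iUnion]
    exact measure_iUnion_null fun k => hausdorffMeasure_recSet_inter_closedBall A l₁ l₂ hsum
      hprod h0 h1 h2 τ hτ hs k.cast_nonneg
  refine ⟨hmeas, dimH_le fun d hd => ?_⟩
  by_contra! hlt
  rw [← ENNReal.ofReal_coe_nnreal] at hlt
  rw [hmeas d (lt_of_not_ge fun h => hlt.not_ge (ENNReal.ofReal_le_ofReal h))] at hd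
  exact ENNReal.zero_ne_top hd
end

section
/- dim_H R_τ = min{ 2log|λ₂|/(τ + log|λ₂|), log|λ₂|/τ }. -/
open Filter MeasureTheory

theorem hausdorffMeasure_iInter_ne_zero {X : Type*} [MetricSpace X] [MeasurableSpace X]
    [BorelSpace X] {V : ℕ → Set X} (hV : Antitone V) (hVc : ∀ k, IsCompact (V k))
    (μ : ℕ → Measure X) (hμ : ∀ k, 1 ≤ μ k (V k)) {C t : ℝ} (ht : 0 < t)
    (hF : ∀ k x ρ, 0 < ρ → μ k (Metric.closedBall x ρ) ≤ ENNReal.ofReal (C * ρ ^ t)) :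
    Measure.hausdorffMeasure t (⋂ k, V k) ≠ 0 := by
  intro h0
  set c := ENNReal.ofReal C with hc
  set q : ENNReal := 2 ^ t with hq
  have hq_top : q ≠ ⊤ := by rw [hq]; simp
  set K := c * (q + 1) with hK
  have hK_top : K ≠ ⊤ := ENNReal.mul_ne_top ENNReal.ofReal_ne_top (by simp [hq_top])
  set δ : ENNReal := (K + 1)⁻¹ with hδ
  have hδ0 : δ ≠ 0 := by simp [hδ, hK_top]
  have hKδ : K * δ < 1 := by
    rw [hδ, ← div_eq_mul_inv]
    refine ENNReal.div_lt_of_lt_mul ?_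
    rw [one_mul]
    exact ENNReal.lt_add_right hK_top one_ne_zero
  obtain ⟨ε, hε0, hε⟩ := ENNReal.exists_pos_sum_of_countable hδ0 ℕ
  have hcov : (⨅ (s : ℕ → Set X) (_ : (⋂ k, V k) ⊆ ⋃ n, s n)
      (_ : ∀ n, Metric.ediam (s n) ≤ 1), ∑' n, ⨆ _ : (s n).Nonempty, Metric.ediam (s n) ^ t) < δ := by
    refine lt_of_le_of_lt ?_ (pos_iff_ne_zero.2 hδ0)
    rw [← h0, Measure.hausdorffMeasure_apply]
    exact le_iSup₂_of_le (1 : ENNReal) one_pos le_rfl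
  simp only [iInf_lt_iff] at hcov
  obtain ⟨s, hs, hs1, hsum⟩ := hcov
  have hfin : ∀ n, Metric.ediam (s n) ≠ ⊤ := fun n => ((hs1 n).trans_lt ENNReal.one_lt_top).ne
  set ρ : ℕ → ℝ := fun n => max (2 * (Metric.ediam (s n)).toReal) ((ε n : ℝ) ^ t⁻¹) with hρ
  have hρpos : ∀ n, 0 < ρ n := fun n =>
    lt_max_of_lt_right (Real.rpow_pos_of_pos (hε0 n) _)
  have hρt : ∀ n, ENNReal.ofReal (C * ρ n ^ t) ≤ c * (q * Metric.ediam (s n) ^ t + ε n) := by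
    intro n
    rw [ENNReal.ofReal_mul' (by have := hρpos n; positivity)]
    gcongr
    have h1 : ENNReal.ofReal ((2 * (Metric.ediam (s n)).toReal) ^ t)
        = q * Metric.ediam (s n) ^ t := by
      rw [← ENNReal.ofReal_rpow_of_nonneg (by positivity) ht.le, ENNReal.ofReal_mul (by norm_num),
        ENNReal.ofReal_toReal (hfin n), ENNReal.mul_rpow_of_nonneg _ _ ht.le]
      simp [hq]
    have h2 : ENNReal.ofReal (((ε n : ℝ) ^ t⁻¹) ^ t) = ε n := by
      rw [Real.rpow_inv_rpow (by positivity) ht.ne', ENNReal.ofReal_coe_nnreal]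
    rcases max_choice (2 * (Metric.ediam (s n)).toReal) ((ε n : ℝ) ^ t⁻¹) with h | h
    · simp only [hρ, h, h1]; exact le_self_add
    · simp only [hρ, h, h2]; exact le_add_self
  set U : ℕ → Set X := fun n => ⋃ h : (s n).Nonempty, Metric.ball h.some (ρ n) with hU
  have hUo : IsOpen (⋃ n, U n) :=
    isOpen_iUnion fun n => isOpen_iUnion fun _ => Metric.isOpen_ball
  have hsU : ∀ n, s n ⊆ U n := by
    intro n x hx
    have hne : (s n).Nonempty := ⟨x, hx⟩
    refine Set.mem_iUnion.2 ⟨hne, ?_⟩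
    rw [Metric.mem_ball]
    have h1 : dist x hne.some ≤ (Metric.ediam (s n)).toReal := by
      rw [dist_edist]
      exact ENNReal.toReal_mono (hfin n) (Metric.edist_le_ediam_of_mem hx hne.some_mem)
    rcases h1.eq_or_lt with h | h
    · rcases (ENNReal.toReal_nonneg (a := Metric.ediam (s n))).eq_or_lt with h' | h'
      · rw [h, ← h']; exact hρpos n
      · exact lt_max_of_lt_left (by linarith)
    · exact lt_max_of_lt_left (by linarith [ENNReal.toReal_nonneg (a := Metric.ediam (s n))])
  obtain ⟨k, hk⟩ := exists_subset_nhds_of_isCompact' (directed_of_isDirected_le hV) hVc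
    (fun k => (hVc k).isClosed) (U := ⋃ n, U n)
    (fun x hx => hUo.mem_nhds (by
      obtain ⟨n, hn⟩ := Set.mem_iUnion.1 (hs hx)
      exact Set.mem_iUnion.2 ⟨n, hsU n hn⟩))
  have hμU : ∀ n, μ k (U n) ≤
      c * (q * (⨆ _ : (s n).Nonempty, Metric.ediam (s n) ^ t) + ε n) := by
    intro n
    by_cases h : (s n).Nonempty
    · simp only [hU, h, Set.iUnion_true, iSup_pos]
      exact (measure_mono Metric.ball_subset_closedBall).trans ((hF k _ _ (hρpos n)).trans (hρt n))
    · simp [hU, h]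
  have : (1 : ENNReal) < 1 := calc
    1 ≤ μ k (V k) := hμ k
    _ ≤ μ k (⋃ n, U n) := measure_mono hk
    _ ≤ ∑' n, μ k (U n) := measure_iUnion_le _
    _ ≤ ∑' n, c * (q * (⨆ _ : (s n).Nonempty, Metric.ediam (s n) ^ t) + ε n) :=
      ENNReal.tsum_le_tsum hμU
    _ = c * (q * (∑' n, ⨆ _ : (s n).Nonempty, Metric.ediam (s n) ^ t) + ∑' n, (ε n : ENNReal)) := by
      rw [ENNReal.tsum_mul_left, ENNReal.tsum_add, ENNReal.tsum_mul_left]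
    _ ≤ c * (q * δ + δ) := by gcongr
    _ = K * δ := by rw [hK]; ring
    _ < 1 := hKδ
  exact lt_irrefl _ this

theorem dimH_frequently_le {X : Type*} [MetricSpace X] {L : Type*} [Nonempty L]
    {F : ℕ → Set X} {C p q : ℝ}
    (hC : 0 ≤ C) (hp : 0 ≤ p) (hq : 0 < q)
    (hF : ∀ᶠ n : ℕ in atTop, ∃ (T : Finset L) (f : X → L), (T.card : ℝ) ≤ C * Real.exp (n * p) ∧
      (∀ x ∈ F n, f x ∈ T) ∧
      ∀ x ∈ F n, ∀ y ∈ F n, f x = f y → dist x y ≤ C * Real.exp (-(n : ℝ) * q)) :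
    dimH {x | ∃ᶠ n in atTop, x ∈ F n} ≤ ENNReal.ofReal (p / q) := by
  borelize X
  refine le_of_forall_gt_imp_ge_of_dense fun d hd => ?_
  induction d with
  | top => exact le_top
  | coe d =>
  have hd' : p / q < d := by
    rw [← ENNReal.ofReal_coe_nnreal] at hd
    exact (ENNReal.ofReal_lt_ofReal_iff_of_nonneg (by positivity)).1 hd
  have hdpos : 0 < (d : ℝ) := lt_of_le_of_lt (by positivity) hd'
  have hpd : p - q * d < 0 := by rw [div_lt_iff₀ hq] at hd'; linarith
  refine dimH_le_of_hausdorffMeasure_ne_top (ne_top_of_le_ne_top ENNReal.zero_ne_top ?_)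
  obtain ⟨n₀, hn₀⟩ := eventually_atTop.1 hF
  choose! T f hT hfT hdist using hn₀
  set r : ℕ → ENNReal := fun n => ENNReal.ofReal (C * Real.exp (-(n : ℝ) * q)) with hr
  set a : ℕ → ENNReal := fun n =>
    ENNReal.ofReal (C * C ^ (d : ℝ) * Real.exp (p - q * d) ^ n) with ha
  have ha_sum : ∑' n, a n ≠ ⊤ := by
    have hs : Summable fun n : ℕ => C * C ^ (d : ℝ) * Real.exp (p - q * d) ^ n :=
      (summable_geometric_of_lt_one (Real.exp_pos _).le (by simpa using hpd)).mul_left _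
    rw [← ENNReal.ofReal_tsum_of_nonneg (fun n => by positivity) hs]
    exact ENNReal.ofReal_ne_top
  let t : ∀ N : ℕ, (Σ n : ℕ, T (n + N)) → Set X :=
    fun N i => {x | x ∈ F (i.1 + N) ∧ f (i.1 + N) x = i.2}
  have hdiam : ∀ N ≥ n₀, ∀ i, Metric.ediam (t N i) ≤ r (i.1 + N) := by
    intro N hN i
    refine Metric.ediam_le fun x hx y hy => ?_
    rw [edist_dist]
    exact ENNReal.ofReal_le_ofReal
      (hdist _ (by omega) x hx.1 y hy.1 (hx.2.trans hy.2.symm))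
  have hr0 : Tendsto r atTop (nhds 0) := by
    rw [← ENNReal.ofReal_zero]
    refine ENNReal.tendsto_ofReal ?_
    rw [← mul_zero C]
    refine Tendsto.const_mul C (Real.tendsto_exp_atBot.comp ?_)
    simp_rw [neg_mul]
    exact tendsto_neg_atTop_atBot.comp (tendsto_natCast_atTop_atTop.atTop_mul_const hq)
  have hr_anti : Antitone r := by
    intro m n hmn
    have : (m : ℝ) ≤ n := by exact_mod_cast hmn
    simp only [hr]
    gcongr
  have key := Measure.hausdorffMeasure_le_liminf_tsum (d : ℝ)
    {x | ∃ᶠ n in atTop, x ∈ F n} (l := atTop) r hr0 t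
    (by
      filter_upwards [eventually_ge_atTop n₀] with N hN i
      exact (hdiam N hN i).trans (hr_anti (Nat.le_add_left _ _)))
    (by
      filter_upwards [eventually_ge_atTop n₀] with N hN x hx
      obtain ⟨n, hn, hxn⟩ := frequently_atTop.1 hx N
      obtain ⟨m, rfl⟩ := Nat.exists_eq_add_of_le' hn
      exact Set.mem_iUnion.2 ⟨⟨m, ⟨f (m + N) x, hfT _ (by omega) x hxn⟩⟩, hxn, rfl⟩)
  refine key.trans ?_
  rw [← (ENNReal.tendsto_sum_nat_add a ha_sum).liminf_eq]
  refine liminf_le_liminf ?_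
  filter_upwards [eventually_ge_atTop n₀] with N hN
  rw [ENNReal.tsum_sigma']
  refine ENNReal.tsum_le_tsum fun n => ?_
  calc ∑' b : T (n + N), Metric.ediam (t N ⟨n, b⟩) ^ (d : ℝ)
      ≤ ∑' b : T (n + N), r (n + N) ^ (d : ℝ) :=
        ENNReal.tsum_le_tsum fun b => ENNReal.rpow_le_rpow (hdiam N hN ⟨n, b⟩) hdpos.le
    _ = (T (n + N)).card * r (n + N) ^ (d : ℝ) := by
        rw [tsum_fintype]; simp
    _ ≤ ENNReal.ofReal (C * Real.exp ((n + N : ℕ) * p)) * r (n + N) ^ (d : ℝ) := by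
        gcongr
        rw [← ENNReal.ofReal_natCast]
        exact ENNReal.ofReal_le_ofReal (hT _ (by omega))
    _ = a (n + N) := by
        simp only [hr, ha]
        rw [ENNReal.ofReal_rpow_of_nonneg (by positivity) hdpos.le,
          ← ENNReal.ofReal_mul (by positivity), Real.mul_rpow hC (Real.exp_pos _).le,
          ← Real.exp_mul, ← Real.exp_nat_mul]
        congr 1
        rw [mul_mul_mul_comm, ← Real.exp_add]
        congr 2
        push_cast
        ring

/-- The closed rectangle centred at `x` with half-sides `r` and `s`. -/
def box (x : ℝ × ℝ) (r s : ℝ) : Set (ℝ × ℝ) :=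
  Metric.closedBall x.1 r ×ˢ Metric.closedBall x.2 s

theorem mem_box {x y : ℝ × ℝ} {r s : ℝ} : y ∈ box x r s ↔ |y.1 - x.1| ≤ r ∧ |y.2 - x.2| ≤ s := by
  simp [box, Real.dist_eq]

theorem box_self (x : ℝ × ℝ) (r : ℝ) : box x r r = Metric.closedBall x r :=
  closedBall_prod_same _ _ _

theorem isCompact_box (x : ℝ × ℝ) (r s : ℝ) : IsCompact (box x r s) :=
  (isCompact_closedBall _ _).prod (isCompact_closedBall _ _)

theorem measurableSet_box (x : ℝ × ℝ) (r s : ℝ) : MeasurableSet (box x r s) :=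
  (isCompact_box x r s).measurableSet

theorem volume_box (x : ℝ × ℝ) {r : ℝ} (hr : 0 ≤ r) (s : ℝ) :
    volume (box x r s) = ENNReal.ofReal (4 * (r * s)) := by
  rw [box, Measure.volume_eq_prod, Measure.prod_prod, Real.volume_closedBall,
    Real.volume_closedBall, ← ENNReal.ofReal_mul (by positivity)]
  congr 1
  ring

theorem box_subset_interior {x : ℝ × ℝ} {r s r' s' : ℝ} (hr : r < r') (hs : s < s') :
    box x r s ⊆ interior (box x r' s') := by
  rw [box, box, interior_prod_eq]
  exact Set.prod_mono
    ((Metric.closedBall_subset_ball hr).trans Metric.ball_subset_interior_closedBall)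
    ((Metric.closedBall_subset_ball hs).trans Metric.ball_subset_interior_closedBall)

theorem volume_closedBall_inter_le (x y r s : ℝ) :
    volume (Metric.closedBall x r ∩ Metric.closedBall y s) ≤ ENNReal.ofReal (min (2 * r) (2 * s)) := by
  rcases min_choice (2 * r) (2 * s) with h | h <;> rw [h, ← Real.volume_closedBall]
  exacts [measure_mono Set.inter_subset_left, measure_mono Set.inter_subset_right]

theorem volume_box_inter_le (x y : ℝ × ℝ) {a ρ : ℝ} (b : ℝ) (ha : 0 ≤ a) (hρ : 0 ≤ ρ) :
    volume (box x a b ∩ box y ρ ρ) ≤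
      ENNReal.ofReal (min (2 * a) (2 * ρ) * min (2 * b) (2 * ρ)) := by
  rw [box, box, Set.prod_inter_prod, Measure.volume_eq_prod, Measure.prod_prod,
    ENNReal.ofReal_mul (le_min (by positivity) (by positivity))]
  exact mul_le_mul' (volume_closedBall_inter_le _ _ _ _) (volume_closedBall_inter_le _ _ _ _)

/-- Move the mass that `μ` gives to each cell of an `α × β` grid onto a smaller rectangle
inside that cell. -/
theorem exists_redistribution (μ : Measure (ℝ × ℝ)) {α β a b : ℝ} (hα : 0 < α)
    (hβ : 0 < β) (ha : 0 < a) (hb : 0 < b) (p : ℝ × ℝ → ℝ × ℝ)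
    (hp : ∀ q, box (p q) a b ⊆ box q (α / 2) (β / 2)) :
    ∃ ν : Measure (ℝ × ℝ), ν Set.univ = μ Set.univ ∧
      (∀ s, MeasurableSet s → ν s ≤ μ Set.univ * (ENNReal.ofReal (1 / (a * b)) * volume s)) ∧
      (∀ x ρ, 0 < ρ → ν (Metric.closedBall x ρ) ≤
        ENNReal.ofReal (min 1 (2 * ρ / a) * min 1 (2 * ρ / b)) * μ (box x (ρ + α) (ρ + β))) ∧
      ∀ K, IsCompact K → μ Kᶜ = 0 → ∃ J : Set (ℝ × ℝ), J.Finite ∧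
        (∀ q ∈ J, (box q (α / 2) (β / 2) ∩ K).Nonempty) ∧
        ν (⋃ q ∈ J, box (p q) (a / 2) (b / 2))ᶜ = 0 := by
  let c : ℤ × ℤ → ℝ × ℝ := fun i => ((i.1 + 1 / 2) * α, (i.2 + 1 / 2) * β)
  let g : ℝ × ℝ → ℤ × ℤ := fun x => (⌊x.1 / α⌋, ⌊x.2 / β⌋)
  have hg : Measurable g := by fun_prop
  let Q : ℤ × ℤ → Set (ℝ × ℝ) := fun i => g ⁻¹' {i}
  have hQm : ∀ i, MeasurableSet (Q i) := fun i => hg (measurableSet_singleton i)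
  have hQd : Pairwise (Function.onFun Disjoint Q) := fun i j hij =>
    Disjoint.preimage g (Set.disjoint_singleton.2 hij)
  have hQU : ⋃ i, Q i = Set.univ := by
    ext x; simp [Q]
  have hQsum : ∀ S, MeasurableSet S → ∑' i, μ (Q i ∩ S) = μ S := by
    intro S hS
    rw [← measure_iUnion (fun i j hij => (hQd hij).mono Set.inter_subset_left Set.inter_subset_left)
      (fun i => (hQm i).inter hS), ← Set.iUnion_inter, hQU, Set.univ_inter]
  have hcell : ∀ {δ y : ℝ} {k : ℤ}, 0 < δ → ⌊y / δ⌋ = k → |y - (k + 1 / 2) * δ| ≤ δ / 2 := by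
    intro δ y k hδ h
    obtain ⟨h1, h2⟩ := Int.floor_eq_iff.1 h
    rw [le_div_iff₀ hδ] at h1
    rw [div_lt_iff₀ hδ] at h2
    rw [abs_le]
    constructor <;> linarith
  have hQbox : ∀ i, Q i ⊆ box (c i) (α / 2) (β / 2) := by
    intro i x hx
    have hx' : g x = i := hx
    rw [mem_box]
    exact ⟨hcell hα (congrArg Prod.fst hx'), hcell hβ (congrArg Prod.snd hx')⟩
  let R : ℤ × ℤ → Set (ℝ × ℝ) := fun i => box (p (c i)) (a / 2) (b / 2)
  have hRm : ∀ i, MeasurableSet (R i) := fun i => measurableSet_box _ _ _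
  have hRbox : ∀ i, R i ⊆ box (c i) (α / 2) (β / 2) := fun i =>
    ((box_subset_interior (by linarith) (by linarith)).trans interior_subset).trans (hp (c i))
  have hab : 0 < a * b := by positivity
  let l : ℤ × ℤ → Measure (ℝ × ℝ) := fun i =>
    ENNReal.ofReal (1 / (a * b)) • volume.restrict (R i)
  have hl : ∀ i S, MeasurableSet S →
      l i S = ENNReal.ofReal (1 / (a * b)) * volume (S ∩ R i) := by
    intro i S hS
    simp [l, Measure.restrict_apply hS]
  have hl1 : ∀ i, l i Set.univ = 1 := by
    intro i
    rw [hl i _ MeasurableSet.univ, Set.univ_inter, volume_box _ (by positivity),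
      ← ENNReal.ofReal_mul (by positivity), ← ENNReal.ofReal_one]
    congr 1
    field_simp
    norm_num
  let ν : Measure (ℝ × ℝ) := Measure.sum fun i => μ (Q i) • l i
  have hν : ∀ S, MeasurableSet S → ν S = ∑' i, μ (Q i) * l i S := by
    intro S hS
    simp [ν, Measure.sum_apply _ hS]
  refine ⟨ν, ?_, ?_, ?_, ?_⟩
  · rw [hν _ MeasurableSet.univ, ← hQsum _ MeasurableSet.univ]
    simp [hl1]
  · intro S hS
    rw [hν _ hS, ← hQsum _ MeasurableSet.univ, ← ENNReal.tsum_mul_right]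
    refine ENNReal.tsum_le_tsum fun i => ?_
    rw [hl i S hS, Set.inter_univ]
    gcongr
    exact Set.inter_subset_left
  · intro x ρ hρ
    rw [hν _ measurableSet_closedBall, ← hQsum _ (measurableSet_box _ _ _),
      ← ENNReal.tsum_mul_left]
    refine ENNReal.tsum_le_tsum fun i => ?_
    rw [hl i _ measurableSet_closedBall]
    by_cases hne : (Metric.closedBall x ρ ∩ R i).Nonempty
    · have hsub : Q i ⊆ box x (ρ + α) (ρ + β) := by
        obtain ⟨y, hy, hyR⟩ := hne
        intro z hz
        rw [← box_self] at hy
        have h1 := mem_box.1 hy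
        have h2 := mem_box.1 (hRbox i hyR)
        have h3 := mem_box.1 (hQbox i hz)
        simp only [abs_le] at h1 h2 h3
        rw [mem_box, abs_le, abs_le]
        refine ⟨⟨?_, ?_⟩, ?_, ?_⟩ <;> linarith
      rw [Set.inter_eq_self_of_subset_left hsub, mul_comm]
      gcongr
      rw [← box_self, Set.inter_comm]
      refine (mul_le_mul_right (volume_box_inter_le _ _ _ (by positivity) hρ.le) _).trans ?_
      rw [← ENNReal.ofReal_mul (by positivity)]
      refine ENNReal.ofReal_le_ofReal (le_of_eq ?_)
      have h1 : min 1 (2 * ρ / a) = min a (2 * ρ) / a := by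
        rw [← min_div_div_right ha.le, div_self ha.ne']
      have h2 : min 1 (2 * ρ / b) = min b (2 * ρ) / b := by
        rw [← min_div_div_right hb.le, div_self hb.ne']
      rw [h1, h2, mul_div_cancel₀ a two_ne_zero, mul_div_cancel₀ b two_ne_zero]
      field_simp
    · rw [Set.not_nonempty_iff_eq_empty.1 hne]
      simp
  · intro K hK hμK
    let I : Set (ℤ × ℤ) := {i | (Q i ∩ K).Nonempty}
    have hI : I.Finite := by
      obtain ⟨B, hB⟩ := hK.isBounded.subset_closedBall 0
      refine (((Set.finite_Icc ⌊-B / α⌋ ⌊B / α⌋).prod (Set.finite_Icc ⌊-B / β⌋ ⌊B / β⌋))).subset ?_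
      rintro i ⟨x, hx, hxK⟩
      have hx' : g x = i := hx
      have h := hB hxK
      rw [← box_self, mem_box] at h
      simp only [Prod.fst_zero, Prod.snd_zero, sub_zero, abs_le] at h
      rw [← hx']
      refine ⟨⟨?_, ?_⟩, ?_, ?_⟩ <;> refine Int.floor_le_floor (div_le_div_of_nonneg_right ?_ ?_) <;>
        linarith
    refine ⟨c '' I, hI.image c, ?_, ?_⟩
    · rintro _ ⟨i, ⟨x, hx, hxK⟩, rfl⟩
      exact ⟨x, hQbox i hx, hxK⟩
    · rw [Set.biUnion_image]
      have hm : MeasurableSet (⋃ i ∈ I, box (p (c i)) (a / 2) (b / 2))ᶜ :=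
        (MeasurableSet.biUnion I.to_countable fun i _ => measurableSet_box _ _ _).compl
      rw [hν _ hm, ENNReal.tsum_eq_zero]
      intro i
      by_cases hi : i ∈ I
      · have : (⋃ i ∈ I, box (p (c i)) (a / 2) (b / 2))ᶜ ∩ R i = ∅ := by
          rw [← Set.disjoint_iff_inter_eq_empty]
          exact Set.disjoint_compl_left_iff_subset.2
            (Set.subset_biUnion_of_mem (u := fun i => box (p (c i)) (a / 2) (b / 2)) hi)
        rw [hl i _ hm, this, measure_empty, mul_zero, mul_zero]
      · have : μ (Q i) = 0 := measure_mono_null (fun x hx hxK => hi ⟨x, hx, hxK⟩) hμK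
        rw [this, zero_mul]

/-- A compact set together with a probability measure carried by its interior, of bounded density
and with a Frostman exponent `t`; the Frostman constant stays below a fixed bound. -/
structure CantorStage (t : ℝ) where
  V : Set (ℝ × ℝ)
  μ : Measure (ℝ × ℝ)
  isCompact : IsCompact V
  measure_univ : μ Set.univ = 1
  exists_support : ∃ K, IsCompact K ∧ K ⊆ interior V ∧ μ Kᶜ = 0
  exists_density_le : ∃ M : ℝ, 0 ≤ M ∧
    ∀ s, MeasurableSet s → μ s ≤ ENNReal.ofReal M * volume s
  exists_frostman : ∃ C < 5, ∀ x ρ, 0 < ρ → μ (Metric.closedBall x ρ) ≤ ENNReal.ofReal (C * ρ ^ t)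

theorem CantorStage.nonempty {t : ℝ} (ht : 0 < t) (ht2 : t ≤ 2) : Nonempty (CantorStage t) := by
  have huniv : volume.restrict (box 0 (1 / 2) (1 / 2)) Set.univ = 1 := by
    rw [Measure.restrict_apply_univ, volume_box _ (by norm_num)]
    norm_num
  refine ⟨⟨box 0 1 1, volume.restrict (box 0 (1 / 2) (1 / 2)), isCompact_box _ _ _, huniv,
    ⟨box 0 (1 / 2) (1 / 2), isCompact_box _ _ _,
      box_subset_interior (by norm_num) (by norm_num), ?_⟩, ⟨1, zero_le_one, ?_⟩,
    ⟨4, by norm_num, ?_⟩⟩⟩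
  · rw [Measure.restrict_apply (measurableSet_box _ _ _).compl, Set.compl_inter_self, measure_empty]
  · intro s _
    rw [ENNReal.ofReal_one, one_mul]
    exact Measure.restrict_apply_le _ _
  · intro x ρ hρ
    rcases le_total ρ 1 with h | h
    · refine (Measure.restrict_apply_le _ _).trans ?_
      rw [← box_self, volume_box _ hρ.le]
      refine ENNReal.ofReal_le_ofReal ?_
      have := Real.rpow_le_rpow_of_exponent_ge hρ h ht2
      rw [Real.rpow_two] at this
      nlinarith
    · refine (measure_mono (Set.subset_univ _)).trans ?_
      rw [huniv, ← ENNReal.ofReal_one]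
      refine ENNReal.ofReal_le_ofReal ?_
      linarith [Real.one_le_rpow h ht.le]

/-- The set `E` contains rectangles of half-sides `a`, `b` in every `α × β` cell, and these
rectangles are spread out enough to carry a measure with Frostman exponent `s`. -/
structure HasRectangles (E : Set (ℝ × ℝ)) (α β a b K s : ℝ) : Prop where
  α_pos : 0 < α
  β_pos : 0 < β
  a_pos : 0 < a
  b_pos : 0 < b
  exists_box : ∀ q, ∃ p, box p a b ⊆ box q (α / 2) (β / 2) ∩ E
  frostman : ∀ ρ, 0 < ρ → ρ ≤ 1 →
    (ρ + α) * (ρ + β) * (min 1 (2 * ρ / a) * min 1 (2 * ρ / b)) ≤ K * ρ ^ s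

theorem CantorStage.exists_next {E : ℕ → Set (ℝ × ℝ)} {α β a b : ℕ → ℝ} {K s t : ℝ}
    (hK : 0 ≤ K) (ht : 0 < t) (hts : t < s)
    (hα : Tendsto α atTop (nhds 0)) (hβ : Tendsto β atTop (nhds 0))
    (hE : ∀ᶠ n in atTop, HasRectangles (E n) (α n) (β n) (a n) (b n) K s)
    (S : CantorStage t) (N : ℕ) :
    ∃ S' : CantorStage t, S'.V ⊆ S.V ∧ ∃ n ≥ N, S'.V ⊆ E n := by
  obtain ⟨K₀, hK₀, hK₀V, hμK₀⟩ := S.exists_support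
  obtain ⟨M, hM, hdens⟩ := S.exists_density_le
  obtain ⟨C₀, hC₀, hfr₀⟩ := S.exists_frostman
  obtain ⟨C, hC1, hC5, hfr⟩ : ∃ C : ℝ, 1 ≤ C ∧ C < 5 ∧ ∀ x ρ, 0 < ρ →
      S.μ (Metric.closedBall x ρ) ≤ ENNReal.ofReal (C * ρ ^ t) := by
    refine ⟨max C₀ 1, le_max_right _ _, max_lt hC₀ (by norm_num), fun x ρ hρ =>
      (hfr₀ x ρ hρ).trans (ENNReal.ofReal_le_ofReal ?_)⟩
    gcongr
    exact le_max_left _ _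
  obtain ⟨C', hCC', hC'5⟩ := exists_between hC5
  obtain ⟨δ, hδ, hδV⟩ := hK₀.exists_cthickening_subset_open isOpen_interior hK₀V
  obtain ⟨ρ₀, hρ₀, hρ₀0, hρ₀1⟩ : ∃ ρ₀ : ℝ, 4 * M * K * ρ₀ ^ (s - t) < 1 ∧ 0 < ρ₀ ∧ ρ₀ ≤ 1 := by
    have h : Tendsto (fun ρ : ℝ => 4 * M * K * ρ ^ (s - t)) (nhds 0) (nhds 0) := by
      have := ((Real.continuousAt_rpow_const 0 (s - t) (Or.inr (sub_pos.2 hts).le)).tendsto).const_mul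
        (4 * M * K)
      rwa [Real.zero_rpow (sub_pos.2 hts).ne', mul_zero] at this
    exact (((h.eventually (gt_mem_nhds one_pos)).filter_mono nhdsWithin_le_nhds).and
      (Ioc_mem_nhdsGT one_pos)).exists
  have hγ : Tendsto (fun n => C * (1 + max (α n) (β n) / ρ₀) ^ t) atTop (nhds C) := by
    have h1 : Tendsto (fun n => 1 + max (α n) (β n) / ρ₀) atTop (nhds 1) := by
      simpa using ((hα.max hβ).div_const ρ₀).const_add 1
    simpa using (h1.rpow_const (p := t) (Or.inl one_ne_zero)).const_mul C
  obtain ⟨n, hn, hnC, hαδ, hβδ, hnN⟩ := (hE.and ((hγ.eventually (gt_mem_nhds hCC')).and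
    ((hα.eventually (gt_mem_nhds hδ)).and ((hβ.eventually (gt_mem_nhds hδ)).and
      (eventually_ge_atTop N))))).exists
  obtain ⟨hα0, hβ0, ha0, hb0, hbox, hfrost⟩ := hn
  choose p hp using hbox
  obtain ⟨ν, hν1, hνd, hνF, hνK⟩ := exists_redistribution S.μ hα0 hβ0 ha0 hb0 p
    (fun q => (hp q).trans Set.inter_subset_left)
  rw [S.measure_univ] at hν1
  rw [S.measure_univ] at hνd
  obtain ⟨J, hJ, hJK, hνJ⟩ := hνK K₀ hK₀ hμK₀
  refine ⟨⟨⋃ q ∈ J, box (p q) (a n) (b n), ν, hJ.isCompact_biUnion fun q _ => isCompact_box _ _ _,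
    hν1, ⟨⋃ q ∈ J, box (p q) (a n / 2) (b n / 2),
      hJ.isCompact_biUnion fun q _ => isCompact_box _ _ _, ?_, hνJ⟩,
    ⟨1 / (a n * b n), by positivity, fun s hs => by simpa using hνd s hs⟩, ⟨C', hC'5, ?_⟩⟩,
    ?_, n, hnN, ?_⟩
  · refine Set.iUnion₂_subset fun q hq =>
      (box_subset_interior (half_lt_self ha0) (half_lt_self hb0)).trans (interior_mono ?_)
    exact Set.subset_biUnion_of_mem (u := fun q => box (p q) (a n) (b n)) hq
  · intro x ρ hρ
    refine (hνF x ρ hρ).trans ?_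
    have hm1 : min 1 (2 * ρ / a n) * min 1 (2 * ρ / b n) ≤ 1 :=
      mul_le_one₀ (min_le_left _ _) (le_min zero_le_one (by positivity)) (min_le_left _ _)
    have hm0 : 0 ≤ min 1 (2 * ρ / a n) * min 1 (2 * ρ / b n) :=
      mul_nonneg (le_min zero_le_one (by positivity)) (le_min zero_le_one (by positivity))
    rcases le_total ρ₀ ρ with h | h
    · set γ := max (α n) (β n) with hγdef
      have hγ0 : 0 < γ := lt_max_of_lt_left hα0
      have hsub : box x (ρ + α n) (ρ + β n) ⊆ Metric.closedBall x (ρ + γ) := by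
        rw [← box_self]
        refine Set.prod_mono (Metric.closedBall_subset_closedBall ?_)
          (Metric.closedBall_subset_closedBall ?_)
        · linarith [le_max_left (α n) (β n)]
        · linarith [le_max_right (α n) (β n)]
      calc _ ≤ 1 * S.μ (Metric.closedBall x (ρ + γ)) := by
            gcongr
            exact ENNReal.ofReal_le_one.2 hm1
        _ ≤ ENNReal.ofReal (C * (ρ + γ) ^ t) := by rw [one_mul]; exact hfr _ _ (by positivity)
        _ ≤ ENNReal.ofReal (C' * ρ ^ t) := by
            refine ENNReal.ofReal_le_ofReal ?_
            have h1 : ρ + γ ≤ (1 + γ / ρ₀) * ρ := by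
              have : γ ≤ γ / ρ₀ * ρ := by
                rw [div_mul_eq_mul_div, le_div_iff₀ hρ₀0]
                gcongr
              linarith
            calc C * (ρ + γ) ^ t ≤ C * ((1 + γ / ρ₀) * ρ) ^ t := by gcongr
              _ = C * (1 + γ / ρ₀) ^ t * ρ ^ t := by
                rw [Real.mul_rpow (by positivity) hρ.le, mul_assoc]
              _ ≤ C' * ρ ^ t := by gcongr
    · calc _ ≤ ENNReal.ofReal (min 1 (2 * ρ / a n) * min 1 (2 * ρ / b n)) *
            (ENNReal.ofReal M * ENNReal.ofReal (4 * ((ρ + α n) * (ρ + β n)))) := by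
            gcongr
            rw [← volume_box x (by positivity)]
            exact hdens _ (measurableSet_box _ _ _)
        _ = ENNReal.ofReal (4 * M * ((ρ + α n) * (ρ + β n) *
            (min 1 (2 * ρ / a n) * min 1 (2 * ρ / b n)))) := by
            rw [← ENNReal.ofReal_mul hM, ← ENNReal.ofReal_mul hm0]
            congr 1
            ring
        _ ≤ ENNReal.ofReal (C' * ρ ^ t) := by
            refine ENNReal.ofReal_le_ofReal ?_
            calc _ ≤ 4 * M * (K * ρ ^ s) := by
                  exact mul_le_mul_of_nonneg_left (hfrost ρ hρ (h.trans hρ₀1)) (by positivity)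
              _ = 4 * M * K * ρ ^ (s - t) * ρ ^ t := by
                  rw [mul_assoc _ (ρ ^ (s - t)), ← Real.rpow_add hρ, sub_add_cancel]
                  ring
              _ ≤ 4 * M * K * ρ₀ ^ (s - t) * ρ ^ t := by
                  gcongr
              _ ≤ C' * ρ ^ t := by
                  gcongr
                  linarith
  · refine Set.iUnion₂_subset fun q hq z hz => interior_subset (hδV ?_)
    obtain ⟨y, hy, hyK⟩ := hJK q hq
    refine Metric.mem_cthickening_of_dist_le z y δ K₀ hyK ?_
    have h1 := mem_box.1 hy
    have h2 := mem_box.1 (hp q hz).1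
    simp only [abs_le] at h1 h2
    rw [Prod.dist_eq, Real.dist_eq, Real.dist_eq, max_le_iff, abs_le, abs_le]
    refine ⟨⟨?_, ?_⟩, ?_, ?_⟩ <;> linarith
  · exact Set.iUnion₂_subset fun q _ => (hp q).trans Set.inter_subset_right

theorem le_dimH_frequently_of_hasRectangles {E : ℕ → Set (ℝ × ℝ)} {α β a b : ℕ → ℝ} {K s : ℝ}
    (hK : 0 ≤ K) (hs2 : s ≤ 2)
    (hα : Tendsto α atTop (nhds 0)) (hβ : Tendsto β atTop (nhds 0))
    (hE : ∀ᶠ n in atTop, HasRectangles (E n) (α n) (β n) (a n) (b n) K s) :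
    ENNReal.ofReal s ≤ dimH {x | ∃ᶠ n in atTop, x ∈ E n} := by
  refine le_of_forall_lt_imp_le_of_dense fun d hd => ?_
  lift d to NNReal using hd.ne_top
  rcases eq_or_ne d 0 with rfl | hd0
  · simp
  have ht : 0 < (d : ℝ) := by positivity
  have hts : (d : ℝ) < s := by
    rw [← ENNReal.ofReal_coe_nnreal] at hd
    exact (ENNReal.ofReal_lt_ofReal_iff_of_nonneg ht.le).1 hd
  obtain ⟨S₀⟩ := CantorStage.nonempty ht (hts.le.trans hs2)
  choose next hnext₁ hnext₂ using CantorStage.exists_next hK ht hts hα hβ hE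
  let S : ℕ → CantorStage (d : ℝ) := fun k => Nat.rec S₀ (fun k S => next S k) k
  have hanti : Antitone fun k => (S k).V := antitone_nat_of_succ_le fun k => hnext₁ (S k) k
  have hsub : (⋂ k, (S k).V) ⊆ {x | ∃ᶠ n in atTop, x ∈ E n} := by
    intro x hx
    refine frequently_atTop.2 fun N => ?_
    obtain ⟨n, hn, hVn⟩ := hnext₂ (S N) N
    exact ⟨n, hn, hVn (Set.mem_iInter.1 hx (N + 1))⟩
  refine (le_dimH_of_hausdorffMeasure_ne_zero ?_).trans (dimH_mono hsub)
  refine hausdorffMeasure_iInter_ne_zero (C := 5) hanti (fun k => (S k).isCompact)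
    (fun k => (S k).μ) (fun k => ?_) ht (fun k x ρ hρ => ?_)
  · obtain ⟨K, hK, hKV, hμK⟩ := (S k).exists_support
    calc (1 : ENNReal) = (S k).μ Set.univ := (S k).measure_univ.symm
      _ ≤ (S k).μ K + (S k).μ Kᶜ := by
        rw [← Set.union_compl_self K]; exact measure_union_le _ _
      _ = (S k).μ K := by rw [hμK, add_zero]
      _ ≤ (S k).μ (S k).V := measure_mono (hKV.trans interior_subset)
  · obtain ⟨C, hC, hF⟩ := (S k).exists_frostman
    refine (hF x ρ hρ).trans (ENNReal.ofReal_le_ofReal ?_)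
    gcongr

theorem abs_mul_lt_one_of_floor_eq {x y G : ℝ} (hG : 0 ≤ G) (h : ⌊x * G⌋ = ⌊y * G⌋) :
    |x - y| * G < 1 := by
  have := Int.abs_sub_lt_one_of_floor_eq_floor h
  rwa [← sub_mul, abs_mul, abs_of_nonneg hG] at this

theorem card_Icc_floor_neg_le {v : ℝ} (hv : 0 ≤ v) :
    ((Finset.Icc ⌊-v⌋ ⌊v⌋).card : ℝ) ≤ 2 * v + 2 := by
  have h1 : ⌊-v⌋ ≤ ⌊v⌋ := Int.floor_le_floor (by linarith)
  have h2 : ((Finset.Icc ⌊-v⌋ ⌊v⌋).card : ℤ) = ⌊v⌋ + 1 - ⌊-v⌋ := by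
    rw [Int.card_Icc, Int.toNat_of_nonneg (by omega)]
  have h3 : ((Finset.Icc ⌊-v⌋ ⌊v⌋).card : ℝ) = ⌊v⌋ + 1 - ⌊-v⌋ := by exact_mod_cast h2
  linarith [Int.floor_le v, Int.lt_floor_add_one (-v)]

theorem floor_mem_Icc_floor_neg {x v : ℝ} (h : |x| ≤ v) : ⌊x⌋ ∈ Finset.Icc ⌊-v⌋ ⌊v⌋ :=
  Finset.mem_Icc.2 ⟨Int.floor_le_floor (abs_le.1 h).1, Int.floor_le_floor (abs_le.1 h).2⟩

/-- The points that `diag(l₁ⁿ, l₂ⁿ) - 1` sends to within `r` of `Λ`, in each coordinate. -/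
def closeSet (Λ : Set (ℝ × ℝ)) (l₁ l₂ r : ℝ) (n : ℕ) : Set (ℝ × ℝ) :=
  {x | ∃ z ∈ Λ, |(l₁ ^ n - 1) * x.1 - z.1| < r ∧ |(l₂ ^ n - 1) * x.2 - z.2| < r}

theorem eventually_abs_pow_sub_one {l₁ l₂ : ℝ} (h1 : |l₁| < 1) (h2 : 1 < |l₂|) :
    ∀ᶠ n : ℕ in atTop, (1 / 2 ≤ |l₁ ^ n - 1| ∧ |l₁ ^ n - 1| ≤ 2) ∧
      Real.exp (n * Real.log |l₂|) / 2 ≤ |l₂ ^ n - 1| ∧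
      |l₂ ^ n - 1| ≤ 2 * Real.exp (n * Real.log |l₂|) := by
  filter_upwards [(tendsto_pow_atTop_nhds_zero_of_lt_one (abs_nonneg l₁) h1).eventually
    (gt_mem_nhds (show (0 : ℝ) < 1 / 2 by norm_num)),
    (tendsto_pow_atTop_atTop_of_one_lt h2).eventually (eventually_ge_atTop 2)] with n hn1 hn2
  rw [Real.exp_nat_mul, Real.exp_log (by linarith)]
  rw [← abs_pow] at hn1 hn2 ⊢
  have e1 := abs_le.1 (abs_abs_sub_abs_le_abs_sub (l₁ ^ n) 1)
  have e2 := abs_le.1 (abs_abs_sub_abs_le_abs_sub (l₂ ^ n) 1)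
  have e3 := abs_sub (l₁ ^ n) 1
  have e4 := abs_sub (l₂ ^ n) 1
  rw [abs_one] at e1 e2 e3 e4
  refine ⟨⟨?_, ?_⟩, ?_, ?_⟩ <;> linarith

theorem dimH_frequently_closeSet_le {Λ : Set (ℝ × ℝ)} {l₁ l₂ τ c σ : ℝ}
    (hΛ : ∀ z ∈ Λ, ∀ z' ∈ Λ, z ≠ z' → 1 ≤ |z.1 - z'.1| * |z.2 - z'.2|)
    (h1 : |l₁| < 1) (h2 : 1 < |l₂|) (hτ : 0 < τ) (hc : 0 < c) (hσ : 0 ≤ σ)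
    (hσL : σ ≤ Real.log |l₂|) :
    dimH {x | ∃ᶠ n : ℕ in atTop, x ∈ closeSet Λ l₁ l₂ (c * Real.exp (-(n : ℝ) * τ)) n} ≤
      ENNReal.ofReal ((Real.log |l₂| + σ) / (τ + σ)) := by
  set L := Real.log |l₂| with hL
  have hL0 : 0 < L := Real.log_pos h2
  set F : ℕ → ℕ → Set (ℝ × ℝ) := fun m n =>
    closeSet Λ l₁ l₂ (c * Real.exp (-(n : ℝ) * τ)) n ∩ Metric.closedBall 0 m with hF
  have hsub : {x | ∃ᶠ n : ℕ in atTop, x ∈ closeSet Λ l₁ l₂ (c * Real.exp (-(n : ℝ) * τ)) n} ⊆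
      ⋃ m, {x | ∃ᶠ n in atTop, x ∈ F m n} := by
    intro x hx
    obtain ⟨m, hm⟩ := exists_nat_ge (dist x 0)
    exact Set.mem_iUnion.2 ⟨m, hx.mono fun n hn => ⟨hn, hm⟩⟩
  refine (dimH_mono hsub).trans ?_
  rw [dimH_iUnion]
  refine iSup_le fun m => ?_
  set U : ℝ := 2 * m + c with hU
  have hU0 : 0 < U := by positivity
  refine dimH_frequently_le (L := ℤ × ℤ) (C := (4 * U ^ 2 + 2) * (2 * c + 2) + (4 * c + 2))
    (by positivity) (by positivity) (by positivity) ?_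
  filter_upwards [eventually_abs_pow_sub_one h1 h2] with n hn
  rw [← hL] at hn
  obtain ⟨⟨hn1, hn1'⟩, hn2, hn2'⟩ := hn
  have hn0 : (0 : ℝ) ≤ n := Nat.cast_nonneg n
  set e := Real.exp (n * L) with he
  have he1 : 1 ≤ e := Real.one_le_exp (by positivity)
  set r := c * Real.exp (-(n : ℝ) * τ) with hr
  have hrc : r ≤ c := by
    refine mul_le_of_le_one_right hc.le (Real.exp_le_one_iff.2 ?_)
    rw [neg_mul]; exact neg_nonpos.2 (by positivity)
  set G := 2 * U * e with hG
  set H := Real.exp (n * (τ + σ)) with hH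
  have hrH : r * H = c * Real.exp (n * σ) := by
    rw [hr, hH, mul_assoc, ← Real.exp_add]; congr 2; ring
  have hσ1 : 1 ≤ Real.exp (n * σ) := Real.one_le_exp (by positivity)
  have hchoice : ∀ x, ∃ z, x ∈ F m n → z ∈ Λ ∧ |(l₁ ^ n - 1) * x.1 - z.1| < r ∧
      |(l₂ ^ n - 1) * x.2 - z.2| < r := by
    intro x
    by_cases hx : x ∈ F m n
    · obtain ⟨z, hz⟩ := hx.1
      exact ⟨z, fun _ => hz⟩
    · exact ⟨0, fun h => absurd h hx⟩
  choose z hz using hchoice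
  have hz1 : ∀ x ∈ F m n, |(z x).1| ≤ U ∧ |(z x).2| ≤ U * e := by
    intro x hx
    obtain ⟨-, hzx1, hzx2⟩ := hz x hx
    have hxm := hx.2
    rw [← box_self, mem_box] at hxm
    simp only [Prod.fst_zero, Prod.snd_zero, sub_zero] at hxm
    have i1 : |(l₁ ^ n - 1) * x.1| ≤ 2 * m := by rw [abs_mul]; gcongr; exact hxm.1
    have i2 : |(l₂ ^ n - 1) * x.2| ≤ 2 * e * m := by rw [abs_mul]; gcongr; exact hxm.2
    rw [abs_lt] at hzx1 hzx2
    rw [abs_le] at i1 i2 ⊢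
    rw [abs_le]
    have i3 : c ≤ c * e := le_mul_of_one_le_right hc.le he1
    have i4 : U * e = 2 * e * m + c * e := by rw [hU]; ring
    refine ⟨⟨?_, ?_⟩, ?_, ?_⟩ <;> linarith
  refine ⟨Finset.Icc ⌊-(U * G)⌋ ⌊U * G⌋ ×ˢ Finset.Icc ⌊-(r * H)⌋ ⌊r * H⌋,
    fun x => (⌊(z x).1 * G⌋, ⌊((l₁ ^ n - 1) * x.1 - (z x).1) * H⌋), ?_, ?_, ?_⟩
  · rw [Finset.card_product, Nat.cast_mul]
    calc _ ≤ (2 * (U * G) + 2) * (2 * (r * H) + 2) := by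
          gcongr <;> exact card_Icc_floor_neg_le (by positivity)
      _ = (4 * U ^ 2 * e + 2) * (2 * c * Real.exp (n * σ) + 2) := by rw [hrH, hG]; ring
      _ ≤ ((4 * U ^ 2 + 2) * e) * ((2 * c + 2) * Real.exp (n * σ)) := by
          gcongr <;> linarith
      _ = (4 * U ^ 2 + 2) * (2 * c + 2) * Real.exp (n * (L + σ)) := by
          rw [mul_add (n : ℝ) L σ, Real.exp_add]; ring
      _ ≤ _ := by
          gcongr
          linarith
  · intro x hx
    refine Finset.mem_product.2 ⟨floor_mem_Icc_floor_neg ?_, floor_mem_Icc_floor_neg ?_⟩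
    · rw [abs_mul, abs_of_pos (show 0 < G by positivity)]
      gcongr
      exact (hz1 x hx).1
    · rw [abs_mul, abs_of_pos (show 0 < H by positivity)]
      gcongr
      exact (hz x hx).2.1.le
  · intro x hx y hy hxy
    have hG1 := abs_mul_lt_one_of_floor_eq (by positivity) (congrArg Prod.fst hxy)
    have hH1 := abs_mul_lt_one_of_floor_eq (by positivity) (congrArg Prod.snd hxy)
    have hzz : z x = z y := by
      by_contra hne
      have i1 := hΛ _ (hz x hx).1 _ (hz y hy).1 hne
      have i2 : |(z x).2 - (z y).2| ≤ G := by
        refine (abs_sub _ _).trans ?_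
        rw [hG]
        linarith [(hz1 x hx).2, (hz1 y hy).2]
      have : |(z x).1 - (z y).1| * |(z x).2 - (z y).2| ≤ |(z x).1 - (z y).1| * G := by gcongr
      linarith
    rw [hzz] at hH1
    have hHinv : Real.exp (-(n : ℝ) * (τ + σ)) * H = 1 := by
      rw [hH, ← Real.exp_add, neg_mul, neg_add_cancel, Real.exp_zero]
    set η := Real.exp (-(n : ℝ) * (τ + σ)) with hη
    have hη0 : 0 < η := Real.exp_pos _
    have d1 : |x.1 - y.1| ≤ 2 * η := by
      have i1 : |(l₁ ^ n - 1) * x.1 - (z y).1 - ((l₁ ^ n - 1) * y.1 - (z y).1)|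
          = |l₁ ^ n - 1| * |x.1 - y.1| := by rw [← abs_mul]; congr 1; ring
      rw [i1] at hH1
      have i2 : |l₁ ^ n - 1| * |x.1 - y.1| < η := by
        have := mul_lt_mul_of_pos_right hH1 hη0
        rwa [one_mul, mul_assoc, mul_comm H, hHinv, mul_one] at this
      have i3 : 1 / 2 * |x.1 - y.1| ≤ |l₁ ^ n - 1| * |x.1 - y.1| := by gcongr
      linarith
    have d2 : |x.2 - y.2| ≤ 4 * c * η := by
      have i1 : |l₂ ^ n - 1| * |x.2 - y.2| ≤ 2 * r := by
        rw [← abs_mul, abs_le]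
        have j1 := abs_lt.1 (hz x hx).2.2
        have j2 := abs_lt.1 (hz y hy).2.2
        rw [hzz] at j1
        constructor <;> linarith
      have i2 : e / 2 * |x.2 - y.2| ≤ |l₂ ^ n - 1| * |x.2 - y.2| := by gcongr
      have i3 : r ≤ c * η * e := by
        rw [hr, hη, he, mul_assoc, ← Real.exp_add]
        gcongr
        nlinarith [mul_le_mul_of_nonneg_left hσL hn0]
      have i4 : e * |x.2 - y.2| ≤ e * (4 * c * η) := by linarith
      exact le_of_mul_le_mul_left i4 (by positivity)
    rw [Prod.dist_eq, Real.dist_eq, Real.dist_eq]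
    have i5 : 0 ≤ (4 * U ^ 2 + 2) * (2 * c + 2) * η := by positivity
    have i6 : 0 ≤ c * η := by positivity
    refine max_le ?_ ?_ <;> linarith

theorem min_one_le_rpow {u x : ℝ} (hu : 0 < u) (hx0 : 0 ≤ x) (hx1 : x ≤ 1) : min 1 u ≤ u ^ x := by
  rcases le_total u 1 with h | h
  · simpa [h] using Real.rpow_le_rpow_of_exponent_ge hu h hx1
  · simpa [h] using Real.one_le_rpow h hx0

theorem rectangle_frostman_le {α β a b x y s K ρ : ℝ} (hα : 0 < α) (hβ : 0 < β) (ha : 0 < a)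
    (hb : 0 < b) (hx0 : 0 ≤ x) (hx1 : x ≤ 1) (hy0 : 0 ≤ y) (hy1 : y ≤ 1) (hxy : x + y = s)
    (hαK : α * a ^ (-y) ≤ K) (hβK : β * a ^ (-y) ≤ K) (hK : α * β * (a ^ (-x) * b ^ (-y)) ≤ K)
    (hρ : 0 < ρ) (hρ1 : ρ ≤ 1) :
    (ρ + α) * (ρ + β) * (min 1 (2 * ρ / a) * min 1 (2 * ρ / b)) ≤ (1 + 8 * K) * ρ ^ s := by
  have hscale : ∀ {d w : ℝ}, 0 < d → 0 ≤ w → w ≤ 1 →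
      min 1 (2 * ρ / d) ≤ 2 * d ^ (-w) * ρ ^ w := by
    intro d w hd hw0 hw1
    refine (min_one_le_rpow (by positivity) hw0 hw1).trans ?_
    rw [Real.div_rpow (by positivity) hd.le, Real.mul_rpow zero_le_two hρ.le, Real.rpow_neg hd.le,
      div_eq_mul_inv, mul_right_comm]
    gcongr
    simpa using Real.rpow_le_rpow_of_exponent_le one_le_two hw1
  have hm0 : ∀ {d : ℝ}, 0 < d → 0 ≤ min 1 (2 * ρ / d) := fun hd =>
    le_min zero_le_one (by positivity)
  set m₁ := min 1 (2 * ρ / a)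
  set m₂ := min 1 (2 * ρ / b)
  have hm₁ : m₁ ≤ 1 := min_le_left _ _
  have hm₂ : m₂ ≤ 1 := min_le_left _ _
  have hm₁0 : 0 ≤ m₁ := hm0 ha
  have hm₂0 : 0 ≤ m₂ := hm0 hb
  have hm : m₁ * m₂ ≤ m₁ := mul_le_of_le_one_right hm₁0 hm₂
  have hK0 : 0 ≤ K := le_trans (by positivity) hαK
  have t1 : ρ ^ 2 * (m₁ * m₂) ≤ ρ ^ s := by
    calc _ ≤ ρ ^ 2 * 1 := by gcongr; linarith
      _ = ρ ^ (2 : ℝ) := by rw [mul_one, Real.rpow_two]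
      _ ≤ ρ ^ s := Real.rpow_le_rpow_of_exponent_ge hρ hρ1 (by linarith)
  have t2 : ∀ {δ : ℝ}, 0 < δ → δ * a ^ (-y) ≤ K → δ * ρ * (m₁ * m₂) ≤ 2 * K * ρ ^ s := by
    intro δ hδ hδK
    calc _ ≤ δ * ρ * (2 * a ^ (-y) * ρ ^ y) := 
          mul_le_mul_of_nonneg_left (hm.trans (hscale ha hy0 hy1)) (by positivity)
      _ = 2 * (δ * a ^ (-y)) * ρ ^ (1 + y) := by rw [Real.rpow_add hρ, Real.rpow_one]; ring
      _ ≤ 2 * K * ρ ^ s := by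
        have := Real.rpow_le_rpow_of_exponent_ge hρ hρ1 (show s ≤ 1 + y by linarith)
        gcongr
  have t3 : α * β * (m₁ * m₂) ≤ 4 * K * ρ ^ s := by
    calc _ ≤ α * β * ((2 * a ^ (-x) * ρ ^ x) * (2 * b ^ (-y) * ρ ^ y)) := by
          gcongr
          exacts [hscale ha hx0 hx1, hscale hb hy0 hy1]
      _ = 4 * (α * β * (a ^ (-x) * b ^ (-y))) * ρ ^ s := by rw [← hxy, Real.rpow_add hρ]; ring
      _ ≤ _ := by gcongr
  calc _ = ρ ^ 2 * (m₁ * m₂) + α * ρ * (m₁ * m₂) + β * ρ * (m₁ * m₂) + α * β * (m₁ * m₂) := by ring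
    _ ≤ ρ ^ s + 2 * K * ρ ^ s + 2 * K * ρ ^ s + 4 * K * ρ ^ s := by
      linarith [t1, t2 hα hαK, t2 hβ hβK, t3]
    _ = _ := by ring

theorem exponent_bounds {L τ s : ℝ} (hL : 0 < L) (hτ : 0 < τ)
    (h1 : s * (τ + L) ≤ 2 * L) (h2 : s * τ ≤ L) :
    τ * max 0 (s - 1) ≤ min τ (L / 2) ∧ min τ (L / 2) ≤ L / 2 ∧
      τ * min s 1 + (τ + L) * max 0 (s - 1) ≤ L ∧ s ≤ 2 := by
  have hs2 : s ≤ 2 := by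
    by_contra! h
    nlinarith
  refine ⟨?_, min_le_right _ _, ?_, hs2⟩
  · rw [mul_max_of_nonneg _ _ hτ.le, mul_zero]
    refine max_le (le_min hτ.le (by positivity)) (le_min (by nlinarith) ?_)
    have key : τ * (s * (τ + L)) ≤ τ * (2 * L) := by gcongr
    have : (τ + L) * (τ * (s - 1)) ≤ (τ + L) * (L / 2) := by nlinarith [sq_nonneg (τ - L / 2)]
    exact le_of_mul_le_mul_left this (by positivity)
  · rcases le_total s 1 with h | h
    · rw [min_eq_left h, max_eq_left (by linarith)]
      linarith
    · rw [min_eq_right h, max_eq_right (by linarith)]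
      linarith

theorem mul_exp_rpow {c : ℝ} (hc : 0 < c) (v w : ℝ) :
    (c * Real.exp v) ^ w = c ^ w * Real.exp (v * w) := by
  rw [Real.mul_rpow hc.le (Real.exp_pos _).le, ← Real.exp_mul]

theorem hasRectangles_closeSet {Λ : Set (ℝ × ℝ)} {l₁ l₂ τ c D s : ℝ} {n : ℕ} (hD : 1 ≤ D)
    (hΛ : ∀ T : ℝ, 1 ≤ T → ∀ y : ℝ × ℝ, ∃ z ∈ Λ, |y.1 - z.1| ≤ D / T ∧ |y.2 - z.2| ≤ D * T)
    (h2 : 1 < |l₂|) (hτ : 0 < τ) (hc : 0 < c) (hc1 : c ≤ 1)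
    (hs0 : 0 ≤ s) (hs1 : s * (τ + Real.log |l₂|) ≤ 2 * Real.log |l₂|)
    (hs2 : s * τ ≤ Real.log |l₂|)
    (hn : (1 / 2 ≤ |l₁ ^ n - 1| ∧ |l₁ ^ n - 1| ≤ 2) ∧
      Real.exp (n * Real.log |l₂|) / 2 ≤ |l₂ ^ n - 1| ∧
      |l₂ ^ n - 1| ≤ 2 * Real.exp (n * Real.log |l₂|)) :
    HasRectangles (closeSet Λ l₁ l₂ (4 * c * Real.exp (-(n : ℝ) * τ)) n)
      (8 * D * Real.exp (-(n : ℝ) * min τ (Real.log |l₂| / 2)))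
      (8 * D * Real.exp (-(n : ℝ) * (Real.log |l₂| - min τ (Real.log |l₂| / 2))))
      (c * Real.exp (-(n : ℝ) * τ)) (c * Real.exp (-(n : ℝ) * (τ + Real.log |l₂|)))
      (1 + 8 * (64 * D ^ 2 * c ^ (-2 : ℝ))) s := by
  have hL0 : 0 < Real.log |l₂| := Real.log_pos h2
  set L := Real.log |l₂| with hL
  obtain ⟨e1, e2, e3, e4⟩ := exponent_bounds hL0 hτ hs1 hs2
  have hθτ : min τ (L / 2) ≤ τ := min_le_left _ _
  have hθ0 : 0 ≤ min τ (L / 2) := le_min hτ.le (by positivity)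
  set θ := min τ (L / 2) with hθ
  obtain ⟨⟨n1, n2⟩, n3, n4⟩ := hn
  have hn0 : (0 : ℝ) ≤ n := Nat.cast_nonneg n
  have hD0 : 0 < D := by linarith
  have exp_le : ∀ {v w : ℝ}, w ≤ v → Real.exp (-(n : ℝ) * v) ≤ Real.exp (-(n : ℝ) * w) :=
    fun h => Real.exp_le_exp.2 (by nlinarith)
  refine ⟨by positivity, by positivity, by positivity, by positivity, ?_, ?_⟩
  · intro q
    have hd1 : l₁ ^ n - 1 ≠ 0 := abs_pos.1 (by linarith)
    have hd2 : l₂ ^ n - 1 ≠ 0 := abs_pos.1 (lt_of_lt_of_le (by positivity) n3)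
    obtain ⟨z, hz, hz1, hz2⟩ := hΛ (Real.exp (n * θ)) (Real.one_le_exp (by positivity))
      ((l₁ ^ n - 1) * q.1, (l₂ ^ n - 1) * q.2)
    have p1 : (l₁ ^ n - 1) * (z.1 / (l₁ ^ n - 1)) = z.1 := mul_div_cancel₀ _ hd1
    have p2 : (l₂ ^ n - 1) * (z.2 / (l₂ ^ n - 1)) = z.2 := mul_div_cancel₀ _ hd2
    refine ⟨(z.1 / (l₁ ^ n - 1), z.2 / (l₂ ^ n - 1)), fun x hx => ?_⟩
    rw [mem_box] at hx
    set p₁ := z.1 / (l₁ ^ n - 1)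
    set p₂ := z.2 / (l₂ ^ n - 1)
    dsimp only at hx hz1 hz2
    rw [← p1, ← mul_sub, abs_mul] at hz1
    rw [← p2, ← mul_sub, abs_mul] at hz2
    have g1 : |q.1 - p₁| ≤ 2 * (D * Real.exp (-(n : ℝ) * θ)) := by
      have : 1 / 2 * |q.1 - p₁| ≤ |l₁ ^ n - 1| * |q.1 - p₁| := by gcongr
      rw [neg_mul, Real.exp_neg, ← div_eq_mul_inv]
      linarith
    have g2 : |q.2 - p₂| ≤ 2 * (D * Real.exp (-(n : ℝ) * (L - θ))) := by
      have i1 : Real.exp (n * L) / 2 * |q.2 - p₂| ≤ |l₂ ^ n - 1| * |q.2 - p₂| := by gcongr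
      have i2 : Real.exp (n * L) * Real.exp (-(n : ℝ) * (L - θ)) = Real.exp (n * θ) := by
        rw [← Real.exp_add]; congr 1; ring
      have i3 : Real.exp (n * L) * |q.2 - p₂| ≤
          Real.exp (n * L) * (2 * (D * Real.exp (-(n : ℝ) * (L - θ)))) := by
        have : Real.exp (n * L) * (2 * (D * Real.exp (-(n : ℝ) * (L - θ)))) =
          2 * (D * Real.exp (n * θ)) := by rw [← i2]; ring
        linarith
      exact le_of_mul_le_mul_left i3 (Real.exp_pos _)
    have k1 : c * Real.exp (-(n : ℝ) * τ) ≤ D * Real.exp (-(n : ℝ) * θ) := by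
      gcongr ?_ * ?_
      · linarith
      · exact exp_le hθτ
    have k2 : c * Real.exp (-(n : ℝ) * (τ + L)) ≤ D * Real.exp (-(n : ℝ) * (L - θ)) := by
      gcongr ?_ * ?_
      · linarith
      · exact exp_le (by linarith)
    constructor
    · rw [mem_box]
      have j1 := abs_sub_le x.1 p₁ q.1
      have j2 := abs_sub_le x.2 p₂ q.2
      rw [abs_sub_comm p₁] at j1
      rw [abs_sub_comm p₂] at j2
      have j3 : ∀ v, 0 ≤ D * Real.exp v := fun v => by positivity
      constructor <;> linarith [hx.1, hx.2, j3 (-(n : ℝ) * θ), j3 (-(n : ℝ) * (L - θ))]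
    · refine ⟨z, hz, ?_, ?_⟩
      · rw [← p1, ← mul_sub, abs_mul]
        calc _ ≤ 2 * (c * Real.exp (-(n : ℝ) * τ)) := by gcongr; exact hx.1
          _ < _ := by nlinarith [mul_pos hc (Real.exp_pos (-(n : ℝ) * τ))]
      · rw [← p2, ← mul_sub, abs_mul]
        calc _ ≤ 2 * Real.exp (n * L) * (c * Real.exp (-(n : ℝ) * (τ + L))) := by
              gcongr; exact hx.2
          _ = 2 * c * (Real.exp (n * L) * Real.exp (-(n : ℝ) * (τ + L))) := by ring
          _ = 2 * c * Real.exp (-(n : ℝ) * τ) := by rw [← Real.exp_add]; congr 2; ring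
          _ < _ := by nlinarith [mul_pos hc (Real.exp_pos (-(n : ℝ) * τ))]
  · intro ρ hρ hρ1
    have hy0 : 0 ≤ max 0 (s - 1) := le_max_left _ _
    have hy1 : max 0 (s - 1) ≤ 1 := max_le zero_le_one (by linarith)
    have hx0 : 0 ≤ min s 1 := le_min hs0 zero_le_one
    have hx1 : min s 1 ≤ 1 := min_le_right _ _
    have hxy : min s 1 + max 0 (s - 1) = s := by
      rcases le_total s 1 with h | h
      · rw [min_eq_left h, max_eq_left (by linarith), add_zero]
      · rw [min_eq_right h, max_eq_right (by linarith)]; ring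
    set y := max 0 (s - 1)
    set x := min s 1
    have hcw : ∀ {w : ℝ}, w ≤ 2 → c ^ (-w) ≤ c ^ (-2 : ℝ) := fun hw =>
      Real.rpow_le_rpow_of_exponent_ge hc hc1 (by linarith)
    have hDD : 8 * D ≤ 64 * D ^ 2 := by nlinarith
    have hone : ∀ {v : ℝ}, τ * y ≤ v →
        8 * D * Real.exp (-(n : ℝ) * v) * (c * Real.exp (-(n : ℝ) * τ)) ^ (-y) ≤
          64 * D ^ 2 * c ^ (-2 : ℝ) := by
      intro v hv
      rw [mul_exp_rpow hc]
      calc _ = 8 * D * c ^ (-y) * Real.exp (-(n : ℝ) * v + -(n : ℝ) * τ * -y) := by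
            rw [Real.exp_add]; ring
        _ ≤ 64 * D ^ 2 * c ^ (-2 : ℝ) * 1 := by
            gcongr ?_ * ?_ * ?_
            · exact hcw (by linarith)
            · exact Real.exp_le_one_iff.2 (by nlinarith)
        _ = _ := mul_one _
    refine rectangle_frostman_le (by positivity) (by positivity) (by positivity) (by positivity)
      hx0 hx1 hy0 hy1 hxy (hone e1) (hone (by linarith)) ?_ hρ hρ1
    rw [mul_exp_rpow hc, mul_exp_rpow hc]
    calc _ = 64 * D ^ 2 * (c ^ (-x) * c ^ (-y)) * (Real.exp (-(n : ℝ) * θ) *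
            Real.exp (-(n : ℝ) * (L - θ)) * (Real.exp (-(n : ℝ) * τ * -x) *
            Real.exp (-(n : ℝ) * (τ + L) * -y))) := by ring
      _ ≤ 64 * D ^ 2 * c ^ (-2 : ℝ) * 1 := by
          gcongr ?_ * ?_ * ?_
          · rw [← Real.rpow_add hc, ← neg_add]
            exact hcw (by linarith)
          · rw [← Real.exp_add, ← Real.exp_add, ← Real.exp_add]
            exact Real.exp_le_one_iff.2 (by nlinarith)
      _ = _ := mul_one _

theorem tendsto_mul_exp_neg_mul_nhds_zero (K : ℝ) {v : ℝ} (hv : 0 < v) :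
    Tendsto (fun n : ℕ => K * Real.exp (-(n : ℝ) * v)) atTop (nhds 0) := by
  have h := (Real.tendsto_exp_atBot.comp ((tendsto_natCast_atTop_atTop (R := ℝ)).atTop_mul_const
    hv |> tendsto_neg_atTop_atBot.comp)).const_mul K
  rw [mul_zero] at h
  refine h.congr fun n => ?_
  simp

theorem le_dimH_frequently_closeSet {Λ : Set (ℝ × ℝ)} {l₁ l₂ τ c D : ℝ} (hD : 1 ≤ D)
    (hΛ : ∀ T : ℝ, 1 ≤ T → ∀ y : ℝ × ℝ, ∃ z ∈ Λ, |y.1 - z.1| ≤ D / T ∧ |y.2 - z.2| ≤ D * T)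
    (h1 : |l₁| < 1) (h2 : 1 < |l₂|) (hτ : 0 < τ) (hc : 0 < c) :
    ENNReal.ofReal (min (2 * Real.log |l₂| / (τ + Real.log |l₂|)) (Real.log |l₂| / τ)) ≤
      dimH {x | ∃ᶠ n : ℕ in atTop, x ∈ closeSet Λ l₁ l₂ (c * Real.exp (-(n : ℝ) * τ)) n} := by
  have hL0 : 0 < Real.log |l₂| := Real.log_pos h2
  set L := Real.log |l₂| with hL
  set s := min (2 * L / (τ + L)) (L / τ) with hs
  have hs0 : 0 ≤ s := le_min (by positivity) (by positivity)
  have hs1 : s * (τ + L) ≤ 2 * L := (le_div_iff₀ (by positivity)).1 (min_le_left _ _)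
  have hs2 : s * τ ≤ L := (le_div_iff₀ hτ).1 (min_le_right _ _)
  obtain ⟨-, e2, -, e4⟩ := exponent_bounds hL0 hτ hs1 hs2
  set c' := min (c / 4) 1 with hc'
  have hc'0 : 0 < c' := lt_min (by positivity) one_pos
  refine (le_dimH_frequently_of_hasRectangles
    (E := fun n => closeSet Λ l₁ l₂ (4 * c' * Real.exp (-(n : ℝ) * τ)) n)
    (by positivity) e4
    (tendsto_mul_exp_neg_mul_nhds_zero _ (lt_min hτ (by positivity)))
    (tendsto_mul_exp_neg_mul_nhds_zero _ (by linarith))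
    ((eventually_abs_pow_sub_one h1 h2).mono fun n hn =>
      hasRectangles_closeSet hD hΛ h2 hτ hc'0 (min_le_right _ _) hs0 hs1 hs2 hn)).trans ?_
  refine dimH_mono fun x hx => hx.mono fun n hn => ?_
  obtain ⟨z, hz, hz1, hz2⟩ := hn
  have : 4 * c' * Real.exp (-(n : ℝ) * τ) ≤ c * Real.exp (-(n : ℝ) * τ) := by
    gcongr
    linarith [min_le_left (c / 4) 1]
  exact ⟨z, hz, hz1.trans_le this, hz2.trans_le this⟩

theorem irrational_of_sq_add_eq {l : ℝ} {t d : ℤ} (h : l ^ 2 + d = t * l) (h0 : 0 < |l|)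
    (h1 : |l| < 1) : Irrational l := by
  rintro ⟨q, rfl⟩
  have hq : q ^ 2 + d = t * q := by exact_mod_cast h
  have hint : IsIntegral ℤ q := by
    refine ⟨Polynomial.X ^ 2 - Polynomial.C t * Polynomial.X + Polynomial.C d, by monicity!, ?_⟩
    simp only [Polynomial.eval₂_add, Polynomial.eval₂_sub, Polynomial.eval₂_mul,
      Polynomial.eval₂_pow, Polynomial.eval₂_X, Polynomial.eval₂_C]
    simp only [algebraMap_int_eq, eq_intCast]
    linarith
  obtain ⟨m, rfl⟩ := IsIntegrallyClosed.isIntegral_iff.1 hint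
  simp only [algebraMap_int_eq, eq_intCast, Rat.cast_intCast] at h0 h1
  have h0' : 0 < |m| := by exact_mod_cast h0
  have h1' : |m| < 1 := by exact_mod_cast h1
  omega

/-- The coordinate of `(x, y)` along the eigenvector for `l` of a matrix with first column
`(a, c)`. -/
def eigenForm (a c : ℤ) (l x y : ℝ) : ℝ :=
  c * x + (l - a) * y

/-- Integer vectors written in eigencoordinates. -/
def eigenLattice (a c : ℤ) (l₁ l₂ : ℝ) : Set (ℝ × ℝ) :=
  Set.range fun z : ℤ × ℤ => (eigenForm a c l₁ z.1 z.2, eigenForm a c l₂ z.1 z.2)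

theorem eigenForm_mul {a b c d : ℤ} {l : ℝ} (h : l ^ 2 + (a * d - b * c : ℤ) = (a + d : ℤ) * l)
    (x y : ℝ) : eigenForm a c l (a * x + b * y) (c * x + d * y) = l * eigenForm a c l x y := by
  simp only [eigenForm]
  push_cast at h
  linear_combination -y * h

theorem eigenForm_ne_zero {a c : ℤ} {l : ℝ} (hc : c ≠ 0) (hl : Irrational l) {x y : ℤ}
    (hxy : (x, y) ≠ 0) : eigenForm a c l x y ≠ 0 := by
  intro h
  rcases eq_or_ne y 0 with rfl | hy
  · have : x ≠ 0 := fun hx => hxy (by simp [hx])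
    simp [eigenForm, hc, this] at h
  · refine hl ⟨a - c * x / y, ?_⟩
    have : (y : ℝ) ≠ 0 := by exact_mod_cast hy
    push_cast
    field_simp
    simp only [eigenForm] at h
    linarith

theorem one_le_abs_sub_mul_abs_sub_of_mem_eigenLattice {a b c d : ℤ} {l₁ l₂ : ℝ}
    (hsum : l₁ + l₂ = (a + d : ℤ)) (hprod : l₁ * l₂ = (a * d - b * c : ℤ)) (hc : c ≠ 0)
    (hl₁ : Irrational l₁) (hl₂ : Irrational l₂) :
    ∀ z ∈ eigenLattice a c l₁ l₂, ∀ z' ∈ eigenLattice a c l₁ l₂, z ≠ z' →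
      1 ≤ |z.1 - z'.1| * |z.2 - z'.2| := by
  rintro _ ⟨⟨x, y⟩, rfl⟩ _ ⟨⟨x', y'⟩, rfl⟩ hne
  have hne' : (x - x', y - y') ≠ 0 := by
    intro h
    rw [Prod.mk_eq_zero, sub_eq_zero, sub_eq_zero] at h
    exact hne (by rw [h.1, h.2])
  have hsub : ∀ l, eigenForm a c l x y - eigenForm a c l x' y' =
      eigenForm a c l (x - x' : ℤ) (y - y' : ℤ) := fun l => by
    simp only [eigenForm]; push_cast; ring
  dsimp only
  rw [hsub, hsub, ← abs_mul]
  have h0 := mul_ne_zero (eigenForm_ne_zero (a := a) hc hl₁ hne')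
    (eigenForm_ne_zero (a := a) hc hl₂ hne')
  generalize x - x' = u at *
  generalize y - y' = v at *
  have hN : eigenForm a c l₁ u v * eigenForm a c l₂ u v =
      (c * (c * u ^ 2 + (d - a) * u * v - b * v ^ 2) : ℤ) := by
    simp only [eigenForm]
    push_cast at *
    linear_combination (c * u * v - a * v ^ 2) * hsum + v ^ 2 * hprod
  rw [hN] at h0 ⊢
  exact_mod_cast Int.one_le_abs (by exact_mod_cast h0)

theorem exists_small_eigenForm (a : ℤ) {c : ℤ} (hc : c ≠ 0) (l₁ l₂ : ℝ) {T : ℝ} (hT : 1 ≤ T) :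
    ∃ x y : ℤ, (x, y) ≠ 0 ∧ |eigenForm a c l₁ x y| ≤ (|c| + 2 * |l₂ - l₁|) / T ∧
      |eigenForm a c l₂ x y| ≤ (|c| + 2 * |l₂ - l₁|) * T := by
  have hT0 : 0 < T := by linarith
  obtain ⟨j, k, hk0, hkn, hjk⟩ := Real.exists_int_int_abs_mul_sub_le ((l₁ - a) / c)
    (Nat.ceil_pos.2 hT0)
  have hc' : (c : ℝ) ≠ 0 := by exact_mod_cast hc
  have hk : (k : ℝ) ≤ 2 * T := by
    have h1 : (k : ℝ) ≤ ⌈T⌉₊ := by exact_mod_cast hkn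
    linarith [Nat.ceil_lt_add_one hT0.le]
  have hk0' : (0 : ℝ) < k := by exact_mod_cast hk0
  have hu : |eigenForm a c l₁ (-j : ℤ) k| ≤ |(c : ℝ)| / T := by
    have : eigenForm a c l₁ (-j : ℤ) k = c * (k * ((l₁ - a) / c) - j) := by
      simp only [eigenForm]
      field_simp
      push_cast
      ring
    rw [this, abs_mul, div_eq_mul_one_div |(c : ℝ)|]
    gcongr
    refine hjk.trans ?_
    gcongr
    linarith [Nat.le_ceil T]
  refine ⟨-j, k, fun h => hk0.ne' (Prod.mk_eq_zero.1 h).2, hu.trans ?_, ?_⟩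
  · push_cast
    refine div_le_div_of_nonneg_right ?_ hT0.le
    linarith [abs_nonneg (l₂ - l₁)]
  · have : eigenForm a c l₂ (-j : ℤ) k = eigenForm a c l₁ (-j : ℤ) k + (l₂ - l₁) * k := by
      simp only [eigenForm]; ring
    rw [this]
    refine (abs_add_le _ _).trans ?_
    rw [abs_mul, abs_of_pos hk0', add_mul]
    push_cast at *
    have h1 : |(c : ℝ)| / T ≤ |(c : ℝ)| * T :=
      (div_le_self (abs_nonneg _) hT).trans (le_mul_of_one_le_right (abs_nonneg _) hT)
    have h2 : |l₂ - l₁| * k ≤ |l₂ - l₁| * (2 * T) := by gcongr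
    linarith

theorem exists_mem_eigenLattice_near {a b c d : ℤ} {l₁ l₂ : ℝ}
    (hsum : l₁ + l₂ = (a + d : ℤ)) (hprod : l₁ * l₂ = (a * d - b * c : ℤ)) (hc : c ≠ 0)
    (hl₁ : Irrational l₁) (hl₂ : Irrational l₂) (hne : l₁ ≠ l₂) :
    ∃ D, 1 ≤ D ∧ ∀ T : ℝ, 1 ≤ T → ∀ y : ℝ × ℝ,
      ∃ z ∈ eigenLattice a c l₁ l₂, |y.1 - z.1| ≤ D / T ∧ |y.2 - z.2| ≤ D * T := by
  set M : ℝ := |c| + 2 * |l₂ - l₁| with hM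
  have hM0 : 0 ≤ M := by rw [hM]; push_cast; positivity
  refine ⟨(1 + |l₁| + |l₂|) * M + 1, le_add_of_nonneg_left (by positivity), fun T hT q => ?_⟩
  obtain ⟨x, y, hxy, h1, h2⟩ := exists_small_eigenForm a hc l₁ l₂ hT
  rw [← hM] at h1 h2
  have hu := eigenForm_ne_zero (a := a) hc hl₁ hxy
  have hw := eigenForm_ne_zero (a := a) hc hl₂ hxy
  have hu' := eigenForm_mul (a := a) (b := b) (c := c) (d := d) (l := l₁)
    (by rw [← hsum, ← hprod]; ring) x y
  have hw' := eigenForm_mul (a := a) (b := b) (c := c) (d := d) (l := l₂)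
    (by rw [← hsum, ← hprod]; ring) x y
  have hT0 : 0 < T := by linarith
  set u := eigenForm a c l₁ x y
  set w := eigenForm a c l₂ x y
  have hl : l₂ - l₁ ≠ 0 := sub_ne_zero.2 hne.symm
  set β := (q.2 / w - q.1 / u) / (l₂ - l₁) with hβ
  set α := q.1 / u - β * l₁ with hα
  have e1 : q.1 = u * (α + β * l₁) := by rw [hα]; field_simp; ring
  have e2 : q.2 = w * (α + β * l₂) := by
    have : β * (l₂ - l₁) = q.2 / w - q.1 / u := div_mul_cancel₀ _ hl
    have : α + β * l₂ = q.2 / w := by rw [hα]; linarith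
    rw [this, mul_div_cancel₀ _ hw]
  have hadd : ∀ l, eigenForm a c l (round α * x + round β * (a * x + b * y) : ℤ)
      (round α * y + round β * (c * x + d * y) : ℤ) = round α * eigenForm a c l x y +
      round β * eigenForm a c l (a * x + b * y) (c * x + d * y) := fun l => by
    simp only [eigenForm]; push_cast; ring
  have herr : ∀ l, |α + β * l - (round α + round β * l)| ≤ 1 + |l| := by
    intro l
    have i1 := abs_sub_round α
    have i2 := abs_sub_round β
    have : α + β * l - (round α + round β * l) = (α - round α) + (β - round β) * l := by ring
    rw [this]
    refine (abs_add_le _ _).trans ?_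
    rw [abs_mul]
    have i3 : |β - round β| * |l| ≤ 1 / 2 * |l| := by gcongr
    linarith [abs_nonneg l]
  refine ⟨_, ⟨(round α * x + round β * (a * x + b * y), round α * y + round β * (c * x + d * y)),
    rfl⟩, ?_, ?_⟩
  · dsimp only
    rw [hadd, hu', e1]
    have : u * (α + β * l₁) - (round α * u + round β * (l₁ * u)) =
      u * (α + β * l₁ - (round α + round β * l₁)) := by ring
    rw [this, abs_mul]
    calc _ ≤ M / T * (1 + |l₁|) := by gcongr; exact herr l₁
      _ = (1 + |l₁|) * M / T := by ring
      _ ≤ _ := by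
        gcongr
        nlinarith [abs_nonneg l₂]
  · dsimp only
    rw [hadd, hw', e2]
    have : w * (α + β * l₂) - (round α * w + round β * (l₂ * w)) =
      w * (α + β * l₂ - (round α + round β * l₂)) := by ring
    rw [this, abs_mul]
    calc _ ≤ M * T * (1 + |l₂|) := by gcongr; exact herr l₂
      _ = (1 + |l₂|) * M * T := by ring
      _ ≤ _ := by
        gcongr
        nlinarith [abs_nonneg l₁]

/-- The eigencoordinates of a vector in the plane. -/
noncomputable def eigenMap (a c : ℤ) (l₁ l₂ : ℝ) : EuclideanSpace ℝ (Fin 2) →ₗ[ℝ] ℝ × ℝ where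
  toFun x := (eigenForm a c l₁ (x 0) (x 1), eigenForm a c l₂ (x 0) (x 1))
  map_add' x y := by
    ext <;> simp only [eigenForm, PiLp.add_apply, Prod.mk_add_mk] <;> ring
  map_smul' r x := by
    ext <;> simp only [eigenForm, PiLp.smul_apply, smul_eq_mul, Prod.smul_mk, RingHom.id_apply] <;>
      ring

theorem eigenMap_apply (a c : ℤ) (l₁ l₂ : ℝ) (x : EuclideanSpace ℝ (Fin 2)) :
    eigenMap a c l₁ l₂ x = (eigenForm a c l₁ (x 0) (x 1), eigenForm a c l₂ (x 0) (x 1)) :=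
  rfl

theorem eigenMap_injective {a c : ℤ} {l₁ l₂ : ℝ} (hc : c ≠ 0) (hne : l₁ ≠ l₂) :
    Function.Injective (eigenMap a c l₁ l₂) := by
  rw [← LinearMap.ker_eq_bot, LinearMap.ker_eq_bot']
  intro x hx
  obtain ⟨h1, h2⟩ := Prod.mk_eq_zero.1 hx
  simp only [eigenForm] at h1 h2
  have hx1 : x 1 = 0 := by
    have : (l₁ - l₂) * x 1 = 0 := by linarith
    exact (mul_eq_zero.1 this).resolve_left (sub_ne_zero.2 hne)
  have hx0 : x 0 = 0 := by
    rw [hx1, mul_zero, add_zero] at h1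
    exact (mul_eq_zero.1 h1).resolve_left (by exact_mod_cast hc)
  ext i
  fin_cases i
  · exact hx0
  · exact hx1

theorem eigenForm_mulVec_pow (A : Matrix (Fin 2) (Fin 2) ℤ) {l : ℝ}
    (h : l ^ 2 + (A 0 0 * A 1 1 - A 0 1 * A 1 0 : ℤ) = (A 0 0 + A 1 1 : ℤ) * l)
    (n : ℕ) (x : EuclideanSpace ℝ (Fin 2)) :
    eigenForm (A 0 0) (A 1 0) l (Matrix.toEuclideanLin ((A ^ n).map (Int.cast : ℤ → ℝ)) x 0)
      (Matrix.toEuclideanLin ((A ^ n).map (Int.cast : ℤ → ℝ)) x 1) =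
      l ^ n * eigenForm (A 0 0) (A 1 0) l (x 0) (x 1) := by
  induction n with
  | zero => simp [eigenForm]
  | succ n ih =>
    rw [pow_succ l, mul_comm (l ^ n), mul_assoc, ← ih, ← eigenForm_mul h]
    have hA : (A ^ (n + 1)).map (Int.cast : ℤ → ℝ) =
        A.map (Int.cast : ℤ → ℝ) * (A ^ n).map (Int.cast : ℤ → ℝ) := by
      rw [pow_succ']
      exact Matrix.map_mul (f := Int.castRingHom ℝ)
    simp only [Matrix.toLpLin_apply, hA, ← Matrix.mulVec_mulVec]
    congr 1 <;> simp [Matrix.mulVec, dotProduct, Fin.sum_univ_two]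

theorem eigenMap_sub_sub (A : Matrix (Fin 2) (Fin 2) ℤ) {l₁ l₂ : ℝ}
    (hsum : l₁ + l₂ = (A 0 0 + A 1 1 : ℤ)) (hprod : l₁ * l₂ = (A 0 0 * A 1 1 - A 0 1 * A 1 0 : ℤ))
    (n : ℕ) (x : EuclideanSpace ℝ (Fin 2)) (z : Fin 2 → ℤ) :
    eigenMap (A 0 0) (A 1 0) l₁ l₂
        (Matrix.toEuclideanLin ((A ^ n).map (Int.cast : ℤ → ℝ)) x - x - intVec z) =
      ((l₁ ^ n - 1) * (eigenMap (A 0 0) (A 1 0) l₁ l₂ x).1 -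
          eigenForm (A 0 0) (A 1 0) l₁ (z 0) (z 1),
        (l₂ ^ n - 1) * (eigenMap (A 0 0) (A 1 0) l₁ l₂ x).2 -
          eigenForm (A 0 0) (A 1 0) l₂ (z 0) (z 1)) := by
  have h1 := eigenForm_mulVec_pow A (l := l₁) (by rw [← hsum, ← hprod]; ring) n x
  have h2 := eigenForm_mulVec_pow A (l := l₂) (by rw [← hsum, ← hprod]; ring) n x
  rw [map_sub, map_sub, eigenMap_apply, eigenMap_apply, eigenMap_apply, h1, h2]
  ext <;> simp only [Prod.mk_sub_mk, sub_one_mul] <;> rfl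

theorem exists_frequently_closeSet_subset_image_recSet (A : Matrix (Fin 2) (Fin 2) ℤ) {l₁ l₂ : ℝ}
    (hsum : l₁ + l₂ = (A 0 0 + A 1 1 : ℤ)) (hprod : l₁ * l₂ = (A 0 0 * A 1 1 - A 0 1 * A 1 0 : ℤ))
    (hc : A 1 0 ≠ 0) (hne : l₁ ≠ l₂) (τ : ℝ) :
    ∃ (e : EuclideanSpace ℝ (Fin 2) ≃L[ℝ] ℝ × ℝ) (c C : ℝ), 0 < c ∧ 0 < C ∧
      {x | ∃ᶠ n : ℕ in atTop, x ∈ closeSet (eigenLattice (A 0 0) (A 1 0) l₁ l₂) l₁ l₂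
        (c * Real.exp (-(n : ℝ) * τ)) n} ⊆ e '' recSet A τ ∧
      e '' recSet A τ ⊆ {x | ∃ᶠ n : ℕ in atTop,
        x ∈ closeSet (eigenLattice (A 0 0) (A 1 0) l₁ l₂) l₁ l₂
          (C * Real.exp (-(n : ℝ) * τ)) n} := by
  set e : EuclideanSpace ℝ (Fin 2) ≃L[ℝ] ℝ × ℝ := (LinearEquiv.ofInjectiveOfFinrankEq
    (eigenMap (A 0 0) (A 1 0) l₁ l₂) (eigenMap_injective hc hne)
    (by simp)).toContinuousLinearEquiv with he
  have hes := fun n x z => show e (Matrix.toEuclideanLin _ x - x - intVec z) = _ from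
    eigenMap_sub_sub A hsum hprod n x z
  have hex : ∀ x, eigenMap (A 0 0) (A 1 0) l₁ l₂ x = e x := fun _ => rfl
  simp only [hex] at hes
  refine ⟨e, (‖(e.symm : ℝ × ℝ →L[ℝ] EuclideanSpace ℝ (Fin 2))‖ + 1)⁻¹,
    ‖(e : EuclideanSpace ℝ (Fin 2) →L[ℝ] ℝ × ℝ)‖ + 1, by positivity, by positivity, ?_, ?_⟩
  · intro p hp
    refine ⟨e.symm p, hp.mono fun n hn => ?_, e.apply_symm_apply p⟩
    obtain ⟨-, ⟨⟨z₀, z₁⟩, rfl⟩, hz⟩ := hn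
    refine ⟨![z₀, z₁], ?_⟩
    have h := hes n (e.symm p) ![z₀, z₁]
    rw [e.apply_symm_apply] at h
    generalize Matrix.toEuclideanLin ((A ^ n).map (Int.cast : ℤ → ℝ)) (e.symm p) - e.symm p -
      intVec ![z₀, z₁] = y at *
    have hy : ‖e y‖ < (‖(e.symm : ℝ × ℝ →L[ℝ] EuclideanSpace ℝ (Fin 2))‖ + 1)⁻¹ *
        Real.exp (-(n : ℝ) * τ) := by
      rw [h, Prod.norm_def]
      exact max_lt hz.1 hz.2
    rw [inv_mul_eq_div, lt_div_iff₀' (by positivity)] at hy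
    refine lt_of_le_of_lt ?_ hy
    have := (e.symm : ℝ × ℝ →L[ℝ] EuclideanSpace ℝ (Fin 2)).le_opNorm (e y)
    rw [ContinuousLinearEquiv.coe_coe, e.symm_apply_apply] at this
    linarith [norm_nonneg (e y)]
  · rintro _ ⟨x, hx, rfl⟩
    refine hx.mono fun n ⟨z, hz⟩ => ⟨_, ⟨(z 0, z 1), rfl⟩, ?_⟩
    have h := hes n x z
    generalize Matrix.toEuclideanLin ((A ^ n).map (Int.cast : ℤ → ℝ)) x - x - intVec z = y at *
    have hy : ‖e y‖ < (‖(e : EuclideanSpace ℝ (Fin 2) →L[ℝ] ℝ × ℝ)‖ + 1) *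
        Real.exp (-(n : ℝ) * τ) := by
      have := (e : EuclideanSpace ℝ (Fin 2) →L[ℝ] ℝ × ℝ).le_opNorm y
      rw [ContinuousLinearEquiv.coe_coe] at this
      calc _ ≤ (‖(e : EuclideanSpace ℝ (Fin 2) →L[ℝ] ℝ × ℝ)‖ + 1) * ‖y‖ := by
            linarith [norm_nonneg y]
        _ < _ := by gcongr
    rw [h, Prod.norm_def] at hy
    exact max_lt_iff.1 hy

/-- Main theorem: `dim_H R_τ = min{ 2log|λ₂|/(τ + log|λ₂|), log|λ₂|/τ }`. -/
theorem dimH_recSet (A : Matrix (Fin 2) (Fin 2) ℤ) (l₁ l₂ : ℝ)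
    (hsum : l₁ + l₂ = (A.trace : ℝ)) (hprod : l₁ * l₂ = (A.det : ℝ))
    (h0 : 0 < |l₁|) (h1 : |l₁| < 1) (h2 : 1 < |l₂|)
    (τ : ℝ) (hτ : 0 < τ) :
    dimH (recSet A τ) = ENNReal.ofReal
      (min (2 * Real.log |l₂| / (τ + Real.log |l₂|)) (Real.log |l₂| / τ)) := by

  have hl : l₁ ≠ l₂ := fun h => by rw [h] at h1; linarith
  rw [Matrix.trace_fin_two] at hsum
  rw [Matrix.det_fin_two] at hprod
  have hl₁ : Irrational l₁ :=
    irrational_of_sq_add_eq (t := A 0 0 + A 1 1) (d := A 0 0 * A 1 1 - A 0 1 * A 1 0)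
      (by rw [← hsum, ← hprod]; ring) h0 h1
  have hl₂ : Irrational l₂ := by
    rw [← eq_sub_iff_add_eq'] at hsum
    rw [hsum]
    exact hl₁.intCast_sub _
  have hc : A 1 0 ≠ 0 := by
    intro hc
    push_cast [hc] at hsum hprod
    have : (l₁ - A 0 0) * (l₁ - A 1 1) = 0 := by linear_combination l₁ * hsum - hprod
    rcases mul_eq_zero.1 this with h | h
    · exact hl₁.ne_int _ (sub_eq_zero.1 h)
    · exact hl₁.ne_int _ (sub_eq_zero.1 h)
  have hL0 : 0 < Real.log |l₂| := Real.log_pos h2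
  obtain ⟨e, c, C, hc0, hC0, hsub, hsup⟩ :=
    exists_frequently_closeSet_subset_image_recSet A hsum hprod hc hl τ
  rw [← e.dimH_image]
  apply le_antisymm
  · have hup := fun σ hσ hσL => (dimH_mono hsup).trans (dimH_frequently_closeSet_le (σ := σ)
      (one_le_abs_sub_mul_abs_sub_of_mem_eigenLattice hsum hprod hc hl₁ hl₂) h1 h2 hτ hC0 hσ hσL)
    rw [ENNReal.ofReal_min]
    refine le_min ?_ ?_
    · simpa [two_mul] using hup _ hL0.le le_rfl
    · simpa using hup 0 le_rfl hL0.le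
  · obtain ⟨D, hD, hΛ⟩ := exists_mem_eigenLattice_near hsum hprod hc hl₁ hl₂ hl
    exact (le_dimH_frequently_closeSet hD hΛ h1 h2 hτ hc0).trans (dimH_mono hsub)
end

section
/- Let E_n ⊂ 𝕋^d be open sets and μ_n probability measures with μ_n(𝕋^d \ E_n) = 0. Suppose there exist constants C > 0 and s > 0 such that C^{−1} ≤ liminf_n μ_n(B)/μ(B) ≤ limsup_n μ_n(B)/μ(B) ≤ C for every ball B (where μ is Lebesgue measure on 𝕋^d), and μ_n(B) ≤ C r^s for every n and every ball B of radius r. Then dim_H(limsup_n E_n) ≥ s. -/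
open Filter MeasureTheory
open scoped ENNReal

/-- A cover by sets whose `t`-th powers of diameters have small sum can be enlarged to a cover by
balls with the same property. -/
lemma exists_ball_cover_of_hausdorffMeasure_eq_zero {X : Type*} [MetricSpace X]
    [MeasurableSpace X] [BorelSpace X] [Nonempty X] {t : ℝ} (ht : 0 < t) {F : Set X}
    (hF : μH[t] F = 0) {ε : ℝ≥0∞} (hε : 0 < ε) :
    ∃ (x : ℕ → X) (r : ℕ → ℝ), (∀ n, 0 < r n) ∧ F ⊆ ⋃ n, Metric.ball (x n) (r n) ∧
      ∑' n, ENNReal.ofReal (r n ^ t) < ε := by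
  have hε2 : ε / 2 ≠ 0 := (ENNReal.half_pos hε.ne').ne'
  rw [Measure.hausdorffMeasure_apply] at hF
  have h1 := le_antisymm ((le_iSup₂ (f := fun (r : ℝ≥0∞) (_ : 0 < r) =>
    ⨅ (t' : ℕ → Set X) (_ : F ⊆ ⋃ n, t' n) (_ : ∀ n, Metric.ediam (t' n) ≤ r),
      ∑' n, ⨆ _ : (t' n).Nonempty, Metric.ediam (t' n) ^ t) 1 one_pos).trans hF.le) bot_le
  have h2 := h1.trans_lt (pos_iff_ne_zero.2 hε2 : (⊥ : ℝ≥0∞) < ε / 2)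
  simp only [iInf_lt_iff] at h2
  obtain ⟨S, hFS, hdiam, hsum⟩ := h2
  obtain ⟨ε', hε'pos, hε'sum⟩ := ENNReal.exists_pos_sum_of_countable' hε2 ℕ
  have key : ∀ n, ∃ (x : X) (r : ℝ), 0 < r ∧ S n ⊆ Metric.ball x r ∧
      ENNReal.ofReal (r ^ t) ≤ (⨆ _ : (S n).Nonempty, Metric.ediam (S n) ^ t) + ε' n := by
    intro n
    set D := ⨆ _ : (S n).Nonempty, Metric.ediam (S n) ^ t with hD
    have hDtop : D ≠ ⊤ := ((ENNReal.le_tsum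
      (f := fun k => ⨆ _ : (S k).Nonempty, Metric.ediam (S k) ^ t) n).trans_lt hsum).ne_top
    obtain ⟨y, hy1, hy2⟩ := exists_between (ENNReal.lt_add_right hDtop (hε'pos n).ne')
    have hytop : y ≠ ⊤ := (hy2.trans_le le_top).ne
    have hy0 : 0 < y.toReal := ENNReal.toReal_pos (bot_le.trans_lt hy1).ne' hytop
    refine (S n).eq_empty_or_nonempty.elim (fun h => ?_) (fun h => ?_)
    · refine ⟨Classical.arbitrary X, y.toReal ^ t⁻¹, by positivity, by simp [h], ?_⟩
      rw [Real.rpow_inv_rpow hy0.le ht.ne', ENNReal.ofReal_toReal hytop]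
      exact hy2.le
    · obtain ⟨x, hx⟩ := h
      refine ⟨x, y.toReal ^ t⁻¹, by positivity, fun z hz => ?_, ?_⟩
      · have hd : edist z x ^ t < y := by
          refine lt_of_le_of_lt ?_ hy1
          rw [hD, iSup_pos ⟨x, hx⟩]
          gcongr
          exact Metric.edist_le_ediam_of_mem hz hx
        rw [edist_dist, ENNReal.ofReal_rpow_of_nonneg dist_nonneg ht.le,
          ENNReal.ofReal_lt_iff_lt_toReal (by positivity) hytop] at hd
        rw [Metric.mem_ball]
        exact (Real.lt_rpow_inv_iff_of_pos dist_nonneg hy0.le ht).2 hd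
      · rw [Real.rpow_inv_rpow hy0.le ht.ne', ENNReal.ofReal_toReal hytop]
        exact hy2.le
  choose x r hr hsub hle using key
  refine ⟨x, r, hr, hFS.trans (Set.iUnion_mono hsub), ?_⟩
  calc ∑' n, ENNReal.ofReal (r n ^ t) ≤ _ := ENNReal.tsum_le_tsum hle
    _ = _ := ENNReal.tsum_add
    _ < ε / 2 + ε / 2 := ENNReal.add_lt_add hsum hε'sum
    _ = ε := ENNReal.add_halves ε

/-- Mass distribution principle for a decreasing sequence of sets, each of which carries a measure
with the same Hölder bound. -/
lemma hausdorffMeasure_iInter_ne_zero_s13 {X : Type*} [MetricSpace X] [CompactSpace X]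
    [MeasurableSpace X] [BorelSpace X] [Nonempty X] {t A : ℝ} (ht : 0 < t) {U : ℕ → Set X}
    (hU : ∀ k, closure (U (k + 1)) ⊆ U k) {m : ℝ≥0∞} (hm : 0 < m)
    (hν : ∀ k, ∃ ν : Measure X, ν (U k)ᶜ = 0 ∧ m ≤ ν Set.univ ∧
      ∀ x r, 0 < r → ν (Metric.ball x r) ≤ ENNReal.ofReal (A * r ^ t)) :
    μH[t] (⋂ k, U k) ≠ 0 := by
  intro hzero
  have hε : 0 < m / ENNReal.ofReal A := ENNReal.div_pos hm.ne' ENNReal.ofReal_ne_top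
  obtain ⟨x, r, hr, hsub, hsum⟩ := exists_ball_cover_of_hausdorffMeasure_eq_zero ht hzero hε
  have hanti : Antitone U := antitone_nat_of_succ_le fun k => subset_closure.trans (hU k)
  obtain ⟨k, hk⟩ := exists_subset_nhds_of_isCompact' (V := fun k => closure (U k))
    (Antitone.directed_ge fun i j h => closure_mono (hanti h))
    (fun k => isClosed_closure.isCompact) (fun k => isClosed_closure)
    (U := ⋃ n, Metric.ball (x n) (r n)) (by
      intro y hy
      refine (isOpen_iUnion fun n => Metric.isOpen_ball).mem_nhds (hsub ?_)
      rw [Set.mem_iInter] at hy ⊢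
      exact fun k => hU k (hy (k + 1)))
  obtain ⟨ν, hν0, hνm, hνr⟩ := hν k
  have : ν Set.univ ≤ ENNReal.ofReal A * ∑' n, ENNReal.ofReal (r n ^ t) := by
    calc ν Set.univ ≤ ν (U k ∪ (U k)ᶜ) := by simp
      _ ≤ ν (U k) + ν (U k)ᶜ := measure_union_le _ _
      _ = ν (U k) := by rw [hν0, add_zero]
      _ ≤ ν (⋃ n, Metric.ball (x n) (r n)) := measure_mono (subset_closure.trans hk)
      _ ≤ ∑' n, ν (Metric.ball (x n) (r n)) := measure_iUnion_le _
      _ ≤ ∑' n, ENNReal.ofReal A * ENNReal.ofReal (r n ^ t) := by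
          refine ENNReal.tsum_le_tsum fun n => (hνr _ _ (hr n)).trans_eq ?_
          rw [mul_comm A, ENNReal.ofReal_mul (Real.rpow_nonneg (hr n).le t), mul_comm]
      _ = _ := ENNReal.tsum_mul_left
  have h2 := (ENNReal.lt_div_iff_mul_lt (Or.inr hsum.ne_top) (Or.inl ENNReal.ofReal_ne_top)).1 hsum
  rw [mul_comm] at h2
  exact absurd (hνm.trans this) (not_le.2 h2)

/-- Redistribute a measure `ν` at scale `δ` along a measure `lam`: the mass at `y` is spread over
`ball y δ` proportionally to `lam`. -/
lemma exists_measure_redistribute {X : Type*} [MetricSpace X] [SecondCountableTopology X]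
    [MeasurableSpace X] [BorelSpace X] (ν lam : Measure X) [IsFiniteMeasure lam] {δ : ℝ}
    {c : ℝ≥0∞} (hc : 0 < c) (hlam : ∀ y, c ≤ lam (Metric.ball y δ)) :
    ∃ ν' : Measure X, ν' Set.univ = ν Set.univ ∧ ∀ S, MeasurableSet S →
      ν' S ≤ ν (Metric.thickening δ S) ∧
      ν' S ≤ lam S / c * ν (Metric.thickening δ S) := by
  have hmeas : ∀ S : Set X, MeasurableSet S → Measurable fun y => lam (S ∩ Metric.ball y δ) := by
    intro S hS
    have : MeasurableSet {p : X × X | p.2 ∈ S ∧ dist p.2 p.1 < δ} :=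
      (measurable_snd hS).inter
        (isOpen_lt (continuous_snd.dist continuous_fst) continuous_const).measurableSet
    exact measurable_measure_prodMk_left (ν := lam) this
  let κ : X → Measure X := fun y => (lam (Metric.ball y δ))⁻¹ • lam.restrict (Metric.ball y δ)
  have hκ : ∀ (y : X) (S : Set X), MeasurableSet S →
      κ y S = (lam (Metric.ball y δ))⁻¹ * lam (S ∩ Metric.ball y δ) := by
    intro y S hS
    simp [κ, Measure.restrict_apply hS]
  have hκm : Measurable κ := by
    refine Measure.measurable_of_measurable_coe _ fun S hS => ?_
    simp_rw [hκ _ _ hS]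
    refine Measurable.mul (Measurable.inv ?_) (hmeas S hS)
    simpa using hmeas Set.univ MeasurableSet.univ
  have hb0 : ∀ y, lam (Metric.ball y δ) ≠ 0 := fun y => (hc.trans_le (hlam y)).ne'
  have hout : ∀ (S : Set X) (y : X), y ∉ Metric.thickening δ S → S ∩ Metric.ball y δ = ∅ := by
    intro S y hy
    refine Set.eq_empty_of_forall_notMem fun z hz => hy ?_
    exact Metric.mem_thickening_iff.2 ⟨z, hz.1, by simpa [dist_comm] using hz.2⟩
  have hbound : ∀ S : Set X, MeasurableSet S → ∀ a : ℝ≥0∞, (∀ y, κ y S ≤ a) →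
      ν.bind κ S ≤ a * ν (Metric.thickening δ S) := by
    intro S hS a ha
    rw [Measure.bind_apply hS hκm.aemeasurable,
      ← lintegral_indicator_const Metric.isOpen_thickening.measurableSet]
    refine lintegral_mono fun y => ?_
    by_cases hy : y ∈ Metric.thickening δ S
    · simpa [hy] using ha y
    · simp [hy, hκ y S hS, hout S y hy]
  refine ⟨ν.bind κ, ?_, fun S hS => ⟨?_, ?_⟩⟩
  · rw [Measure.bind_apply MeasurableSet.univ hκm.aemeasurable]
    simp [hκ _ _ MeasurableSet.univ, ENNReal.inv_mul_cancel (hb0 _) (measure_ne_top lam _)]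
  · refine (hbound S hS 1 fun y => ?_).trans_eq (one_mul _)
    rw [hκ y S hS, ← ENNReal.inv_mul_cancel (hb0 y) (measure_ne_top lam _)]
    gcongr
    exact Set.inter_subset_right
  · refine hbound S hS _ fun y => ?_
    rw [hκ y S hS, mul_comm, div_eq_mul_inv]
    gcongr
    · exact Set.inter_subset_left
    · exact hlam y

/-- Smoothing by convolution: a finite measure concentrated on a set `K` can be replaced by a
measure of the same mass, dominated by a multiple of Haar measure, concentrated on the
`δ`-thickening of `K`, and satisfying the same ball bounds. -/
lemma exists_measure_smoothing {X : Type*} [NormedAddCommGroup X] [SecondCountableTopology X]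
    [MeasurableSpace X] [BorelSpace X] (μ : Measure X) [μ.IsAddHaarMeasure] [IsFiniteMeasure μ]
    (ν : Measure X) [IsFiniteMeasure ν] {K : Set X} (hK : ν Kᶜ = 0) {δ : ℝ} (hδ : 0 < δ) :
    ∃ ν' : Measure X, ν' Set.univ = ν Set.univ ∧
      (∃ M : ℝ, 0 ≤ M ∧ ∀ S, MeasurableSet S → ν' S ≤ ENNReal.ofReal M * μ S) ∧
      ν' (Metric.thickening δ K)ᶜ = 0 ∧
      ∀ r a, (∀ x, ν (Metric.ball x r) ≤ a) → ∀ x, ν' (Metric.ball x r) ≤ a := by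
  set v := μ (Metric.ball (0 : X) δ) with hv
  have hv0 : v ≠ 0 := (Metric.measure_ball_pos μ 0 hδ).ne'
  have hvtop : v ≠ ⊤ := measure_ne_top _ _
  set η : Measure X := v⁻¹ • μ.restrict (Metric.ball 0 δ) with hη
  have hη1 : η Set.univ = 1 := by
    simp [hη, ← hv, ENNReal.inv_mul_cancel hv0 hvtop]
  have : IsProbabilityMeasure η := ⟨hη1⟩
  have happ : ∀ S, MeasurableSet S → (ν ∗ η) S = ∫⁻ x, η ((x + ·) ⁻¹' S) ∂ν := by
    intro S hS
    rw [Measure.conv, Measure.map_apply (by fun_prop) hS,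
      Measure.prod_apply (measurable_add hS)]
    rfl
  have happ' : ∀ S, MeasurableSet S → (ν ∗ η) S = ∫⁻ y, ν ((· + y) ⁻¹' S) ∂η := by
    intro S hS
    rw [Measure.conv, Measure.map_apply (by fun_prop) hS,
      Measure.prod_apply_symm (measurable_add hS)]
    rfl
  have hηle : ∀ S, MeasurableSet S → η S ≤ v⁻¹ * μ S := by
    intro S hS
    rw [hη, Measure.smul_apply, smul_eq_mul]
    gcongr
    exact Measure.restrict_le_self
  refine ⟨ν ∗ η, ?_, ⟨(v⁻¹ * ν Set.univ).toReal, ENNReal.toReal_nonneg, fun S hS => ?_⟩, ?_, ?_⟩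
  · simp [happ _ MeasurableSet.univ]
  · rw [ENNReal.ofReal_toReal (ENNReal.mul_ne_top (ENNReal.inv_ne_top.2 hv0) (measure_ne_top _ _)),
      happ S hS]
    calc ∫⁻ x, η ((x + ·) ⁻¹' S) ∂ν ≤ ∫⁻ _, v⁻¹ * μ S ∂ν := by
          refine lintegral_mono fun x => (hηle _ (measurable_const_add x hS)).trans_eq ?_
          rw [measure_preimage_add]
      _ = _ := by rw [lintegral_const]; ring
  · rw [happ _ Metric.isOpen_thickening.measurableSet.compl, lintegral_eq_zero_iff']
    · have hKae : ∀ᵐ x ∂ν, x ∈ K := hK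
      filter_upwards [hKae] with x hx
      have : ((x + ·) ⁻¹' (Metric.thickening δ K)ᶜ) ∩ Metric.ball 0 δ = ∅ := by
        refine Set.eq_empty_of_forall_notMem fun z hz => hz.1 ?_
        exact Metric.mem_thickening_iff.2 ⟨x, hx, by simpa [dist_eq_norm] using hz.2⟩
      rw [hη, Measure.smul_apply, Measure.restrict_apply
        (measurable_const_add x Metric.isOpen_thickening.measurableSet.compl), this]
      simp
    · exact (measurable_measure_prodMk_left (ν := η)
        (measurable_add Metric.isOpen_thickening.measurableSet.compl)).aemeasurable
  · intro r a ha x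
    rw [happ' _ Metric.isOpen_ball.measurableSet]
    calc ∫⁻ y, ν ((· + y) ⁻¹' Metric.ball x r) ∂η ≤ ∫⁻ _, a ∂η := by
          refine lintegral_mono fun y => ?_
          simpa using ha (x - y)
      _ = a := by simp

/-- A measure with bounded density and a Hölder bound of exponent `t < s` can be redistributed at
every sufficiently small scale along a measure with a Hölder bound of exponent `s`, with
arbitrarily small loss in the Hölder constant. -/
lemma exists_redistribute_holder {X : Type*} [NormedAddCommGroup X] [SecondCountableTopology X]
    [MeasurableSpace X] [BorelSpace X] (μ : Measure X) [μ.IsAddHaarMeasure] [IsFiniteMeasure μ]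
    {D C C₁ c₀ s t M A A' : ℝ} (hC : 0 ≤ C) (hc₀ : 0 < c₀) (ht : 0 < t)
    (hts : t < s) (hM : 0 ≤ M) (hA : 0 < A) (hAA' : A < A')
    (hdoub : ∀ x δ, 0 < δ →
      μ (Metric.ball x (2 * δ)) ≤ ENNReal.ofReal D * μ (Metric.ball x (δ / 2)))
    (hμ : ∀ x r, 0 < r → μ (Metric.ball x r) ≤ ENNReal.ofReal (C₁ * r ^ s))
    (ν : Measure X) (hνM : ∀ S, MeasurableSet S → ν S ≤ ENNReal.ofReal M * μ S)
    (hνA : ∀ x r, 0 < r → ν (Metric.ball x r) ≤ ENNReal.ofReal (A * r ^ t)) :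
    ∃ δ₀ > 0, ∀ δ, 0 < δ → δ < δ₀ → ∀ (lam : Measure X) [IsFiniteMeasure lam],
      (∀ x r, 0 < r → lam (Metric.ball x r) ≤ ENNReal.ofReal (C * r ^ s)) →
      (∀ y, ENNReal.ofReal c₀ * μ (Metric.ball y (δ / 2)) ≤ lam (Metric.ball y δ)) →
      ∃ ν' : Measure X, ν' Set.univ = ν Set.univ ∧
        (∀ S, MeasurableSet S → ν' S ≤ ν (Metric.thickening δ S)) ∧
        (∀ S, MeasurableSet S → lam S = 0 → ν' S = 0) ∧
        ∀ x r, 0 < r → ν' (Metric.ball x r) ≤ ENNReal.ofReal (A' * r ^ t) := by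
  set L := max (C * M * D / c₀) (M * C₁ * 2 ^ s) with hL
  have hst : 0 < s - t := sub_pos.2 hts
  have hA' : 0 < A' := hA.trans hAA'
  obtain ⟨r₀, hr₀, hLr₀⟩ : ∃ r₀ > 0, ∀ r, 0 < r → r ≤ r₀ → L * r ^ s ≤ A' * r ^ t := by
    have hlim : Tendsto (fun r : ℝ => L * r ^ (s - t)) (nhds 0) (nhds 0) := by
      have := (Real.continuousAt_rpow_const 0 (s - t) (Or.inr hst.le)).tendsto.const_mul L
      simpa [Real.zero_rpow hst.ne'] using this
    obtain ⟨ρ, hρ, h⟩ := Metric.eventually_nhds_iff.1 (hlim.eventually (gt_mem_nhds hA'))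
    refine ⟨ρ / 2, by positivity, fun r hr hrρ => ?_⟩
    have h1 : L * r ^ (s - t) < A' := h (by
      rw [Real.dist_eq, sub_zero, abs_of_pos hr]; linarith)
    have h2 : r ^ s = r ^ (s - t) * r ^ t := by rw [← Real.rpow_add hr]; ring_nf
    rw [h2, ← mul_assoc]
    gcongr
  obtain ⟨δ₀, hδ₀, hAδ₀⟩ : ∃ δ₀ > 0, ∀ δ, 0 < δ → δ < δ₀ → A * (1 + δ / r₀) ^ t ≤ A' := by
    have hlim : Tendsto (fun δ : ℝ => A * (1 + δ / r₀) ^ t) (nhds 0) (nhds A) := by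
      have h1 : ContinuousAt (fun δ : ℝ => A * (1 + δ / r₀) ^ t) 0 := by
        refine continuousAt_const.mul (ContinuousAt.rpow_const ?_ (Or.inr ht.le))
        fun_prop
      simpa [ContinuousAt] using h1
    obtain ⟨ρ, hρ, h⟩ := Metric.eventually_nhds_iff.1 (hlim.eventually (gt_mem_nhds hAA'))
    refine ⟨ρ, hρ, fun δ hδ hδρ => (h ?_).le⟩
    rwa [Real.dist_eq, sub_zero, abs_of_pos hδ]
  refine ⟨δ₀, hδ₀, fun δ hδ hδδ₀ lam _ hlamC hlamc => ?_⟩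
  set v := μ (Metric.ball (0 : X) (δ / 2)) with hv
  have hvx : ∀ x, μ (Metric.ball x (δ / 2)) = v := fun x => μ.addHaar_ball_center x _
  have hv0 : v ≠ 0 := (Metric.measure_ball_pos μ 0 (by positivity)).ne'
  have hvtop : v ≠ ⊤ := measure_ne_top _ _
  have hc0 : ENNReal.ofReal c₀ ≠ 0 := by simpa using hc₀
  have hc : 0 < ENNReal.ofReal c₀ * v := ENNReal.mul_pos hc0 hv0
  obtain ⟨ν', hν'1, hν'⟩ := exists_measure_redistribute ν lam hc
    (fun y => by simpa [hvx] using hlamc y)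
  have hth : ∀ (x : X) (r : ℝ), Metric.thickening δ (Metric.ball x r) ⊆ Metric.ball x (r + δ) := by
    intro x r y hy
    obtain ⟨z, hz, hyz⟩ := Metric.mem_thickening_iff.1 hy
    rw [Metric.mem_ball] at hz ⊢
    linarith [dist_triangle y z x]
  refine ⟨ν', hν'1, fun S hS => (hν' S hS).1, fun S hS h0 => ?_, fun x r hr => ?_⟩
  · simpa [h0] using (hν' S hS).2
  obtain ⟨h1, h2⟩ := hν' _ (Metric.isOpen_ball (x := x) (ε := r)).measurableSet
  rcases le_or_gt r r₀ with hrr₀ | hrr₀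
  · have hrs : 0 ≤ r ^ s := Real.rpow_nonneg hr.le s
    refine le_trans ?_ (ENNReal.ofReal_le_ofReal (hLr₀ r hr hrr₀))
    rcases lt_or_ge r δ with hrδ | hrδ
    · calc ν' (Metric.ball x r)
          ≤ lam (Metric.ball x r) / (ENNReal.ofReal c₀ * v)
              * ν (Metric.thickening δ (Metric.ball x r)) := h2
        _ ≤ ENNReal.ofReal (C * r ^ s) / (ENNReal.ofReal c₀ * v)
              * (ENNReal.ofReal M * (ENNReal.ofReal D * v)) := by
            gcongr
            · exact hlamC x r hr
            · calc ν (Metric.thickening δ (Metric.ball x r))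
                  ≤ ν (Metric.ball x (2 * δ)) := measure_mono
                    ((hth x r).trans (Metric.ball_subset_ball (by linarith)))
                _ ≤ ENNReal.ofReal M * μ (Metric.ball x (2 * δ)) :=
                    hνM _ Metric.isOpen_ball.measurableSet
                _ ≤ _ := by
                    gcongr
                    simpa [hvx] using hdoub x δ hδ
        _ = ENNReal.ofReal (C * r ^ s) * ENNReal.ofReal M * ENNReal.ofReal D
              / ENNReal.ofReal c₀ := by
            rw [div_eq_mul_inv, div_eq_mul_inv,
              ENNReal.mul_inv (Or.inl hc0) (Or.inl ENNReal.ofReal_ne_top)]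
            calc _ = ENNReal.ofReal (C * r ^ s) * ENNReal.ofReal M * ENNReal.ofReal D
                    * (ENNReal.ofReal c₀)⁻¹ * (v⁻¹ * v) := by ring
              _ = _ := by rw [ENNReal.inv_mul_cancel hv0 hvtop, mul_one]
        _ = ENNReal.ofReal (C * M * D / c₀ * r ^ s) := by
            rw [← ENNReal.ofReal_mul (by positivity), ← ENNReal.ofReal_mul (by positivity),
              ← ENNReal.ofReal_div_of_pos hc₀]
            congr 1
            ring
        _ ≤ ENNReal.ofReal (L * r ^ s) := by
            gcongr
            exact le_max_left _ _
    · calc ν' (Metric.ball x r) ≤ ν (Metric.thickening δ (Metric.ball x r)) := h1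
        _ ≤ ν (Metric.ball x (2 * r)) := measure_mono
            ((hth x r).trans (Metric.ball_subset_ball (by linarith)))
        _ ≤ ENNReal.ofReal M * μ (Metric.ball x (2 * r)) :=
            hνM _ Metric.isOpen_ball.measurableSet
        _ ≤ ENNReal.ofReal M * ENNReal.ofReal (C₁ * (2 * r) ^ s) := by
            gcongr
            exact hμ x _ (by positivity)
        _ = ENNReal.ofReal (M * C₁ * 2 ^ s * r ^ s) := by
            rw [← ENNReal.ofReal_mul hM, Real.mul_rpow (by norm_num) hr.le]
            congr 1
            ring
        _ ≤ ENNReal.ofReal (L * r ^ s) := by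
            gcongr
            exact le_max_right _ _
  · calc ν' (Metric.ball x r) ≤ ν (Metric.thickening δ (Metric.ball x r)) := h1
      _ ≤ ν (Metric.ball x (r + δ)) := measure_mono (hth x r)
      _ ≤ ENNReal.ofReal (A * (r + δ) ^ t) := hνA x _ (by positivity)
      _ ≤ ENNReal.ofReal (A' * r ^ t) := by
          refine ENNReal.ofReal_le_ofReal ?_
          calc A * (r + δ) ^ t ≤ A * ((1 + δ / r₀) * r) ^ t := by
                gcongr
                have : δ ≤ δ / r₀ * r := by
                  rw [div_mul_eq_mul_div, le_div_iff₀ hr₀]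
                  gcongr
                linarith
            _ = A * (1 + δ / r₀) ^ t * r ^ t := by
                rw [Real.mul_rpow (by positivity) hr.le]
                ring
            _ ≤ A' * r ^ t := by
                gcongr
                exact hAδ₀ δ hδ hδδ₀

/-- `ν` is a finite measure of mass larger than `1 / 2` concentrated on `U`, dominated by a multiple
of `μ`, and with a Hölder bound of exponent `t` and constant smaller than `B`. -/
structure IsHolderOn {X : Type*} [MetricSpace X] [MeasurableSpace X] (μ : Measure X) (t B : ℝ)
    (U : Set X) (ν : Measure X) : Prop where
  compl : ν Uᶜ = 0
  half_lt : 1 / 2 < ν Set.univ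
  density : ∃ M : ℝ, 0 ≤ M ∧ ∀ S, MeasurableSet S → ν S ≤ ENNReal.ofReal M * μ S
  holder : ∃ A, 0 < A ∧ A < B ∧
    ∀ x r, 0 < r → ν (Metric.ball x r) ≤ ENNReal.ofReal (A * r ^ t)

/-- Inductive step of the Cantor-type construction: pass from `U` to an open set whose closure lies in
`U ∩ E n` for some large `n`. -/
lemma exists_isHolderOn_closure_subset {X : Type*} [NormedAddCommGroup X] [CompactSpace X]
    [MeasurableSpace X] [BorelSpace X] (μ : Measure X) [μ.IsAddHaarMeasure]
    {D C C₁ c₀ s t B : ℝ} (hC : 0 ≤ C) (hc₀ : 0 < c₀) (ht : 0 < t) (hts : t < s)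
    (hdoub : ∀ x δ, 0 < δ →
      μ (Metric.ball x (2 * δ)) ≤ ENNReal.ofReal D * μ (Metric.ball x (δ / 2)))
    (hμ : ∀ x r, 0 < r → μ (Metric.ball x r) ≤ ENNReal.ofReal (C₁ * r ^ s))
    (E : ℕ → Set X) (hE : ∀ n, IsOpen (E n)) (μn : ℕ → Measure X)
    [∀ n, IsFiniteMeasure (μn n)] (hsupp : ∀ n, μn n (E n)ᶜ = 0)
    (hlower : ∀ δ, 0 < δ → ∀ᶠ n in atTop, ∀ y,
      ENNReal.ofReal c₀ * μ (Metric.ball y (δ / 2)) ≤ μn n (Metric.ball y δ))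
    (hholder : ∀ n x r, 0 < r → μn n (Metric.ball x r) ≤ ENNReal.ofReal (C * r ^ s))
    {U : Set X} (hU : IsOpen U) {ν : Measure X} (hν : IsHolderOn μ t B U ν) (N : ℕ) :
    ∃ n ≥ N, ∃ V, IsOpen V ∧ closure V ⊆ U ∩ E n ∧ ∃ ν', IsHolderOn μ t B V ν' := by
  obtain ⟨hνU, hνhalf, ⟨M, hM, hνM⟩, ⟨A, hA, hAB, hνA⟩⟩ := hν
  have hfin : ∀ {ρ : Measure X} {M : ℝ},
      (∀ S, MeasurableSet S → ρ S ≤ ENNReal.ofReal M * μ S) → IsFiniteMeasure ρ := fun h =>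
    ⟨(h _ MeasurableSet.univ).trans_lt
      (ENNReal.mul_lt_top ENNReal.ofReal_lt_top (measure_lt_top _ _))⟩
  have := hfin hνM
  have huniv : ∀ (ρ : Measure X) (S : Set X), ρ Sᶜ = 0 → ρ Set.univ = ρ S := fun ρ S h =>
    (measure_congr (ae_eq_univ.2 h)).symm
  rw [huniv ν U hνU] at hνhalf
  obtain ⟨K, hKU, hK, hνK⟩ := hU.exists_lt_isCompact hνhalf
  obtain ⟨δ₁, hδ₁, hKδ₁⟩ := hK.exists_thickening_subset_open hU hKU
  have hres : ∀ (ρ : Measure X) (T S : Set X), ρ.restrict T S ≤ ρ S := fun ρ T S =>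
    Measure.restrict_le_self S
  obtain ⟨A', hAA', hA'B⟩ := exists_between hAB
  obtain ⟨δ₀, hδ₀, hstep⟩ := exists_redistribute_holder μ hC hc₀ ht hts hM hA hAA' hdoub hμ
    (ν.restrict K) (fun S hS => (hres _ _ _).trans (hνM S hS))
    (fun x r hr => (hres _ _ _).trans (hνA x r hr))
  obtain ⟨δ, hδ, hδlt⟩ := exists_between (lt_min hδ₀ hδ₁)
  obtain ⟨n, hnδ, hnN⟩ := ((hlower δ hδ).and (eventually_ge_atTop N)).exists
  obtain ⟨ν₁, hν₁univ, hν₁th, hν₁zero, hν₁A⟩ :=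
    hstep δ hδ (hδlt.trans_le (min_le_left _ _)) (μn n) (hholder n) hnδ
  have : IsFiniteMeasure ν₁ := ⟨hν₁univ ▸ measure_lt_top _ _⟩
  have hUE : IsOpen (U ∩ E n) := hU.inter (hE n)
  have hν₁U : ν₁ Uᶜ = 0 := by
    refine le_antisymm ((hν₁th _ hU.measurableSet.compl).trans ?_) bot_le
    rw [Measure.restrict_apply Metric.isOpen_thickening.measurableSet]
    have : Metric.thickening δ Uᶜ ∩ K = ∅ := by
      refine Set.eq_empty_of_forall_notMem fun y hy => ?_
      obtain ⟨z, hz, hyz⟩ := Metric.mem_thickening_iff.1 hy.1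
      refine hz (hKδ₁ (Metric.mem_thickening_iff.2 ⟨y, hy.2, ?_⟩))
      rw [dist_comm]
      exact hyz.trans (hδlt.trans_le (min_le_right _ _))
    simp [this]
  have hν₁UE : ν₁ (U ∩ E n)ᶜ = 0 := by
    rw [Set.compl_inter]
    exact measure_union_null hν₁U (hν₁zero _ (hE n).measurableSet.compl (hsupp n))
  have hν₁half : 1 / 2 < ν₁ (U ∩ E n) := by
    rw [← huniv ν₁ _ hν₁UE, hν₁univ, Measure.restrict_apply_univ]
    exact hνK
  obtain ⟨K', hK'U, hK', hν₁K'⟩ := hUE.exists_lt_isCompact hν₁half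
  obtain ⟨ε, hε, hK'ε⟩ := hK'.exists_cthickening_subset_open hUE hK'U
  obtain ⟨ν₂, hν₂univ, hν₂M, hν₂K', hν₂A⟩ := exists_measure_smoothing μ (ν₁.restrict K')
    (K := K') (by simp [Measure.restrict_apply hK'.measurableSet.compl]) hε
  refine ⟨n, hnN, Metric.thickening ε K', Metric.isOpen_thickening,
    (Metric.closure_thickening_subset_cthickening _ _).trans hK'ε, ν₂, hν₂K', ?_, hν₂M,
    A', hA.trans hAA', hA'B, fun x r hr => ?_⟩
  · rw [hν₂univ, Measure.restrict_apply_univ]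
    exact hν₁K'
  · exact hν₂A r _ (fun y => (hres _ _ _).trans (hν₁A y r hr)) x

lemma volume_ball_pi_addCircle {d : ℕ} (x : Fin d → AddCircle (1 : ℝ)) {r : ℝ} (hr : 0 < r) :
    volume (Metric.ball x r) = ENNReal.ofReal (min 1 (2 * r)) ^ d := by
  rw [volume_pi_ball x hr]
  simp [← measure_congr (AddCircle.closedBall_ae_eq_ball (T := (1 : ℝ))),
    AddCircle.volume_closedBall]

lemma volume_ball_pi_addCircle_doubling {d : ℕ} (x : Fin d → AddCircle (1 : ℝ)) {δ : ℝ}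
    (hδ : 0 < δ) : volume (Metric.ball x (2 * δ)) ≤
      ENNReal.ofReal (4 ^ d) * volume (Metric.ball x (δ / 2)) := by
  rw [volume_ball_pi_addCircle x (by positivity), volume_ball_pi_addCircle x (by positivity),
    ENNReal.ofReal_pow (by norm_num), ← mul_pow, ← ENNReal.ofReal_mul (by norm_num)]
  gcongr
  rw [mul_min_of_nonneg _ _ (by norm_num)]
  exact min_le_min (by norm_num) (by linarith)

/-- A pointwise lower bound for the liminf of the measures of balls relative to `μ` is uniform over
all centres in a compact space. -/
lemma eventually_forall_le_measure_ball {X : Type*} [MetricSpace X] [CompactSpace X]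
    [MeasurableSpace X] (μ : Measure X) {c a : ℝ≥0∞} (hca : c < a) (μn : ℕ → Measure X)
    {δ : ℝ} (hδ : 0 < δ) {v : ℝ≥0∞} (hv0 : v ≠ 0) (hvtop : v ≠ ⊤)
    (hv : ∀ x, μ (Metric.ball x (δ / 2)) = v)
    (hlower : ∀ x, a ≤ liminf (fun n => μn n (Metric.ball x (δ / 2)) /
      μ (Metric.ball x (δ / 2))) atTop) :
    ∀ᶠ n in atTop, ∀ y, c * v ≤ μn n (Metric.ball y δ) := by
  obtain ⟨s, -, hs⟩ := isCompact_univ.elim_nhds_subcover (fun x : X => Metric.ball x (δ / 2))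
    fun x _ => Metric.ball_mem_nhds x (by positivity)
  have hev : ∀ᶠ n in atTop, ∀ x ∈ s, c < μn n (Metric.ball x (δ / 2)) / v := by
    refine (eventually_all_finset s).2 fun x _ => ?_
    have := eventually_lt_of_lt_liminf (hca.trans_le (hlower x))
    simpa only [hv] using this
  filter_upwards [hev] with n hn y
  obtain ⟨x, hx, hyx⟩ := Set.mem_iUnion₂.1 (hs (Set.mem_univ y))
  have h1 := ((ENNReal.lt_div_iff_mul_lt (Or.inl hv0) (Or.inl hvtop)).1 (hn x hx)).le
  refine h1.trans (measure_mono (Metric.ball_subset_ball' ?_))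
  rw [Metric.mem_ball, dist_comm] at hyx
  linarith

lemma measure_ball_le_of_le_liminf {X : Type*} [MetricSpace X] [MeasurableSpace X]
    (μ : Measure X) (μn : ℕ → Measure X) {S : Set X} {C b : ℝ≥0∞} (hC0 : C ≠ 0) (hC : C ≠ ⊤)
    (hS0 : μ S ≠ 0) (hS : μ S ≠ ⊤) (hlower : C⁻¹ ≤ liminf (fun n => μn n S / μ S) atTop)
    (hb : ∀ n, μn n S ≤ b) : μ S ≤ C * b := by
  have h1 : liminf (fun n => μn n S / μ S) atTop ≤ b / μ S := by
    refine (liminf_le_liminf (v := fun _ => b / μ S) (Eventually.of_forall fun n => ?_)).trans_eq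
      (by simp)
    exact ENNReal.div_le_div_right (hb n) _
  have h2 := (ENNReal.le_div_iff_mul_le (Or.inl hS0) (Or.inl hS)).1 (hlower.trans h1)
  calc μ S = C * (C⁻¹ * μ S) := by rw [← mul_assoc, ENNReal.mul_inv_cancel hC0 hC, one_mul]
    _ ≤ C * b := by gcongr

/-- Persson–Reeve type lemma: if open sets `Eₙ ⊆ 𝕋^d` carry probability
measures `μₙ` (supported on `Eₙ`) whose values on balls are comparable to
Lebesgue measure `μ` in the limit, and `μₙ(B) ≤ C rˢ` for every ball `B` of
radius `r`, then `dim_H (limsup Eₙ) ≥ s`. -/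
theorem dimH_limsup_ge (d : ℕ) (hd : 1 ≤ d)
    (E : ℕ → Set (Fin d → AddCircle (1 : ℝ)))
    (hopen : ∀ n, IsOpen (E n))
    (μn : ℕ → Measure (Fin d → AddCircle (1 : ℝ)))
    (hprob : ∀ n, IsProbabilityMeasure (μn n))
    (hsupp : ∀ n, μn n (E n)ᶜ = 0)
    (C : ℝ≥0∞) (hC0 : 0 < C) (hCtop : C < ⊤) (s : ℝ) (hs : 0 < s)
    (hlower : ∀ (x : Fin d → AddCircle (1 : ℝ)) (r : ℝ), 0 < r →
      C⁻¹ ≤ liminf (fun n => μn n (Metric.ball x r) / volume (Metric.ball x r)) atTop)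
    (hupper : ∀ (x : Fin d → AddCircle (1 : ℝ)) (r : ℝ), 0 < r →
      limsup (fun n => μn n (Metric.ball x r) / volume (Metric.ball x r)) atTop ≤ C)
    (hholder : ∀ (n : ℕ) (x : Fin d → AddCircle (1 : ℝ)) (r : ℝ), 0 < r →
      μn n (Metric.ball x r) ≤ C * ENNReal.ofReal (r ^ s)) :
    ENNReal.ofReal s ≤ dimH (⋂ N, ⋃ n, ⋃ (_ : N ≤ n), E n) := by
  set μ : Measure (Fin d → AddCircle (1 : ℝ)) := volume with hμdef
  have hμ1 : μ Set.univ = 1 := by simp [hμdef, volume_pi, Measure.pi_univ]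
  have : IsProbabilityMeasure μ := ⟨hμ1⟩
  refine le_of_not_gt fun hlt => ?_
  obtain ⟨t, hdimt, hts⟩ := ENNReal.lt_iff_exists_nnreal_btwn.1 hlt
  have hts' : (t : ℝ) < s := by
    rwa [← ENNReal.ofReal_coe_nnreal, ENNReal.ofReal_lt_ofReal_iff hs] at hts
  have ht : 0 < (t : ℝ) := by exact_mod_cast (zero_le.trans_lt hdimt : (0 : ℝ≥0∞) < t)
  have hCr : 0 < C.toReal := ENNReal.toReal_pos hC0.ne' hCtop.ne
  have hCeq : ENNReal.ofReal C.toReal = C := ENNReal.ofReal_toReal hCtop.ne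
  have hholder' : ∀ n x r, 0 < r →
      μn n (Metric.ball x r) ≤ ENNReal.ofReal (C.toReal * r ^ s) := by
    intro n x r hr
    rw [ENNReal.ofReal_mul hCr.le, hCeq]
    exact hholder n x r hr
  have hμball : ∀ x r, 0 < r →
      μ (Metric.ball x r) ≤ ENNReal.ofReal (C.toReal * C.toReal * r ^ s) := by
    intro x r hr
    rw [mul_assoc, ENNReal.ofReal_mul hCr.le, hCeq]
    exact measure_ball_le_of_le_liminf μ μn hC0.ne' hCtop.ne
      (Metric.measure_ball_pos μ x hr).ne' (measure_ne_top _ _) (hlower x r hr)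
      fun n => hholder' n x r hr
  have hlower' : ∀ δ, 0 < δ → ∀ᶠ n in atTop, ∀ y,
      ENNReal.ofReal (C.toReal⁻¹ / 2) * μ (Metric.ball y (δ / 2)) ≤ μn n (Metric.ball y δ) := by
    intro δ hδ
    have hca : ENNReal.ofReal (C.toReal⁻¹ / 2) < C⁻¹ := by
      rw [← hCeq, ← ENNReal.ofReal_inv_of_pos hCr, ENNReal.ofReal_lt_ofReal_iff (by positivity),
        hCeq]
      exact half_lt_self (by positivity)
    have hcen : ∀ x, μ (Metric.ball x (δ / 2)) = μ (Metric.ball 0 (δ / 2)) := fun x =>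
      μ.addHaar_ball_center x _
    simpa only [hcen] using eventually_forall_le_measure_ball μ hca μn hδ
      (Metric.measure_ball_pos μ 0 (by positivity)).ne' (measure_ne_top _ _) hcen
      fun x => hlower x _ (by positivity)
  set B : ℝ := C.toReal * C.toReal + 2 with hB
  have hinit : IsHolderOn μ t B Set.univ μ := by
    refine ⟨by simp, by simp [hμ1], ⟨1, zero_le_one, fun S _ => by simp⟩,
      C.toReal * C.toReal + 1, by positivity, by simp [hB], fun x r hr => ?_⟩
    rcases le_total r 1 with hr1 | hr1
    · refine (hμball x r hr).trans (ENNReal.ofReal_le_ofReal ?_)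
      have := Real.rpow_le_rpow_of_exponent_ge hr hr1 hts'.le
      gcongr
      linarith
    · refine prob_le_one.trans ?_
      rw [ENNReal.one_le_ofReal]
      have := Real.one_le_rpow hr1 ht.le
      nlinarith [mul_pos hCr hCr]
  let Good := {U : Set (Fin d → AddCircle (1 : ℝ)) // IsOpen U ∧ ∃ ν, IsHolderOn μ t B U ν}
  have hstep : ∀ (k : ℕ) (U : Good), ∃ V : Good, ∃ n ≥ k, closure V.1 ⊆ U.1 ∩ E n := by
    rintro k ⟨U, hU, ν, hν⟩
    obtain ⟨n, hn, V, hV, hVU, hν'⟩ := exists_isHolderOn_closure_subset μ hCr.le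
      (by positivity) ht hts' (fun x δ hδ => volume_ball_pi_addCircle_doubling x hδ) hμball E
      hopen μn hsupp hlower' hholder' hU hν k
    exact ⟨⟨V, hV, hν'⟩, n, hn, hVU⟩
  choose next idx hidx hnext using hstep
  let U : ℕ → Good := fun k => Nat.rec ⟨Set.univ, isOpen_univ, μ, hinit⟩ next k
  have hUsucc : ∀ k, closure (U (k + 1)).1 ⊆ (U k).1 ∩ E (idx k (U k)) := fun k =>
    hnext k (U k)
  have hsub : (⋂ k, (U k).1) ⊆ ⋂ N, ⋃ n, ⋃ (_ : N ≤ n), E n := by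
    intro x hx
    simp only [Set.mem_iInter, Set.mem_iUnion] at hx ⊢
    exact fun N => ⟨_, hidx N (U N), (hUsucc N (subset_closure (hx (N + 1)))).2⟩
  refine hausdorffMeasure_iInter_ne_zero_s13 (A := B) ht (U := fun k => (U k).1) (m := 1 / 2)
    (fun k => (hUsucc k).trans Set.inter_subset_left) (by simp) (fun k => ?_)
    (measure_mono_null hsub (hausdorffMeasure_of_dimH_lt hdimt))
  obtain ⟨ν, hν0, hνhalf, -, A, -, hAB, hνA⟩ := (U k).2.2
  refine ⟨ν, hν0, hνhalf.le, fun x r hr => (hνA x r hr).trans (ENNReal.ofReal_le_ofReal ?_)⟩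
  gcongr
end
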